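/- arXiv:1701.04365 — 4 statements merged into one kernel-verified Lean document; each statement's English description precedes it below -/
import Mathlib

section
/- There exist a continuous function f : ℝ → ℝ with f(x) > 0 for every x and ∫_ℝ f = 1, and a constant C such that: (a) the laws of (Q_n − q_n)/n converge weakly, as n → ∞, to the probability measure on ℝ whose density with respect to Lebesgue measure is f; and (b) for every integer n ≥ 2 and every integer x, |P(Q_n = x) − n^{−1} f((x − q_n)/n)| ≤ C n^{−19/18} log n. -/
open MeasureTheory ProbabilityTheory Filter BoundedContinuousFunction

/-- Binary convolution of laws on `ℤ` (the law of the sum of independent variables). -/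
noncomputable def mconvZ (μ ν : Measure ℤ) : Measure ℤ :=
  μ.bind (fun x => ν.map (fun y => x + y))

/-- `μ n` is the law of `Q_n`, the number of key comparisons used by QuickSort on `n` keys. -/
def IsQuicksortLaw (μ : ℕ → Measure ℤ) : Prop :=
  (∀ n, IsProbabilityMeasure (μ n)) ∧
  μ 0 = Measure.dirac 0 ∧ μ 1 = Measure.dirac 0 ∧
  ∀ n : ℕ, 2 ≤ n →
    μ n = (n : ENNReal)⁻¹ •
      ∑ u ∈ Finset.Icc 1 n,
        (mconvZ (μ (u - 1)) (μ (n - u))).map (fun x => x + ((n : ℤ) - 1))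

/-- The mean `q_n = E Q_n` of a law on `ℤ`. -/
noncomputable def meanZ (ν : Measure ℤ) : ℝ := ∫ k, (k : ℝ) ∂ν

lemma mconvZ_eq_map_prod (μ ν : Measure ℤ) [SFinite ν] :
    mconvZ μ ν = (μ.prod ν).map (fun p => p.1 + p.2) := by
  ext s hs
  rw [mconvZ, Measure.bind_apply hs (Measurable.of_discrete).aemeasurable,
    Measure.map_apply Measurable.of_discrete hs, Measure.prod_apply (Measurable.of_discrete hs)]
  refine lintegral_congr fun x => ?_
  rw [Measure.map_apply Measurable.of_discrete hs]
  rfl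

section Law

variable {μ : ℕ → Measure ℤ}

lemma IsQuicksortLaw.eq_sum_prod (hμ : IsQuicksortLaw μ) {n : ℕ} (hn : 1 ≤ n) :
    μ n = (n : ENNReal)⁻¹ • ∑ k ∈ Finset.range n,
      ((μ k).prod (μ (n - 1 - k))).map (fun p : ℤ × ℤ => p.1 + p.2 + ((n : ℤ) - 1)) := by
  have := hμ.1
  rcases hn.eq_or_lt with rfl | hn
  · simp [hμ.2.1, hμ.2.2.1, Measure.dirac_prod_dirac, Measure.map_dirac]
  · rw [hμ.2.2.2 n hn, Finset.range_eq_Ico, Finset.sum_Ico_eq_sum_range]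
    congr 1
    rw [show Finset.Icc 1 n = Finset.Ico 1 (n + 1) by ext; simp,
      Finset.sum_Ico_eq_sum_range]
    refine Finset.sum_congr (by simp) fun k hk => ?_
    rw [mconvZ_eq_map_prod, Measure.map_map Measurable.of_discrete Measurable.of_discrete]
    have h1 : 1 + k - 1 = 0 + k := by omega
    have h2 : n - (1 + k) = n - 1 - (0 + k) := by omega
    rw [h1, h2]
    rfl

/-- The law of `Q_n` is carried by `[0, n²]`. -/
lemma IsQuicksortLaw.ae_mem_Icc (hμ : IsQuicksortLaw μ) (n : ℕ) :
    ∀ᵐ k ∂μ n, k ∈ Set.Icc (0 : ℤ) ((n : ℤ) ^ 2) := by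
  have := hμ.1
  induction n using Nat.strong_induction_on with
  | _ n ih =>
    rcases Nat.eq_zero_or_pos n with rfl | hn
    · rw [hμ.2.1, ae_dirac_eq]; simp
    · rw [hμ.eq_sum_prod hn, ae_iff]
      simp only [Measure.smul_apply, Measure.finsetSum_apply, smul_eq_mul]
      rw [Finset.sum_eq_zero, mul_zero]
      intro k hk
      rw [Finset.mem_range] at hk
      rw [← ae_iff, ae_map_iff Measurable.of_discrete.aemeasurable (MeasurableSet.of_discrete)]
      have h1 := Measure.quasiMeasurePreserving_fst (μ := μ k) (ν := μ (n - 1 - k)) |>.ae (ih k hk)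
      have h2 := Measure.quasiMeasurePreserving_snd (μ := μ k) (ν := μ (n - 1 - k)) |>.ae
        (ih (n - 1 - k) (by omega))
      filter_upwards [h1, h2] with p hp1 hp2
      obtain ⟨l, rfl⟩ : ∃ l, n = k + l + 1 := ⟨n - 1 - k, by omega⟩
      simp only [show k + l + 1 - 1 - k = l by omega, Set.mem_Icc] at hp1 hp2 ⊢
      push_cast
      have hk0 : (0 : ℤ) ≤ k := by positivity
      have hl0 : (0 : ℤ) ≤ l := by positivity
      constructor
      · linarith [hp1.1, hp2.1]
      · nlinarith [hp1.2, hp2.2, mul_nonneg hk0 hl0]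

lemma IsQuicksortLaw.integrable (hμ : IsQuicksortLaw μ) {E : Type*} [NormedAddCommGroup E]
    (n : ℕ) (F : ℤ → E) : Integrable F (μ n) := by
  have := hμ.1 n
  classical
  refine Integrable.of_bound (C := ∑ k ∈ Finset.Icc (0 : ℤ) ((n : ℤ) ^ 2), ‖F k‖)
    (StronglyMeasurable.of_discrete).aestronglyMeasurable ?_
  filter_upwards [hμ.ae_mem_Icc n] with k hk
  exact Finset.single_le_sum (f := fun k => ‖F k‖) (fun _ _ => norm_nonneg _)
    (Finset.mem_Icc.2 hk)

lemma IsQuicksortLaw.integral_eq (hμ : IsQuicksortLaw μ) {E : Type*} [NormedAddCommGroup E]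
    [NormedSpace ℝ E] {n : ℕ} (hn : 1 ≤ n) (F : ℤ → E) :
    ∫ z, F z ∂μ n = (n : ℝ)⁻¹ • ∑ k ∈ Finset.range n,
      ∫ x, ∫ y, F (x + y + ((n : ℤ) - 1)) ∂μ (n - 1 - k) ∂μ k := by
  have := hμ.1
  have hint : ∀ k ∈ Finset.range n, Integrable F
      (((μ k).prod (μ (n - 1 - k))).map (fun p : ℤ × ℤ => p.1 + p.2 + ((n : ℤ) - 1))) := by
    intro k hk
    have h := hμ.integrable n F
    rw [hμ.eq_sum_prod hn, integrable_smul_measure (by simp) (by simp; omega),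
      integrable_finsetSum_measure] at h
    exact h k hk
  rw [hμ.eq_sum_prod hn, integral_smul_measure, integral_finsetSum_measure hint]
  simp only [ENNReal.toReal_inv, ENNReal.toReal_natCast]
  congr 1
  refine Finset.sum_congr rfl fun k hk => ?_
  have h := hint k hk
  have hm : AEMeasurable (fun p : ℤ × ℤ => p.1 + p.2 + ((n : ℤ) - 1))
      ((μ k).prod (μ (n - 1 - k))) := Measurable.of_discrete.aemeasurable
  rw [integrable_map_measure h.aestronglyMeasurable hm] at h
  rw [integral_map hm (hint k hk).aestronglyMeasurable]
  exact integral_prod _ h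

end Law

namespace QuickSort

section Toll

/-- Closed form `2 (n + 1) H_n - 4 n` of the mean number of comparisons. -/
noncomputable def qsMean (n : ℕ) : ℝ := 2 * ((n : ℝ) + 1) * (harmonic n : ℝ) - 4 * n

/-- The centred toll of the first partitioning step, when the smaller part has `k` keys. -/
noncomputable def toll (n k : ℕ) : ℝ :=
  (n : ℝ) - 1 + qsMean k + qsMean (n - 1 - k) - qsMean n

@[simp] lemma qsMean_zero : qsMean 0 = 0 := by simp [qsMean]

lemma harmonic_succ_real (n : ℕ) :
    ((harmonic (n + 1) : ℚ) : ℝ) = harmonic n + 1 / ((n : ℝ) + 1) := by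
  rw [harmonic_succ]; push_cast; ring

lemma sum_qsMean (n : ℕ) :
    2 * ∑ k ∈ Finset.range n, qsMean k = n * (qsMean n - (n - 1)) := by
  induction n with
  | zero => simp
  | succ n ih =>
    rw [Finset.sum_range_succ, mul_add, ih, qsMean, qsMean, harmonic_succ_real]
    push_cast
    field_simp
    ring

lemma sum_toll (n : ℕ) : ∑ k ∈ Finset.range n, toll n k = 0 := by
  have h := sum_qsMean n
  have h2 := Finset.sum_range_reflect qsMean n
  simp only [toll, Finset.sum_sub_distrib, Finset.sum_add_distrib, h2, Finset.sum_const,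
    Finset.card_range, nsmul_eq_mul, ← mul_sub]
  linarith

lemma toll_eq {n k : ℕ} (hk : k < n) :
    toll n k = n + 3 - 2 * (((k : ℝ) + 1) * (harmonic n - harmonic k) +
      ((n - 1 - k : ℕ) + 1 : ℝ) * (harmonic n - harmonic (n - 1 - k))) := by
  obtain ⟨l, rfl⟩ : ∃ l, n = k + l + 1 := ⟨n - 1 - k, by omega⟩
  simp only [show k + l + 1 - 1 - k = l by omega, toll, qsMean]
  push_cast
  ring

lemma harmonic_sub_le_log {n k : ℕ} (hk : k < n) :
    (harmonic n : ℝ) - harmonic k ≤ 1 / ((k : ℝ) + 1) + Real.log (n / (k + 1)) := by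
  have h := Real.strictAnti_eulerMascheroniSeq'.antitone (show k + 1 ≤ n from hk)
  have hn : n ≠ 0 := by omega
  rw [Real.eulerMascheroniSeq', Real.eulerMascheroniSeq', if_neg hn, if_neg (by simp),
    harmonic_succ_real] at h
  rw [Real.log_div (by positivity) (by positivity)]
  push_cast at h
  linarith

lemma log_le_harmonic_sub {n k : ℕ} (hk : k < n) :
    Real.log (n / (k + 1)) ≤ (harmonic n : ℝ) - harmonic k := by
  have h := Real.strictMono_eulerMascheroniSeq.monotone hk.le
  rw [Real.eulerMascheroniSeq, Real.eulerMascheroniSeq] at h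
  have hn : (0 : ℝ) < n := by exact_mod_cast (show 0 < n by omega)
  rw [Real.log_div (by positivity) (by positivity)]
  have := Real.log_le_log hn (show (n : ℝ) ≤ n + 1 by linarith)
  linarith

lemma harmonic_sub_nonneg {n k : ℕ} (hk : k ≤ n) : 0 ≤ (harmonic n : ℝ) - harmonic k := by
  induction n, hk using Nat.le_induction with
  | base => simp
  | succ n hn ih => rw [harmonic_succ_real]; have : 0 ≤ 1 / ((n : ℝ) + 1) := by positivity
                    linarith

lemma harmonic_sub_le {n k : ℕ} (hk : k ≤ n) :
    ((k : ℝ) + 1) * ((harmonic n : ℝ) - harmonic k) ≤ n - k := by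
  induction n, hk using Nat.le_induction with
  | base => simp
  | succ n hn ih =>
    rw [harmonic_succ_real]
    have h : ((k : ℝ) + 1) * (1 / ((n : ℝ) + 1)) ≤ 1 := by
      rw [mul_one_div, div_le_one (by positivity)]
      have : (k : ℝ) ≤ n := by exact_mod_cast hn
      linarith
    push_cast
    linarith

lemma abs_toll_le {n k : ℕ} (hk : k < n) : |toll n k| ≤ n + 3 := by
  have h1 := harmonic_sub_le hk.le
  have h2 := harmonic_sub_nonneg hk.le
  have h3 := harmonic_sub_le (show n - 1 - k ≤ n by omega)
  have h4 := harmonic_sub_nonneg (show n - 1 - k ≤ n by omega)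
  rw [toll_eq hk, abs_le]
  obtain ⟨l, rfl⟩ : ∃ l, n = k + l + 1 := ⟨n - 1 - k, by omega⟩
  simp only [show k + l + 1 - 1 - k = l by omega] at *
  push_cast at *
  have h5 : (0 : ℝ) ≤ (k + 1) * ((harmonic (k + l + 1) : ℝ) - harmonic k) :=
    mul_nonneg (by positivity) h2
  have h6 : (0 : ℝ) ≤ (l + 1) * ((harmonic (k + l + 1) : ℝ) - harmonic l) :=
    mul_nonneg (by positivity) h4
  constructor <;> linarith

lemma abs_toll_div_le {n k : ℕ} (hk : k < n) : |toll n k / n| ≤ 4 := by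
  have hn : (1 : ℝ) ≤ n := by exact_mod_cast (show 1 ≤ n by omega)
  rw [abs_div, Nat.abs_cast, div_le_iff₀ (by linarith)]
  linarith [abs_toll_le hk]

/-- The limit of the normalised toll. -/
noncomputable def limToll (v : ℝ) : ℝ := 1 - 2 * (Real.negMulLog v + Real.negMulLog (1 - v))

lemma abs_harmonic_sub_negMulLog {n k : ℕ} (hk : k < n) :
    |((k : ℝ) + 1) * ((harmonic n : ℝ) - harmonic k) - n * Real.negMulLog ((k + 1) / n)| ≤ 1 := by
  have h1 := harmonic_sub_le_log hk
  have h2 := log_le_harmonic_sub hk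
  have hn : (0 : ℝ) < n := by exact_mod_cast (show 0 < n by omega)
  have h3 : (n : ℝ) * Real.negMulLog ((k + 1) / n) = (k + 1) * Real.log (n / (k + 1)) := by
    rw [Real.negMulLog, ← inv_div, Real.log_inv]
    field_simp
  have h4 : ((k : ℝ) + 1) * (1 / ((k : ℝ) + 1)) = 1 := by field_simp
  have hk0 : (0 : ℝ) ≤ k + 1 := by positivity
  rw [h3, ← mul_sub, abs_le]
  constructor <;> nlinarith

lemma negMulLog_le_two_sqrt {x : ℝ} (hx : 0 ≤ x) : Real.negMulLog x ≤ 2 * √x := by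
  rcases hx.eq_or_lt with rfl | hx
  · simp
  have hs : 0 < √x := Real.sqrt_pos.2 hx
  have h1 := Real.log_le_sub_one_of_pos (inv_pos.2 hs)
  rw [Real.log_inv, Real.log_sqrt hx.le] at h1
  have h2 : x = √x * √x := (Real.mul_self_sqrt hx.le).symm
  have h3 : -Real.log x ≤ 2 * (√x)⁻¹ := by linarith
  calc Real.negMulLog x = x * (-Real.log x) := by rw [Real.negMulLog]; ring
    _ ≤ x * (2 * (√x)⁻¹) := by gcongr
    _ = 2 * √x := by field_simp; linarith

lemma negMulLog_add_le {x y : ℝ} (hx : 0 ≤ x) (hy : 0 ≤ y) :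
    Real.negMulLog (x + y) ≤ Real.negMulLog x + Real.negMulLog y := by
  rcases hx.eq_or_lt with rfl | hx
  · simp
  rcases hy.eq_or_lt with rfl | hy
  · simp
  have h1 := Real.log_le_log hx (show x ≤ x + y by linarith)
  have h2 := Real.log_le_log hy (show y ≤ x + y by linarith)
  simp only [Real.negMulLog]
  nlinarith

lemma negMulLog_sub_le {x d : ℝ} (hx : 0 ≤ x) (hd : 0 ≤ d) (hxd : x + d ≤ 1) :
    Real.negMulLog x - Real.negMulLog (x + d) ≤ d := by
  rcases hx.eq_or_lt with rfl | hx
  · have := Real.negMulLog_nonneg hd (by linarith)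
    simp; linarith
  have h0 : 0 < x + d := by linarith
  have h1 : Real.log (x + d) - Real.log x ≤ d / x := by
    rw [← Real.log_div h0.ne' hx.ne']
    have := Real.log_le_sub_one_of_pos (div_pos h0 hx)
    have h2 : (x + d) / x - 1 = d / x := by field_simp; ring
    linarith
  have h2 : x * (Real.log (x + d) - Real.log x) ≤ d := by
    calc _ ≤ x * (d / x) := by gcongr
      _ = d := by field_simp
  have h3 : d * Real.log (x + d) ≤ 0 :=
    mul_nonpos_of_nonneg_of_nonpos hd (Real.log_nonpos h0.le hxd)
  simp only [Real.negMulLog]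
  nlinarith

lemma abs_negMulLog_sub_le {x y : ℝ} (hx : 0 ≤ x) (hy : 0 ≤ y) (hx1 : x ≤ 1) (hy1 : y ≤ 1) :
    |Real.negMulLog x - Real.negMulLog y| ≤ 2 * √|x - y| := by
  wlog h : y ≤ x generalizing x y
  · rw [abs_sub_comm, abs_sub_comm x y]
    exact this hy hx hy1 hx1 (by linarith)
  have hd : 0 ≤ x - y := by linarith
  rw [abs_of_nonneg hd]
  have h1 := negMulLog_add_le hy hd
  have h2 := negMulLog_sub_le hy hd (by linarith)
  have h3 := negMulLog_le_two_sqrt hd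
  rw [add_sub_cancel] at h1 h2
  have h4 : x - y ≤ √(x - y) := Real.le_sqrt_of_sq_le (by nlinarith)
  have h5 := Real.sqrt_nonneg (x - y)
  rw [abs_le]
  constructor <;> linarith

lemma abs_toll_div_sub_limToll {n : ℕ} (hn : 1 ≤ n) {v : ℝ} (hv0 : 0 ≤ v) (hv1 : v < 1) :
    |toll n ⌊n * v⌋₊ / n - limToll v| ≤ 15 / √n := by
  have hn0 : (0 : ℝ) < n := by exact_mod_cast hn
  have hn1 : (1 : ℝ) ≤ n := by exact_mod_cast hn
  have hf1 := Nat.floor_le (show 0 ≤ (n : ℝ) * v by positivity)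
  have hf2 := Nat.lt_floor_add_one ((n : ℝ) * v)
  set k := ⌊(n : ℝ) * v⌋₊ with hkdef
  have hk : k < n := by
    have : (k : ℝ) < n := by nlinarith
    exact_mod_cast this
  have h1 := abs_harmonic_sub_negMulLog hk
  have h2 := abs_harmonic_sub_negMulLog (show n - 1 - k < n by omega)
  have hl : ((n - 1 - k : ℕ) : ℝ) = n - 1 - k := by
    rw [Nat.cast_sub (by omega), Nat.cast_sub hn]; simp
  have hk' : (k : ℝ) + 1 ≤ n := by exact_mod_cast hk
  rw [hl] at h2
  have e1 : |((k : ℝ) + 1) / n - v| ≤ 1 / n := by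
    rw [show ((k : ℝ) + 1) / n - v = (k + 1 - n * v) / n by field_simp, abs_div, abs_of_pos hn0]
    gcongr
    rw [abs_le]; constructor <;> linarith
  have e2 : |((n : ℝ) - 1 - k + 1) / n - (1 - v)| ≤ 1 / n := by
    rw [show ((n : ℝ) - 1 - k + 1) / n - (1 - v) = (n * v - k) / n by field_simp; ring,
      abs_div, abs_of_pos hn0]
    gcongr
    rw [abs_le]; constructor <;> linarith
  have f1 := abs_negMulLog_sub_le (x := ((k : ℝ) + 1) / n) (y := v) (by positivity) hv0
    (by rw [div_le_one hn0]; linarith) hv1.le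
  have f2 := abs_negMulLog_sub_le (x := ((n : ℝ) - 1 - k + 1) / n) (y := 1 - v)
    (div_nonneg (by linarith) hn0.le) (by linarith)
    (by rw [div_le_one hn0]; linarith) (by linarith)
  have g1 := f1.trans (mul_le_mul_of_nonneg_left (Real.sqrt_le_sqrt e1) zero_le_two)
  have g2 := f2.trans (mul_le_mul_of_nonneg_left (Real.sqrt_le_sqrt e2) zero_le_two)
  rw [Real.sqrt_div zero_le_one, Real.sqrt_one] at g1 g2
  have hs : 1 / (n : ℝ) ≤ 1 / √n := by
    gcongr
    exact Real.sqrt_le_iff.2 ⟨by linarith, by nlinarith⟩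
  rw [toll_eq hk, limToll, hl]
  set a := ((k : ℝ) + 1) * ((harmonic n : ℝ) - harmonic k)
  set b := ((n : ℝ) - 1 - k + 1) * ((harmonic n : ℝ) - harmonic (n - 1 - k))
  set A := Real.negMulLog (((k : ℝ) + 1) / n)
  set B := Real.negMulLog (((n : ℝ) - 1 - k + 1) / n)
  have p1 : |a / n - A| ≤ 1 / n := by
    rw [show a / n - A = (a - n * A) / n by field_simp, abs_div, abs_of_pos hn0]
    gcongr
  have p2 : |b / n - B| ≤ 1 / n := by
    rw [show b / n - B = (b - n * B) / n by field_simp, abs_div, abs_of_pos hn0]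
    gcongr
  have key : ((n : ℝ) + 3 - 2 * (a + b)) / n - (1 - 2 * (Real.negMulLog v + Real.negMulLog (1 - v)))
      = 3 * (1 / n) - 2 * (a / n - A) - 2 * (b / n - B) - 2 * (A - Real.negMulLog v)
        - 2 * (B - Real.negMulLog (1 - v)) := by field_simp; ring
  rw [key, show 15 / √n = 15 * (1 / √n) by ring]
  rw [abs_le] at p1 p2 g1 g2 ⊢
  have : 0 < 1 / (n : ℝ) := by positivity
  constructor <;> linarith

lemma continuous_limToll : Continuous limToll := by
  unfold limToll; fun_prop

lemma limToll_zero : limToll 0 = 1 := by simp [limToll]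

end Toll

section CentralMoments

/-- Integral of a quartic polynomial in a centred integer variable. -/
lemma integral_centered_quartic {ν : Measure ℤ} [IsProbabilityMeasure ν]
    (hI : ∀ F : ℤ → ℝ, Integrable F ν) {b : ℝ} (hb : ∫ y : ℤ, (y : ℝ) ∂ν = b)
    (A₀ A₁ A₂ A₃ A₄ : ℝ) :
    ∫ y : ℤ, (A₀ + A₁ * (y - b) + A₂ * (y - b) ^ 2 + A₃ * (y - b) ^ 3 + A₄ * (y - b) ^ 4) ∂ν
      = A₀ + A₂ * ∫ y : ℤ, ((y : ℝ) - b) ^ 2 ∂ν + A₃ * ∫ y : ℤ, ((y : ℝ) - b) ^ 3 ∂ν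
        + A₄ * ∫ y : ℤ, ((y : ℝ) - b) ^ 4 ∂ν := by
  have h1 : ∫ y : ℤ, ((y : ℝ) - b) ∂ν = 0 := by
    rw [integral_sub (hI _) (hI _), hb]; simp
  rw [integral_add (hI _) (hI _), integral_add (hI _) (hI _), integral_add (hI _) (hI _),
    integral_add (hI _) (hI _), integral_const_mul, integral_const_mul, integral_const_mul,
    integral_const_mul, h1]
  simp

lemma integral_const_add_sq {ν : Measure ℤ} [IsProbabilityMeasure ν]
    (hI : ∀ F : ℤ → ℝ, Integrable F ν) {b : ℝ} (hb : ∫ y : ℤ, (y : ℝ) ∂ν = b) (c : ℝ) :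
    ∫ y : ℤ, (c + ((y : ℝ) - b)) ^ 2 ∂ν = c ^ 2 + ∫ y : ℤ, ((y : ℝ) - b) ^ 2 ∂ν := by
  have := integral_centered_quartic hI hb (c ^ 2) (2 * c) 1 0 0
  simp only [one_mul, zero_mul, add_zero] at this
  rw [← this]
  congr with y
  ring

variable {μ : ℕ → Measure ℤ}

lemma meanZ_eq (hμ : IsQuicksortLaw μ) (n : ℕ) : meanZ (μ n) = qsMean n := by
  induction n using Nat.strong_induction_on with
  | _ n ih =>
    have hp := hμ.1
    rcases Nat.eq_zero_or_pos n with rfl | hn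
    · simp [meanZ, hμ.2.1]
    · have hn0 : (n : ℝ) ≠ 0 := by exact_mod_cast hn.ne'
      rw [meanZ, hμ.integral_eq hn]
      have h : ∀ k ∈ Finset.range n,
          ∫ x : ℤ, ∫ y : ℤ, ((x + y + ((n : ℤ) - 1) : ℤ) : ℝ) ∂μ (n - 1 - k) ∂μ k
            = qsMean k + qsMean (n - 1 - k) + (n - 1) := by
        intro k hk
        rw [Finset.mem_range] at hk
        push_cast
        have h1 : ∀ x : ℤ, ∫ y : ℤ, ((x : ℝ) + y + (n - 1)) ∂μ (n - 1 - k)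
            = x + qsMean (n - 1 - k) + (n - 1) := by
          intro x
          rw [integral_add (hμ.integrable _ _) (hμ.integrable _ _),
            integral_add (hμ.integrable _ _) (hμ.integrable _ _), ← ih _ (by omega)]
          simp [meanZ]
        simp_rw [h1]
        rw [integral_add (hμ.integrable _ _) (hμ.integrable _ _),
            integral_add (hμ.integrable _ _) (hμ.integrable _ _), ← ih k (by omega)]
        simp [meanZ]
      rw [Finset.sum_congr rfl h]
      have h2 := Finset.sum_range_reflect qsMean n
      have h3 := sum_qsMean n
      simp only [Finset.sum_add_distrib, h2, Finset.sum_const, Finset.card_range, nsmul_eq_mul,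
        smul_eq_mul]
      field_simp
      linarith

/-- The second and fourth central moments. -/
noncomputable def centralMoment (ν : Measure ℤ) (p : ℕ) : ℝ := ∫ y : ℤ, ((y : ℝ) - meanZ ν) ^ p ∂ν

lemma sum_pow_le (n p : ℕ) :
    ((p : ℝ) + 1) * ∑ k ∈ Finset.range n, (k : ℝ) ^ p ≤ (n : ℝ) ^ (p + 1) := by
  induction n with
  | zero => simp
  | succ n ih =>
    rw [Finset.sum_range_succ, mul_add]
    have h := one_add_mul_le_pow (a := 1 / (n : ℝ)) ?_ (p + 1)
    · rcases Nat.eq_zero_or_pos n with rfl | hn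
      · rcases p with _ | p <;> simp
      have hn0 : (0 : ℝ) < n := by exact_mod_cast hn
      have h2 := mul_le_mul_of_nonneg_left h (pow_nonneg hn0.le (p + 1))
      rw [← mul_pow] at h2
      have h3 : (n : ℝ) * (1 + 1 / n) = (n + 1 : ℕ) := by push_cast; field_simp
      have h4 : (n : ℝ) ^ (p + 1) * (1 + ((p + 1 : ℕ) : ℝ) * (1 / n)) =
          n ^ (p + 1) + (p + 1) * n ^ p := by
        push_cast; rw [pow_succ]; field_simp
      rw [h3, h4] at h2
      linarith
    · have : 0 ≤ 1 / (n : ℝ) := by positivity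
      linarith

lemma shift_eq (n : ℕ) {k : ℕ} (x y : ℤ) :
    ((x + y + ((n : ℤ) - 1) : ℤ) : ℝ) - qsMean n
      = toll n k + (x - qsMean k) + (y - qsMean (n - 1 - k)) := by
  rw [toll]; push_cast; ring

lemma centralMoment_two_eq (hμ : IsQuicksortLaw μ) {n : ℕ} (hn : 1 ≤ n) :
    n * centralMoment (μ n) 2 = ∑ k ∈ Finset.range n, toll n k ^ 2
      + 2 * ∑ k ∈ Finset.range n, centralMoment (μ k) 2 := by
  have hp := hμ.1
  have hn0 : (n : ℝ) ≠ 0 := by exact_mod_cast (show n ≠ 0 by omega)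
  rw [centralMoment, hμ.integral_eq hn, smul_eq_mul, mul_inv_cancel_left₀ hn0, meanZ_eq hμ]
  have h : ∀ k ∈ Finset.range n,
      ∫ x : ℤ, ∫ y : ℤ, (((x + y + ((n : ℤ) - 1) : ℤ) : ℝ) - qsMean n) ^ 2 ∂μ (n - 1 - k) ∂μ k
      = toll n k ^ 2 + centralMoment (μ k) 2 + centralMoment (μ (n - 1 - k)) 2 := by
    intro k hk
    simp_rw [shift_eq n (k := k), centralMoment, meanZ_eq hμ]
    have h1 : ∀ x : ℤ, ∫ y : ℤ, (toll n k + ((x : ℝ) - qsMean k) + (y - qsMean (n - 1 - k))) ^ 2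
          ∂μ (n - 1 - k) = (toll n k + ((x : ℝ) - qsMean k)) ^ 2
            + ∫ y : ℤ, ((y : ℝ) - qsMean (n - 1 - k)) ^ 2 ∂μ (n - 1 - k) :=
      fun x => integral_const_add_sq (hμ.integrable _) (meanZ_eq hμ _) _
    simp_rw [h1]
    rw [integral_add (hμ.integrable _ _) (hμ.integrable _ _)]
    rw [integral_const_add_sq (hμ.integrable _) (meanZ_eq hμ _)]; simp
  rw [Finset.sum_congr rfl h]
  have h2 := Finset.sum_range_reflect (fun k => centralMoment (μ k) 2) n
  simp only [Finset.sum_add_distrib, h2]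
  ring

lemma centralMoment_two_nonneg (n : ℕ) : 0 ≤ centralMoment (μ n) 2 :=
  integral_nonneg fun _ => sq_nonneg _

lemma centralMoment_two_le (hμ : IsQuicksortLaw μ) (n : ℕ) :
    centralMoment (μ n) 2 ≤ 48 * (n : ℝ) ^ 2 := by
  induction n using Nat.strong_induction_on with
  | _ n ih =>
    have hp := hμ.1
    rcases Nat.eq_zero_or_pos n with rfl | hn
    · simp [centralMoment, meanZ, hμ.2.1]
    have hn1 : (1 : ℝ) ≤ n := by exact_mod_cast hn
    have h1 : ∑ k ∈ Finset.range n, toll n k ^ 2 ≤ ∑ k ∈ Finset.range n, 16 * (n : ℝ) ^ 2 := by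
      refine Finset.sum_le_sum fun k hk => ?_
      have := abs_toll_le (Finset.mem_range.1 hk)
      rw [← sq_abs]
      nlinarith [abs_nonneg (toll n k)]
    have h2 : ∑ k ∈ Finset.range n, centralMoment (μ k) 2
        ≤ ∑ k ∈ Finset.range n, 48 * (k : ℝ) ^ 2 :=
      Finset.sum_le_sum fun k hk => ih k (Finset.mem_range.1 hk)
    have h3 := sum_pow_le n 2
    have h4 := centralMoment_two_eq hμ hn
    rw [← Finset.mul_sum] at h2
    simp only [Finset.sum_const, Finset.card_range, nsmul_eq_mul] at h1
    push_cast at h3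
    refine le_of_mul_le_mul_left ?_ (show (0 : ℝ) < n by linarith)
    rw [h4]
    nlinarith

lemma quartic_le (c X Y : ℝ) : (c + X + Y) ^ 4 ≤
    (c ^ 4 + 4 * c ^ 3 * X + 14 * c ^ 2 * X ^ 2 + 3 / 2 * X ^ 4)
      + (4 * c ^ 3 + 28 * c ^ 2 * X + 6 * X ^ 3) * Y + (14 * c ^ 2 + 9 * X ^ 2) * Y ^ 2
      + 6 * X * Y ^ 3 + 3 / 2 * Y ^ 4 := by
  nlinarith [sq_nonneg ((X + Y) * (4 * c - (X + Y)))]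

lemma centralMoment_four_le_sum (hμ : IsQuicksortLaw μ) {n : ℕ} (hn : 1 ≤ n) :
    n * centralMoment (μ n) 4 ≤ ∑ k ∈ Finset.range n, (toll n k ^ 4
        + 14 * toll n k ^ 2 * (centralMoment (μ k) 2 + centralMoment (μ (n - 1 - k)) 2)
        + 9 * centralMoment (μ k) 2 * centralMoment (μ (n - 1 - k)) 2)
      + 3 * ∑ k ∈ Finset.range n, centralMoment (μ k) 4 := by
  have hp := hμ.1
  have hn0 : (n : ℝ) ≠ 0 := by exact_mod_cast (show n ≠ 0 by omega)
  rw [centralMoment, hμ.integral_eq hn, smul_eq_mul, mul_inv_cancel_left₀ hn0, meanZ_eq hμ]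
  have h2 := Finset.sum_range_reflect (fun k => centralMoment (μ k) 4) n
  have h3 : 3 * ∑ k ∈ Finset.range n, centralMoment (μ k) 4 = ∑ k ∈ Finset.range n,
      (3 / 2 * centralMoment (μ k) 4 + 3 / 2 * centralMoment (μ (n - 1 - k)) 4) := by
    rw [Finset.sum_add_distrib, ← Finset.mul_sum, ← Finset.mul_sum, h2]; ring
  rw [h3, ← Finset.sum_add_distrib]
  refine Finset.sum_le_sum fun k hk => ?_
  simp_rw [shift_eq n (k := k)]
  set l := n - 1 - k
  set c := toll n k
  have h1 : ∀ x : ℤ, ∫ y : ℤ, (c + ((x : ℝ) - qsMean k) + (y - qsMean l)) ^ 4 ∂μ l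
      ≤ (c ^ 4 + 14 * c ^ 2 * centralMoment (μ l) 2 + 3 / 2 * centralMoment (μ l) 4)
        + (4 * c ^ 3 + 6 * centralMoment (μ l) 3) * (x - qsMean k)
        + (14 * c ^ 2 + 9 * centralMoment (μ l) 2) * (x - qsMean k) ^ 2
        + 0 * (x - qsMean k) ^ 3 + 3 / 2 * (x - qsMean k) ^ 4 := by
    intro x
    refine (integral_mono (hμ.integrable _ _) (hμ.integrable _ _)
      fun y => quartic_le c (x - qsMean k) (y - qsMean l)).trans (le_of_eq ?_)
    rw [integral_centered_quartic (hμ.integrable l) (meanZ_eq hμ l)]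
    simp only [centralMoment, meanZ_eq hμ]
    ring
  refine (integral_mono (hμ.integrable _ _) (hμ.integrable _ _) h1).trans (le_of_eq ?_)
  rw [integral_centered_quartic (hμ.integrable k) (meanZ_eq hμ k)]
  simp only [centralMoment, meanZ_eq hμ]
  ring

lemma centralMoment_four_le (hμ : IsQuicksortLaw μ) (n : ℕ) :
    centralMoment (μ n) 4 ≤ 106240 * (n : ℝ) ^ 4 := by
  induction n using Nat.strong_induction_on with
  | _ n ih =>
    have hp := hμ.1
    rcases Nat.eq_zero_or_pos n with rfl | hn
    · simp [centralMoment, meanZ, hμ.2.1]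
    have hn1 : (1 : ℝ) ≤ n := by exact_mod_cast hn
    have hV : ∀ k, k < n → centralMoment (μ k) 2 ≤ 48 * (n : ℝ) ^ 2 := fun k hk =>
      (centralMoment_two_le hμ k).trans (by gcongr)
    have h1 : ∑ k ∈ Finset.range n, (toll n k ^ 4
        + 14 * toll n k ^ 2 * (centralMoment (μ k) 2 + centralMoment (μ (n - 1 - k)) 2)
        + 9 * centralMoment (μ k) 2 * centralMoment (μ (n - 1 - k)) 2)
        ≤ ∑ k ∈ Finset.range n, 42496 * (n : ℝ) ^ 4 := by
      refine Finset.sum_le_sum fun k hk => ?_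
      rw [Finset.mem_range] at hk
      have h0 := abs_toll_le hk
      have h0' : toll n k ^ 2 ≤ 16 * (n : ℝ) ^ 2 := by
        rw [← sq_abs]
        nlinarith [abs_nonneg (toll n k)]
      have h5 := hV k hk
      have h6 := hV (n - 1 - k) (by omega)
      have h7 := centralMoment_two_nonneg (μ := μ) k
      have h8 := centralMoment_two_nonneg (μ := μ) (n - 1 - k)
      have h9 : toll n k ^ 4 ≤ (16 * (n : ℝ) ^ 2) ^ 2 := by
        calc toll n k ^ 4 = (toll n k ^ 2) ^ 2 := by ring
          _ ≤ _ := by gcongr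
      have h10 : 14 * toll n k ^ 2 * (centralMoment (μ k) 2 + centralMoment (μ (n - 1 - k)) 2)
          ≤ 14 * (16 * (n : ℝ) ^ 2) * (48 * (n : ℝ) ^ 2 + 48 * (n : ℝ) ^ 2) := by gcongr
      have h11 : 9 * centralMoment (μ k) 2 * centralMoment (μ (n - 1 - k)) 2
          ≤ 9 * (48 * (n : ℝ) ^ 2) * (48 * (n : ℝ) ^ 2) := by gcongr
      linarith
    have h2 : ∑ k ∈ Finset.range n, centralMoment (μ k) 4
        ≤ ∑ k ∈ Finset.range n, 106240 * (k : ℝ) ^ 4 :=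
      Finset.sum_le_sum fun k hk => ih k (Finset.mem_range.1 hk)
    have h3 := sum_pow_le n 4
    have h4 := centralMoment_four_le_sum hμ hn
    rw [← Finset.mul_sum] at h2
    simp only [Finset.sum_const, Finset.card_range, nsmul_eq_mul] at h1
    push_cast at h3
    refine le_of_mul_le_mul_left ?_ (show (0 : ℝ) < n by linarith)
    refine h4.trans ?_
    nlinarith

end CentralMoments

section Variance

section FloorIntegral

variable {E : Type*} [NormedAddCommGroup E]

lemma norm_floor_le (F : ℕ → E) (n : ℕ) {v : ℝ} (hv : v ∈ Set.Icc (0 : ℝ) 1) :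
    ‖F ⌊n * v⌋₊‖ ≤ ∑ k ∈ Finset.range (n + 1), ‖F k‖ := by
  refine Finset.single_le_sum (f := fun k => ‖F k‖) (fun _ _ => norm_nonneg _) ?_
  rw [Finset.mem_range, Nat.lt_succ_iff]
  refine Nat.floor_le_of_le ?_
  nlinarith [hv.2, (Nat.cast_nonneg n : (0 : ℝ) ≤ n)]

lemma intervalIntegrable_floor (F : ℕ → E) (n : ℕ) :
    IntervalIntegrable (fun v : ℝ => F ⌊n * v⌋₊) volume 0 1 := by
  rw [intervalIntegrable_iff_integrableOn_Ioc_of_le zero_le_one]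
  refine Integrable.of_bound (C := ∑ k ∈ Finset.range (n + 1), ‖F k‖) ?_ ?_
  · refine StronglyMeasurable.aestronglyMeasurable
      (StronglyMeasurable.comp_measurable (f := F) StronglyMeasurable.of_discrete ?_)
    exact Nat.measurable_floor.comp (by fun_prop)
  · filter_upwards [ae_restrict_mem measurableSet_Ioc] with v hv
    exact norm_floor_le F n ⟨hv.1.le, hv.2⟩

/-- Averages over `range n` as integrals over the unit interval. -/
lemma integral_floor [NormedSpace ℝ E] [CompleteSpace E] (F : ℕ → E) {n : ℕ} (hn : 1 ≤ n) :
    ∫ v in (0 : ℝ)..1, F ⌊n * v⌋₊ = (n : ℝ)⁻¹ • ∑ k ∈ Finset.range n, F k := by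
  have hn0 : (0 : ℝ) < n := by exact_mod_cast hn
  have hpiece : ∀ k : ℕ, ∀ v ∈ Set.Ioo ((k : ℝ) / n) ((k + 1 : ℕ) / n), F ⌊n * v⌋₊ = F k := by
    intro k v hv
    have h1 : (k : ℝ) < n * v := by have := hv.1; rw [div_lt_iff₀ hn0] at this; linarith
    have h2 : (n : ℝ) * v < k + 1 := by
      have := hv.2; rw [lt_div_iff₀ hn0] at this; push_cast at this; linarith
    rw [(Nat.floor_eq_iff (by have : (0 : ℝ) ≤ k := by positivity
                              linarith)).2 ⟨h1.le, h2⟩]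
  have hle : ∀ k : ℕ, (k : ℝ) / n ≤ ((k + 1 : ℕ) : ℝ) / n := fun k => by
    gcongr; simp
  have hae : ∀ k : ℕ, ∀ᵐ v ∂volume, v ∈ Set.uIoc ((k : ℝ) / n) ((k + 1 : ℕ) / n) →
      F ⌊n * v⌋₊ = F k := by
    intro k
    have : ∀ᵐ v ∂(volume : Measure ℝ), v ≠ ((k + 1 : ℕ) : ℝ) / n := by
      simp [ae_iff, measure_singleton]
    filter_upwards [this] with v hv hmem
    rw [Set.uIoc_of_le (hle k)] at hmem
    exact hpiece k v ⟨hmem.1, lt_of_le_of_ne hmem.2 hv⟩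
  have hI : ∀ k < n, IntervalIntegrable (fun v : ℝ => F ⌊n * v⌋₊) volume
      ((k : ℝ) / n) ((k + 1 : ℕ) / n) := by
    intro k hk
    refine (intervalIntegrable_floor F n).mono_set ?_
    rw [Set.uIcc_of_le (hle k), Set.uIcc_of_le zero_le_one]
    refine Set.Icc_subset_Icc (by positivity) ?_
    rw [div_le_one hn0]; exact_mod_cast hk
  have h := intervalIntegral.sum_integral_adjacent_intervals (a := fun k : ℕ => (k : ℝ) / n) hI
  simp only [Nat.cast_zero, zero_div, div_self hn0.ne'] at h
  rw [← h, Finset.smul_sum]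
  refine Finset.sum_congr rfl fun k _ => ?_
  rw [intervalIntegral.integral_congr_ae (hae k), intervalIntegral.integral_const]
  congr 1
  push_cast
  field_simp
  ring

end FloorIntegral

variable {μ : ℕ → Measure ℤ}

lemma integral_limToll_sq_pos : 0 < ∫ v in (0 : ℝ)..1, limToll v ^ 2 :=
  intervalIntegral.integral_pos zero_lt_one (continuous_limToll.pow 2).continuousOn
    (fun _ _ => sq_nonneg _) ⟨0, by simp, by simp [limToll_zero]⟩

lemma exists_centralMoment_two_ge (hμ : IsQuicksortLaw μ) :
    ∃ c : ℝ, 0 < c ∧ ∃ N : ℕ, ∀ n ≥ N, c * (n : ℝ) ^ 2 ≤ centralMoment (μ n) 2 := by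
  set J := ∫ v in (0 : ℝ)..1, limToll v ^ 2 with hJ
  have hJ0 : 0 < J := integral_limToll_sq_pos
  refine ⟨J / 4, by positivity, max 1 ⌈900 / J⌉₊, fun n hn => ?_⟩
  have hn1 : 1 ≤ n := (le_max_left _ _).trans hn
  have hn0 : (0 : ℝ) < n := by exact_mod_cast hn1
  have hnJ : 900 / J ≤ n := (Nat.le_ceil _).trans (by exact_mod_cast (le_max_right _ _).trans hn)
  have h1 : J / 2 - 225 / n ≤ ∫ v in (0 : ℝ)..1, (toll n ⌊n * v⌋₊ / n) ^ 2 := by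
    have hc : IntervalIntegrable (fun v => limToll v ^ 2) volume 0 1 :=
      (continuous_limToll.pow 2).intervalIntegrable _ _
    have e : J / 2 - 225 / n = ∫ v in (0 : ℝ)..1, (limToll v ^ 2 * (1 / 2) - 225 / n) := by
      rw [intervalIntegral.integral_sub (hc.mul_const _) (by simp),
        intervalIntegral.integral_mul_const, ← hJ]
      simp; ring
    rw [e]
    refine intervalIntegral.integral_mono_on_of_le_Ioo zero_le_one
      ((hc.mul_const _).sub (by simp))
      (intervalIntegrable_floor (fun k => (toll n k / n) ^ 2) n) fun v hv => ?_
    have h := abs_toll_div_sub_limToll hn1 hv.1.le hv.2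
    have h2 : (toll n ⌊n * v⌋₊ / n - limToll v) ^ 2 ≤ 225 / n := by
      rw [← sq_abs]
      calc _ ≤ (15 / √n) ^ 2 := by gcongr
        _ = 225 / n := by rw [div_pow, Real.sq_sqrt hn0.le]; norm_num
    nlinarith [sq_nonneg (2 * (toll n ⌊n * v⌋₊ / n) - limToll v)]
  rw [integral_floor (fun k => (toll n k / n) ^ 2) hn1, smul_eq_mul] at h1
  have h2 := centralMoment_two_eq hμ hn1
  have h3 : 0 ≤ ∑ k ∈ Finset.range n, centralMoment (μ k) 2 :=
    Finset.sum_nonneg fun k _ => centralMoment_two_nonneg k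
  have h4 : (n : ℝ)⁻¹ * ∑ k ∈ Finset.range n, (toll n k / n) ^ 2
      = (∑ k ∈ Finset.range n, toll n k ^ 2) / n ^ 3 := by
    simp_rw [div_pow]; rw [← Finset.sum_div]; field_simp
  rw [h4] at h1
  have h5 : 225 / (n : ℝ) ≤ J / 4 := by
    rw [div_le_iff₀ hn0]; rw [div_le_iff₀ hJ0] at hnJ; linarith
  have h6 : J / 4 ≤ (∑ k ∈ Finset.range n, toll n k ^ 2) / n ^ 3 := by linarith
  rw [le_div_iff₀ (by positivity)] at h6
  refine le_of_mul_le_mul_left ?_ hn0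
  rw [h2]
  nlinarith

end Variance

section CharacteristicFunction

section ExpBounds

lemma norm_exp_ofReal_mul_I_sub_one_sub_le (x : ℝ) :
    ‖Complex.exp ((x : ℂ) * Complex.I) - 1 - x * Complex.I‖ ≤ 3 * x ^ 2 := by
  have hx : ‖(x : ℂ) * Complex.I‖ = |x| := by simp
  rcases le_total |x| 1 with h | h
  · have := Complex.norm_exp_sub_one_sub_id_le (x := (x : ℂ) * Complex.I) (by rwa [hx])
    rw [hx, sq_abs] at this
    nlinarith [sq_nonneg x]
  · calc _ ≤ ‖Complex.exp ((x : ℂ) * Complex.I)‖ + ‖(1 : ℂ)‖ + ‖(x : ℂ) * Complex.I‖ :=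
          (norm_sub_le _ _).trans (by gcongr; exact norm_sub_le _ _)
      _ = 2 + |x| := by rw [Complex.norm_exp_ofReal_mul_I, hx, norm_one]; ring
      _ ≤ 3 * |x| ^ 2 := by nlinarith
      _ = 3 * x ^ 2 := by rw [sq_abs]

lemma norm_exp_ofReal_mul_I_sub_quadratic_le (x : ℝ) :
    ‖Complex.exp ((x : ℂ) * Complex.I) - 1 - x * Complex.I + (x : ℂ) ^ 2 / 2‖ ≤ 4 * |x| ^ 3 := by
  have hx : ‖(x : ℂ) * Complex.I‖ = |x| := by simp
  rcases le_total |x| 1 with h | h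
  · have := Complex.exp_bound (x := (x : ℂ) * Complex.I) (by rwa [hx]) (n := 3) (by norm_num)
    rw [hx] at this
    simp only [Finset.sum_range_succ, Finset.sum_range_zero] at this
    norm_num [mul_pow, Nat.factorial] at this
    have e : Complex.exp ((x : ℂ) * Complex.I) - 1 - x * Complex.I + (x : ℂ) ^ 2 / 2
        = Complex.exp ((x : ℂ) * Complex.I) - (1 + x * Complex.I + -(x : ℂ) ^ 2 / 2) := by ring
    rw [e]
    refine this.trans ?_
    nlinarith [pow_nonneg (abs_nonneg x) 3]
  · calc _ ≤ ‖Complex.exp ((x : ℂ) * Complex.I)‖ + ‖(1 : ℂ)‖ + ‖(x : ℂ) * Complex.I‖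
            + ‖(x : ℂ) ^ 2 / 2‖ :=
          (norm_add_le _ _).trans (by
            gcongr; exact (norm_sub_le _ _).trans (by gcongr; exact norm_sub_le _ _))
      _ = 2 + |x| + |x| ^ 2 / 2 := by
          rw [Complex.norm_exp_ofReal_mul_I, hx, norm_one]; simp; ring
      _ ≤ 4 * |x| ^ 3 := by nlinarith [mul_nonneg (abs_nonneg x) (abs_nonneg x)]

end ExpBounds

/-- The characteristic function of the centred comparison count `Q_n - q_n`. -/
noncomputable def psi (μ : ℕ → Measure ℤ) (n : ℕ) (s : ℝ) : ℂ :=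
  ∫ z : ℤ, Complex.exp (((s * ((z : ℝ) - qsMean n) : ℝ) : ℂ) * Complex.I) ∂μ n

variable {μ : ℕ → Measure ℤ}

lemma norm_psi_le_one (hμ : IsQuicksortLaw μ) (n : ℕ) (s : ℝ) : ‖psi μ n s‖ ≤ 1 := by
  have hp := hμ.1
  refine (norm_integral_le_integral_norm _).trans ?_
  simp [Complex.norm_exp_ofReal_mul_I, -Complex.ofReal_mul]

lemma psi_zero (hμ : IsQuicksortLaw μ) (s : ℝ) : psi μ 0 s = 1 := by
  simp [psi, hμ.2.1]

lemma psi_zero_right (hμ : IsQuicksortLaw μ) (n : ℕ) : psi μ n 0 = 1 := by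
  have hp := hμ.1
  simp [psi]

lemma psi_rec (hμ : IsQuicksortLaw μ) {n : ℕ} (hn : 1 ≤ n) (s : ℝ) :
    psi μ n s = (n : ℝ)⁻¹ • ∑ k ∈ Finset.range n,
      Complex.exp (((s * toll n k : ℝ) : ℂ) * Complex.I) * psi μ k s * psi μ (n - 1 - k) s := by
  rw [psi, hμ.integral_eq hn]
  congr 1
  refine Finset.sum_congr rfl fun k hk => ?_
  have h : ∀ x y : ℤ,
      Complex.exp (((s * (((x + y + ((n : ℤ) - 1) : ℤ) : ℝ) - qsMean n) : ℝ) : ℂ) * Complex.I)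
      = Complex.exp (((s * toll n k : ℝ) : ℂ) * Complex.I)
        * Complex.exp (((s * ((x : ℝ) - qsMean k) : ℝ) : ℂ) * Complex.I)
        * Complex.exp (((s * ((y : ℝ) - qsMean (n - 1 - k)) : ℝ) : ℂ) * Complex.I) := by
    intro x y
    rw [shift_eq n (k := k) x y, ← Complex.exp_add, ← Complex.exp_add]
    congr 1; push_cast; ring
  simp_rw [h]
  simp_rw [integral_const_mul, integral_mul_const, integral_const_mul]
  rfl

lemma integral_centered (hμ : IsQuicksortLaw μ) (n : ℕ) :
    ∫ z : ℤ, ((z : ℝ) - qsMean n) ∂μ n = 0 := by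
  have hp := hμ.1
  rw [integral_sub (hμ.integrable _ _) (by simp), integral_const]
  have := meanZ_eq hμ n
  rw [meanZ] at this
  simp [this]

lemma integral_centered_pow (hμ : IsQuicksortLaw μ) (n p : ℕ) :
    ∫ z : ℤ, ((z : ℝ) - qsMean n) ^ p ∂μ n = centralMoment (μ n) p := by
  rw [centralMoment, meanZ_eq hμ]

lemma integral_abs_centered_le (hμ : IsQuicksortLaw μ) (n : ℕ) :
    ∫ z : ℤ, |(z : ℝ) - qsMean n| ∂μ n ≤ 7 * n := by
  have hp := hμ.1
  rcases Nat.eq_zero_or_pos n with rfl | hn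
  · simp [hμ.2.1]
  have hn0 : (0 : ℝ) < n := by exact_mod_cast hn
  calc ∫ z : ℤ, |(z : ℝ) - qsMean n| ∂μ n
      ≤ ∫ z : ℤ, (((z : ℝ) - qsMean n) ^ 2 * (1 / (14 * n)) + 7 * n / 2) ∂μ n := by
        refine integral_mono (hμ.integrable _ _) (hμ.integrable _ _) fun z => ?_
        have e : ((z : ℝ) - qsMean n) ^ 2 * (1 / (14 * n)) + 7 * n / 2
            - |(z : ℝ) - qsMean n| = (|(z : ℝ) - qsMean n| - 7 * n) ^ 2 / (14 * n) := by
          rw [← sq_abs]; field_simp; ring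
        have : 0 ≤ (|(z : ℝ) - qsMean n| - 7 * n) ^ 2 / (14 * n) := by positivity
        simp only
        linarith
    _ = centralMoment (μ n) 2 * (1 / (14 * n)) + 7 * n / 2 := by
        rw [integral_add (hμ.integrable _ _) (hμ.integrable _ _), integral_mul_const,
          integral_centered_pow hμ]
        simp
    _ ≤ 48 * (n : ℝ) ^ 2 * (1 / (14 * n)) + 7 * n / 2 := by
        gcongr; exact centralMoment_two_le hμ n
    _ ≤ 7 * n := by
        have : 48 * (n : ℝ) ^ 2 * (1 / (14 * n)) = 48 / 14 * n := by field_simp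
        rw [this]; linarith

lemma integral_abs_centered_cube_le (hμ : IsQuicksortLaw μ) (n : ℕ) :
    ∫ z : ℤ, |(z : ℝ) - qsMean n| ^ 3 ∂μ n ≤ 53144 * (n : ℝ) ^ 3 := by
  have hp := hμ.1
  rcases Nat.eq_zero_or_pos n with rfl | hn
  · simp [hμ.2.1]
  have hn0 : (0 : ℝ) < n := by exact_mod_cast hn
  calc ∫ z : ℤ, |(z : ℝ) - qsMean n| ^ 3 ∂μ n
      ≤ ∫ z : ℤ, (((z : ℝ) - qsMean n) ^ 2 * (n / 2)
          + ((z : ℝ) - qsMean n) ^ 4 * (1 / (2 * n))) ∂μ n := by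
        refine integral_mono (hμ.integrable _ _) (hμ.integrable _ _) fun z => ?_
        have e : ((z : ℝ) - qsMean n) ^ 2 * (n / 2) + ((z : ℝ) - qsMean n) ^ 4 * (1 / (2 * n))
            - |(z : ℝ) - qsMean n| ^ 3
            = |(z : ℝ) - qsMean n| ^ 2 * (|(z : ℝ) - qsMean n| - n) ^ 2 / (2 * n) := by
          rw [← sq_abs, ← (show Even 4 by decide).pow_abs]; field_simp; ring
        have : 0 ≤ |(z : ℝ) - qsMean n| ^ 2 * (|(z : ℝ) - qsMean n| - n) ^ 2 / (2 * n) := by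
          positivity
        simp only
        linarith
    _ = centralMoment (μ n) 2 * (n / 2) + centralMoment (μ n) 4 * (1 / (2 * n)) := by
        rw [integral_add (hμ.integrable _ _) (hμ.integrable _ _), integral_mul_const,
          integral_mul_const, integral_centered_pow hμ, integral_centered_pow hμ]
    _ ≤ 48 * (n : ℝ) ^ 2 * (n / 2) + 106240 * (n : ℝ) ^ 4 * (1 / (2 * n)) := by
        gcongr
        · exact centralMoment_two_le hμ n
        · exact centralMoment_four_le hμ n
    _ = 53144 * (n : ℝ) ^ 3 := by field_simp; ring

lemma norm_psi_sub_psi_le (hμ : IsQuicksortLaw μ) (n : ℕ) (s t : ℝ) :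
    ‖psi μ n s - psi μ n t‖ ≤ 7 * n * |s - t| := by
  have hp := hμ.1
  rw [psi, psi, ← integral_sub (hμ.integrable _ _) (hμ.integrable _ _)]
  calc _ ≤ ∫ z : ℤ, |s - t| * |(z : ℝ) - qsMean n| ∂μ n := by
        refine (norm_integral_le_integral_norm _).trans
          (integral_mono (hμ.integrable _ _) (hμ.integrable _ _) fun z => ?_)
        set X := (z : ℝ) - qsMean n
        have e : Complex.exp (((s * X : ℝ) : ℂ) * Complex.I)
            - Complex.exp (((t * X : ℝ) : ℂ) * Complex.I)
            = Complex.exp (((t * X : ℝ) : ℂ) * Complex.I)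
              * (Complex.exp (Complex.I * (((s - t) * X : ℝ) : ℂ)) - 1) := by
          rw [mul_sub (Complex.exp _), ← Complex.exp_add, mul_one]
          congr 2; push_cast; ring
        simp only
        rw [e, norm_mul, Complex.norm_exp_ofReal_mul_I, one_mul, ← abs_mul]
        exact Real.norm_exp_I_mul_ofReal_sub_one_le
    _ ≤ |s - t| * (7 * n) := by
        rw [integral_const_mul]
        gcongr
        exact integral_abs_centered_le hμ n
    _ = _ := by ring

lemma norm_psi_sub_one_le (hμ : IsQuicksortLaw μ) (n : ℕ) (s : ℝ) :
    ‖psi μ n s - 1‖ ≤ 144 * (s * n) ^ 2 := by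
  have hp := hμ.1
  have e : psi μ n s - 1 = ∫ z : ℤ, (Complex.exp (((s * ((z : ℝ) - qsMean n) : ℝ) : ℂ) * Complex.I)
      - 1 - ((s * ((z : ℝ) - qsMean n) : ℝ) : ℂ) * Complex.I) ∂μ n := by
    rw [integral_sub (hμ.integrable _ _) (hμ.integrable _ _),
      integral_sub (hμ.integrable _ _) (hμ.integrable _ _), integral_mul_const,
      integral_complex_ofReal, integral_const_mul, integral_centered hμ]
    simp [psi]
  rw [e]
  calc _ ≤ ∫ z : ℤ, 3 * s ^ 2 * ((z : ℝ) - qsMean n) ^ 2 ∂μ n := by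
        refine (norm_integral_le_integral_norm _).trans
          (integral_mono (hμ.integrable _ _) (hμ.integrable _ _) fun z => ?_)
        refine (norm_exp_ofReal_mul_I_sub_one_sub_le _).trans_eq ?_
        ring
    _ = 3 * s ^ 2 * centralMoment (μ n) 2 := by
        rw [integral_const_mul, integral_centered_pow hμ]
    _ ≤ 3 * s ^ 2 * (48 * (n : ℝ) ^ 2) := by gcongr; exact centralMoment_two_le hμ n
    _ = _ := by ring

lemma norm_psi_sub_quadratic_le (hμ : IsQuicksortLaw μ) (n : ℕ) (s : ℝ) :
    ‖psi μ n s - (1 - s ^ 2 * centralMoment (μ n) 2 / 2 : ℝ)‖ ≤ 212576 * (|s| * n) ^ 3 := by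
  have hp := hμ.1
  have e : psi μ n s - (1 - s ^ 2 * centralMoment (μ n) 2 / 2 : ℝ)
      = ∫ z : ℤ, (Complex.exp (((s * ((z : ℝ) - qsMean n) : ℝ) : ℂ) * Complex.I)
      - 1 - ((s * ((z : ℝ) - qsMean n) : ℝ) : ℂ) * Complex.I
      + ((s * ((z : ℝ) - qsMean n) : ℝ) : ℂ) ^ 2 / 2) ∂μ n := by
    rw [integral_add (hμ.integrable _ _) (hμ.integrable _ _),
      integral_sub (hμ.integrable _ _) (hμ.integrable _ _),
      integral_sub (hμ.integrable _ _) (hμ.integrable _ _), integral_mul_const,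
      integral_complex_ofReal, integral_const_mul, integral_centered hμ, integral_div]
    simp_rw [← Complex.ofReal_pow]
    rw [integral_complex_ofReal]
    simp_rw [mul_pow]
    rw [integral_const_mul, integral_centered_pow hμ]
    simp [psi]
    ring
  rw [e]
  calc _ ≤ ∫ z : ℤ, 4 * |s| ^ 3 * |(z : ℝ) - qsMean n| ^ 3 ∂μ n := by
        refine (norm_integral_le_integral_norm _).trans
          (integral_mono (hμ.integrable _ _) (hμ.integrable _ _) fun z => ?_)
        refine (norm_exp_ofReal_mul_I_sub_quadratic_le _).trans_eq ?_
        rw [abs_mul]; ring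
    _ ≤ 4 * |s| ^ 3 * (53144 * (n : ℝ) ^ 3) := by
        rw [integral_const_mul]
        gcongr
        exact integral_abs_centered_cube_le hμ n
    _ = _ := by ring

/-- Uniform quadratic decay of the characteristic functions near the origin. -/
lemma exists_norm_psi_le_one_sub (hμ : IsQuicksortLaw μ) :
    ∃ τ : ℝ, 0 < τ ∧ ∃ σ : ℝ, 0 < σ ∧ ∃ N : ℕ, ∀ n ≥ N, ∀ s : ℝ, |s| * n ≤ τ →
      ‖psi μ n s‖ ≤ 1 - σ * (|s| * n) ^ 2 := by
  obtain ⟨c, hc, N, hN⟩ := exists_centralMoment_two_ge hμ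
  refine ⟨min (1 / 5) (c / 850304), by positivity, c / 4, by positivity, N, fun n hn s hs => ?_⟩
  have h := norm_psi_sub_quadratic_le hμ n s
  have hu0 : 0 ≤ |s| * n := by positivity
  have hu1 := hs.trans (min_le_left _ _)
  have hu2 := hs.trans (min_le_right _ _)
  have hm1 : s ^ 2 * (c * (n : ℝ) ^ 2) ≤ s ^ 2 * centralMoment (μ n) 2 :=
    mul_le_mul_of_nonneg_left (hN n hn) (sq_nonneg s)
  have hm2 : s ^ 2 * centralMoment (μ n) 2 ≤ s ^ 2 * (48 * (n : ℝ) ^ 2) :=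
    mul_le_mul_of_nonneg_left (centralMoment_two_le hμ n) (sq_nonneg s)
  have e1 : s ^ 2 * (c * (n : ℝ) ^ 2) = c * (|s| * n) ^ 2 := by rw [mul_pow, sq_abs]; ring
  have e2 : s ^ 2 * (48 * (n : ℝ) ^ 2) = 48 * (|s| * n) ^ 2 := by rw [mul_pow, sq_abs]; ring
  rw [e1] at hm1
  rw [e2] at hm2
  set u := |s| * n
  have h2 : ‖psi μ n s‖ ≤ ‖((1 - s ^ 2 * centralMoment (μ n) 2 / 2 : ℝ) : ℂ)‖ + 212576 * u ^ 3 :=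
    (norm_le_norm_add_norm_sub' _ _).trans (by gcongr)
  rw [Complex.norm_real, Real.norm_of_nonneg (by nlinarith)] at h2
  have h3 : u ^ 3 ≤ c / 850304 * u ^ 2 := by nlinarith [mul_nonneg hu0 hu0]
  linarith

end CharacteristicFunction

section Interpolation

lemma norm_mul_mul_sub_le {a b c a' b' c' : ℂ} (ha' : ‖a'‖ ≤ 1) (hb : ‖b‖ ≤ 1) (hb' : ‖b'‖ ≤ 1)
    (hc : ‖c‖ ≤ 1) :
    ‖a * b * c - a' * b' * c'‖ ≤ ‖a - a'‖ + ‖b - b'‖ + ‖c - c'‖ := by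
  have e : a * b * c - a' * b' * c'
      = (a - a') * (b * c) + a' * c * (b - b') + a' * b' * (c - c') := by ring
  rw [e]
  refine (norm_add_le _ _).trans (add_le_add ((norm_add_le _ _).trans (add_le_add ?_ ?_)) ?_)
  · rw [norm_mul, norm_mul]
    exact mul_le_of_le_one_right (norm_nonneg _) (mul_le_one₀ hb (norm_nonneg _) hc)
  · rw [norm_mul, norm_mul]
    exact mul_le_of_le_one_left (norm_nonneg _) (mul_le_one₀ ha' (norm_nonneg _) hc)
  · rw [norm_mul, norm_mul]
    exact mul_le_of_le_one_left (norm_nonneg _) (mul_le_one₀ ha' (norm_nonneg _) hb')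

lemma norm_exp_sub_exp_le (x y : ℝ) :
    ‖Complex.exp ((x : ℂ) * Complex.I) - Complex.exp ((y : ℂ) * Complex.I)‖ ≤ |x - y| := by
  have e : Complex.exp ((x : ℂ) * Complex.I) - Complex.exp ((y : ℂ) * Complex.I)
      = Complex.exp ((y : ℂ) * Complex.I) * (Complex.exp (Complex.I * ((x - y : ℝ) : ℂ)) - 1) := by
    rw [mul_sub (Complex.exp _), ← Complex.exp_add, mul_one]
    congr 2; push_cast; ring
  rw [e, norm_mul, Complex.norm_exp_ofReal_mul_I, one_mul]
  exact Real.norm_exp_I_mul_ofReal_sub_one_le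

section Floor

variable {n m : ℕ} {v : ℝ}

lemma floor_mul_lt (hn : 1 ≤ n) (hv0 : 0 ≤ v) (hv1 : v < 1) : ⌊n * v⌋₊ < n := by
  have hn0 : (0 : ℝ) < n := by exact_mod_cast hn
  rw [Nat.floor_lt (by positivity)]
  nlinarith

lemma floor_mul_div_le (hn : 1 ≤ n) (hv0 : 0 ≤ v) : (⌊n * v⌋₊ : ℝ) / n ≤ v := by
  have hn0 : (0 : ℝ) < n := by exact_mod_cast hn
  rw [div_le_iff₀ hn0, mul_comm]
  exact Nat.floor_le (by positivity)

lemma le_floor_mul_div (hn : 1 ≤ n) : v - 1 / n ≤ (⌊n * v⌋₊ : ℝ) / n := by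
  have hn0 : (0 : ℝ) < n := by exact_mod_cast hn
  rw [le_div_iff₀ hn0, sub_mul, div_mul_cancel₀ _ hn0.ne']
  linarith [Nat.lt_floor_add_one ((n : ℝ) * v)]

lemma cast_sub_floor_div (hn : 1 ≤ n) (hv0 : 0 ≤ v) (hv1 : v < 1) :
    ((n - 1 - ⌊n * v⌋₊ : ℕ) : ℝ) / n = 1 - 1 / n - ⌊n * v⌋₊ / n := by
  have hn0 : (0 : ℝ) < n := by exact_mod_cast hn
  have := floor_mul_lt hn hv0 hv1
  rw [Nat.cast_sub (by omega), Nat.cast_sub hn]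
  field_simp
  simp

lemma floor_mul_mono (hnm : n ≤ m) (hv0 : 0 ≤ v) : ⌊n * v⌋₊ ≤ ⌊m * v⌋₊ :=
  Nat.floor_le_floor (by gcongr)

lemma sub_floor_mul_mono (hn : 1 ≤ n) (hnm : n ≤ m) (hv0 : 0 ≤ v) (hv1 : v < 1) :
    n - 1 - ⌊n * v⌋₊ ≤ m - 1 - ⌊m * v⌋₊ := by
  have h1 := floor_mul_lt hn hv0 hv1
  have h2 := floor_mul_lt (hn.trans hnm) hv0 hv1
  have h3 : (⌊m * v⌋₊ : ℝ) < ⌊n * v⌋₊ + 1 + (m - n) := by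
    have := Nat.floor_le (a := (m : ℝ) * v) (by positivity)
    have := Nat.lt_floor_add_one ((n : ℝ) * v)
    have : (n : ℝ) ≤ m := by exact_mod_cast hnm
    nlinarith
  have h4 : ⌊m * v⌋₊ + n < ⌊n * v⌋₊ + 1 + m := by
    rw [← Nat.cast_lt (α := ℝ)]; push_cast; linarith
  omega

end Floor

lemma intervalIntegrable_floor_floor {F : ℕ → ℕ → ℂ} {C : ℝ} (hF : ∀ k l, ‖F k l‖ ≤ C) (n m : ℕ) :
    IntervalIntegrable (fun v : ℝ => F ⌊n * v⌋₊ ⌊m * v⌋₊) volume 0 1 := by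
  rw [intervalIntegrable_iff_integrableOn_Ioc_of_le zero_le_one]
  refine Integrable.of_bound (C := C) ?_ (ae_of_all _ fun v => hF _ _)
  refine (StronglyMeasurable.comp_measurable (f := fun p : ℕ × ℕ => F p.1 p.2)
    (g := fun v : ℝ => (⌊n * v⌋₊, ⌊m * v⌋₊)) StronglyMeasurable.of_discrete
      ?_).aestronglyMeasurable
  exact (Nat.measurable_floor.comp (by fun_prop)).prodMk (Nat.measurable_floor.comp (by fun_prop))

variable {μ : ℕ → Measure ℤ}

/-- The summand of the recursion at the scale `n`. -/
noncomputable def recTerm (μ : ℕ → Measure ℤ) (n : ℕ) (t : ℝ) (k : ℕ) : ℂ :=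
  Complex.exp (((t * (toll n k / n) : ℝ) : ℂ) * Complex.I) * psi μ k (t / n)
    * psi μ (n - 1 - k) (t / n)

/-- The summand at scale `n` with the two characteristic functions replaced by those
occurring at scale `m`. -/
noncomputable def mixedTerm (μ : ℕ → Measure ℤ) (n m : ℕ) (t : ℝ) (k l : ℕ) : ℂ :=
  Complex.exp (((t * (toll n k / n) : ℝ) : ℂ) * Complex.I) * psi μ l (t * (k / n) / l)
    * psi μ (m - 1 - l) (t * ((n - 1 - k : ℕ) / n) / (m - 1 - l : ℕ))

lemma psi_eq_integral_recTerm (hμ : IsQuicksortLaw μ) {n : ℕ} (hn : 1 ≤ n) (t : ℝ) :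
    psi μ n (t / n) = ∫ v in (0 : ℝ)..1, recTerm μ n t ⌊n * v⌋₊ := by
  rw [integral_floor _ hn, psi_rec hμ hn]
  congr 1
  refine Finset.sum_congr rfl fun k _ => ?_
  rw [recTerm]
  congr 5
  ring

lemma norm_mixedTerm_le (hμ : IsQuicksortLaw μ) (n m : ℕ) (t : ℝ) (k l : ℕ) :
    ‖mixedTerm μ n m t k l‖ ≤ 1 := by
  rw [mixedTerm, norm_mul, norm_mul, Complex.norm_exp_ofReal_mul_I, one_mul]
  exact mul_le_one₀ (norm_psi_le_one hμ _ _) (norm_nonneg _) (norm_psi_le_one hμ _ _)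

lemma norm_psi_scaled_sub_le (hμ : IsQuicksortLaw μ) (l m : ℕ) (t a : ℝ) :
    ‖psi μ l (t * a / l) - psi μ l (t / m)‖ ≤ 7 * |t| * |a - l / m| := by
  rcases Nat.eq_zero_or_pos l with rfl | hl
  · simp [psi_zero hμ]
    positivity
  have hl0 : (0 : ℝ) < l := by exact_mod_cast hl
  refine (norm_psi_sub_psi_le hμ _ _ _).trans_eq ?_
  have e : t * (a - l / m) = l * (t * a / l - t / m) := by field_simp
  rw [mul_assoc, mul_assoc, ← abs_mul, e, abs_mul, abs_of_pos hl0]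

lemma norm_psi_scaled_sub_one_le (hμ : IsQuicksortLaw μ) (l : ℕ) (t a : ℝ) :
    ‖psi μ l (t * a / l) - 1‖ ≤ 144 * (t * a) ^ 2 := by
  rcases Nat.eq_zero_or_pos l with rfl | hl
  · simp [psi_zero hμ]
    positivity
  have hl0 : (l : ℝ) ≠ 0 := by exact_mod_cast hl.ne'
  refine (norm_psi_sub_one_le hμ _ _).trans_eq ?_
  rw [div_mul_cancel₀ _ hl0]

lemma norm_mixedTerm_sub_recTerm_le (hμ : IsQuicksortLaw μ) {n m : ℕ} (hn : 1 ≤ n) (hnm : n ≤ m)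
    (t : ℝ) {v : ℝ} (hv0 : 0 ≤ v) (hv1 : v < 1) :
    ‖mixedTerm μ n m t ⌊n * v⌋₊ ⌊m * v⌋₊ - recTerm μ m t ⌊m * v⌋₊‖ ≤ 58 * |t| / √n := by
  have hm := hn.trans hnm
  have hn0 : (0 : ℝ) < n := by exact_mod_cast hn
  have hn1 : (1 : ℝ) ≤ n := by exact_mod_cast hn
  have hm0 : (0 : ℝ) < m := by exact_mod_cast hm
  have hmn : 1 / (m : ℝ) ≤ 1 / n := by gcongr
  have hmn' : 15 / √(m : ℝ) ≤ 15 / √n := by gcongr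
  have hsq : 1 / (n : ℝ) ≤ 1 / √n := by
    gcongr
    rw [Real.sqrt_le_left (by positivity)]; nlinarith
  have h0 := floor_mul_div_le hn hv0
  have h1 := floor_mul_div_le hm hv0
  have h2 := le_floor_mul_div (v := v) hn
  have h3 := le_floor_mul_div (v := v) hm
  have h4 := abs_toll_div_sub_limToll hn hv0 hv1
  have h5 := abs_toll_div_sub_limToll hm hv0 hv1
  refine (norm_mul_mul_sub_le (Complex.norm_exp_ofReal_mul_I _).le (norm_psi_le_one hμ _ _)
    (norm_psi_le_one hμ _ _) (norm_psi_le_one hμ _ _)).trans ?_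
  have k1 : ‖Complex.exp (((t * (toll n ⌊n * v⌋₊ / n) : ℝ) : ℂ) * Complex.I)
      - Complex.exp (((t * (toll m ⌊m * v⌋₊ / m) : ℝ) : ℂ) * Complex.I)‖ ≤ |t| * (30 / √n) := by
    refine (norm_exp_sub_exp_le _ _).trans ?_
    rw [← mul_sub, abs_mul]
    gcongr
    rw [abs_le] at h4 h5 ⊢
    have : 30 / √(n : ℝ) = 15 / √n + 15 / √n := by ring
    constructor <;> linarith
  have k2 : 7 * |t| * |(⌊n * v⌋₊ : ℝ) / n - ⌊m * v⌋₊ / m| ≤ 7 * |t| * (2 * (1 / √n)) := by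
    gcongr
    rw [abs_le]; constructor <;> linarith [one_div_pos.2 hn0]
  have k3 : 7 * |t| * |((n - 1 - ⌊n * v⌋₊ : ℕ) : ℝ) / n - (m - 1 - ⌊m * v⌋₊ : ℕ) / m|
      ≤ 7 * |t| * (2 * (1 / √n)) := by
    gcongr
    rw [cast_sub_floor_div hn hv0 hv1, cast_sub_floor_div hm hv0 hv1]
    rw [abs_le]; constructor <;> linarith [one_div_pos.2 hn0, one_div_pos.2 hm0]
  have e : 58 * |t| / √n
      = |t| * (30 / √n) + 7 * |t| * (2 * (1 / √n)) + 7 * |t| * (2 * (1 / √n)) := by ring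
  rw [e]
  gcongr
  · exact (norm_psi_scaled_sub_le hμ _ _ _ _).trans k2
  · exact (norm_psi_scaled_sub_le hμ _ _ _ _).trans k3

lemma norm_integral_mixedTerm_sub_one_le (hμ : IsQuicksortLaw μ) {n m : ℕ} (hn : 1 ≤ n) (t : ℝ) :
    ‖(∫ v in (0 : ℝ)..1, mixedTerm μ n m t ⌊n * v⌋₊ ⌊m * v⌋₊) - 1‖ ≤ 336 * t ^ 2 := by
  have hn0 : (0 : ℝ) < n := by exact_mod_cast hn
  have hM := intervalIntegrable_floor_floor (norm_mixedTerm_le hμ n m t) n m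
  have hT := intervalIntegrable_floor (fun k => ((t * (toll n k / n) : ℝ) : ℂ) * Complex.I) n
  have hz : ∫ v in (0 : ℝ)..1, ((t * (toll n ⌊n * v⌋₊ / n) : ℝ) : ℂ) * Complex.I = 0 := by
    rw [integral_floor (fun k => ((t * (toll n k / n) : ℝ) : ℂ) * Complex.I) hn, ← Finset.sum_mul,
      ← Complex.ofReal_sum, ← Finset.mul_sum, ← Finset.sum_div, sum_toll]
    simp
  have e : (∫ v in (0 : ℝ)..1, mixedTerm μ n m t ⌊n * v⌋₊ ⌊m * v⌋₊) - 1
      = ∫ v in (0 : ℝ)..1, (mixedTerm μ n m t ⌊n * v⌋₊ ⌊m * v⌋₊ - 1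
        - ((t * (toll n ⌊n * v⌋₊ / n) : ℝ) : ℂ) * Complex.I) := by
    rw [intervalIntegral.integral_sub (hM.sub (by simp)) hT,
      intervalIntegral.integral_sub hM (by simp), hz]
    simp
  rw [e]
  have h := intervalIntegral.norm_integral_le_of_norm_le_const_ae (a := 0) (b := 1)
    (C := 336 * t ^ 2) (f := fun v : ℝ => mixedTerm μ n m t ⌊n * v⌋₊ ⌊m * v⌋₊ - 1
        - ((t * (toll n ⌊n * v⌋₊ / n) : ℝ) : ℂ) * Complex.I) ?_
  · simpa using h
  have hne : ∀ᵐ v ∂(volume : Measure ℝ), v ≠ 1 := by simp [ae_iff, measure_singleton]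
  filter_upwards [hne] with v hv1 hv
  rw [Set.uIoc_of_le zero_le_one] at hv
  have hv0 : 0 ≤ v := hv.1.le
  have hv1 : v < 1 := lt_of_le_of_ne hv.2 hv1
  have hg := abs_toll_div_le (floor_mul_lt hn hv0 hv1)
  have ha0 : 0 ≤ (⌊n * v⌋₊ : ℝ) / n := by positivity
  have ha1 : (⌊n * v⌋₊ : ℝ) / n ≤ 1 := (floor_mul_div_le hn hv0).trans hv1.le
  have hb0 : 0 ≤ ((n - 1 - ⌊n * v⌋₊ : ℕ) : ℝ) / n := by positivity
  have hb1 : ((n - 1 - ⌊n * v⌋₊ : ℕ) : ℝ) / n ≤ 1 := by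
    rw [cast_sub_floor_div hn hv0 hv1]
    linarith [one_div_pos.2 hn0]
  have hp := norm_psi_scaled_sub_one_le hμ ⌊m * v⌋₊ t (⌊n * v⌋₊ / n)
  have hq := norm_psi_scaled_sub_one_le hμ (m - 1 - ⌊m * v⌋₊) t ((n - 1 - ⌊n * v⌋₊ : ℕ) / n)
  have hx := norm_exp_ofReal_mul_I_sub_one_sub_le (t * (toll n ⌊n * v⌋₊ / n))
  have hq1 := norm_psi_le_one hμ (m - 1 - ⌊m * v⌋₊) (t * ((n - 1 - ⌊n * v⌋₊ : ℕ) / n)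
    / (m - 1 - ⌊m * v⌋₊ : ℕ))
  have hx1 := Complex.norm_exp_ofReal_mul_I (t * (toll n ⌊n * v⌋₊ / n))
  rw [mixedTerm]
  set p := psi μ ⌊m * v⌋₊ (t * (⌊n * v⌋₊ / n) / ⌊m * v⌋₊)
  set q := psi μ (m - 1 - ⌊m * v⌋₊) (t * ((n - 1 - ⌊n * v⌋₊ : ℕ) / n)
    / (m - 1 - ⌊m * v⌋₊ : ℕ))
  set g := toll n ⌊n * v⌋₊ / n
  set a := (⌊n * v⌋₊ : ℝ) / n
  set b := ((n - 1 - ⌊n * v⌋₊ : ℕ) : ℝ) / n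
  set x := Complex.exp (((t * g : ℝ) : ℂ) * Complex.I)
  have e2 : x * p * q - 1 - ((t * g : ℝ) : ℂ) * Complex.I
      = (x - 1 - ((t * g : ℝ) : ℂ) * Complex.I) + x * q * (p - 1) + x * (q - 1) := by ring
  rw [e2]
  have t2 : 0 ≤ t ^ 2 := sq_nonneg t
  have ha2 : (t * a) ^ 2 ≤ t ^ 2 := by
    rw [mul_pow]; exact mul_le_of_le_one_right t2 (pow_le_one₀ ha0 ha1)
  have hb2 : (t * b) ^ 2 ≤ t ^ 2 := by
    rw [mul_pow]; exact mul_le_of_le_one_right t2 (pow_le_one₀ hb0 hb1)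
  have hg2 : (t * g) ^ 2 ≤ t ^ 2 * 16 := by
    rw [mul_pow, ← sq_abs g]; gcongr; nlinarith [abs_nonneg g]
  calc _ ≤ ‖x - 1 - ((t * g : ℝ) : ℂ) * Complex.I‖ + ‖x * q * (p - 1)‖ + ‖x * (q - 1)‖ :=
        (norm_add_le _ _).trans (by gcongr; exact norm_add_le _ _)
    _ ≤ 3 * (t * g) ^ 2 + 144 * (t * a) ^ 2 + 144 * (t * b) ^ 2 := by
        rw [norm_mul, norm_mul, norm_mul, hx1, one_mul, one_mul]
        exact add_le_add (add_le_add hx ((mul_le_of_le_one_left (norm_nonneg _) hq1).trans hp)) hq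
    _ ≤ 336 * t ^ 2 := by linarith

end Interpolation

section CauchyEstimate

variable {μ : ℕ → Measure ℤ}

lemma norm_integral_mixedTerm_sub_psi_le_sq (hμ : IsQuicksortLaw μ) {n m : ℕ} (hn : 1 ≤ n)
    (hnm : n ≤ m) (t : ℝ) :
    ‖(∫ v in (0 : ℝ)..1, mixedTerm μ n m t ⌊n * v⌋₊ ⌊m * v⌋₊) - psi μ m (t / m)‖
      ≤ 480 * t ^ 2 := by
  have hm0 : (m : ℝ) ≠ 0 := by exact_mod_cast (show m ≠ 0 by omega)
  have h1 := norm_integral_mixedTerm_sub_one_le hμ (m := m) hn t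
  have h2 := norm_psi_sub_one_le hμ m (t / m)
  rw [div_mul_cancel₀ _ hm0, norm_sub_rev] at h2
  refine (norm_sub_le_norm_sub_add_norm_sub _ 1 _).trans ?_
  linarith

lemma norm_integral_mixedTerm_sub_psi_le_sqrt (hμ : IsQuicksortLaw μ) {n m : ℕ} (hn : 1 ≤ n)
    (hnm : n ≤ m) (t : ℝ) :
    ‖(∫ v in (0 : ℝ)..1, mixedTerm μ n m t ⌊n * v⌋₊ ⌊m * v⌋₊) - psi μ m (t / m)‖
      ≤ 58 * |t| / √n := by
  rw [psi_eq_integral_recTerm hμ (hn.trans hnm), ← intervalIntegral.integral_sub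
    (intervalIntegrable_floor_floor (norm_mixedTerm_le hμ n m t) n m)
    (intervalIntegrable_floor _ _)]
  have h := intervalIntegral.norm_integral_le_of_norm_le_const_ae (a := 0) (b := 1)
    (C := 58 * |t| / √n) (f := fun v : ℝ => mixedTerm μ n m t ⌊n * v⌋₊ ⌊m * v⌋₊
      - recTerm μ m t ⌊m * v⌋₊) ?_
  · simpa using h
  have hne : ∀ᵐ v ∂(volume : Measure ℝ), v ≠ 1 := by simp [ae_iff, measure_singleton]
  filter_upwards [hne] with v hv1 hv
  rw [Set.uIoc_of_le zero_le_one] at hv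
  exact norm_mixedTerm_sub_recTerm_le hμ hn hnm t hv.1.le (lt_of_le_of_ne hv.2 hv1)

lemma rpow_interpolation {t N : ℝ} (ht : 0 ≤ t) (hN : 0 < N) :
    √(480 * t ^ 2 * (58 * t / √N)) ≤ 167 * (t ^ (3 / 2 : ℝ) * N ^ (-(1 / 4) : ℝ)) := by
  rw [Real.sqrt_le_left (by positivity), mul_pow, mul_pow, ← Real.rpow_natCast,
    ← Real.rpow_natCast (_ ^ (_ : ℝ)), ← Real.rpow_natCast (_ ^ (_ : ℝ)), ← Real.rpow_mul ht,
    ← Real.rpow_mul hN.le, Real.sqrt_eq_rpow]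
  norm_num
  rw [Real.rpow_neg hN.le, ← div_eq_mul_inv]
  have : 480 * t ^ 2 * (58 * t / N ^ (1 / 2 : ℝ)) = 27840 * (t ^ 3 / N ^ (1 / 2 : ℝ)) := by ring
  rw [this]
  gcongr
  norm_num

lemma norm_integral_mixedTerm_sub_psi_le (hμ : IsQuicksortLaw μ) {n m : ℕ} (hn : 1 ≤ n)
    (hnm : n ≤ m) (t : ℝ) :
    ‖(∫ v in (0 : ℝ)..1, mixedTerm μ n m t ⌊n * v⌋₊ ⌊m * v⌋₊) - psi μ m (t / m)‖
      ≤ 167 * (|t| ^ (3 / 2 : ℝ) * (n : ℝ) ^ (-(1 / 4) : ℝ)) := by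
  have hn0 : (0 : ℝ) < n := by exact_mod_cast hn
  refine le_trans ?_ (rpow_interpolation (abs_nonneg t) hn0)
  refine Real.le_sqrt_of_sq_le ?_
  rw [sq, sq_abs]
  exact mul_le_mul (norm_integral_mixedTerm_sub_psi_le_sq hμ hn hnm t)
    (norm_integral_mixedTerm_sub_psi_le_sqrt hμ hn hnm t) (norm_nonneg _) (by positivity)

lemma scaled_bound {A t a N : ℝ} {k : ℕ} (hk : 1 ≤ k) (hN : 0 < N) (ha : a = k / N) :
    A * (|t * a| ^ (3 / 2 : ℝ) * (k : ℝ) ^ (-(1 / 4) : ℝ))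
      = A * (|t| ^ (3 / 2 : ℝ) * N ^ (-(1 / 4) : ℝ)) * a ^ (5 / 4 : ℝ) := by
  have hk0 : (0 : ℝ) < k := by exact_mod_cast hk
  have ha0 : 0 < a := by rw [ha]; positivity
  have e : (k : ℝ) = a * N := by rw [ha]; field_simp
  rw [abs_mul, abs_of_pos ha0, Real.mul_rpow (abs_nonneg _) ha0.le, e,
    Real.mul_rpow ha0.le hN.le]
  have : a ^ (3 / 2 : ℝ) * a ^ (-(1 / 4) : ℝ) = a ^ (5 / 4 : ℝ) := by
    rw [← Real.rpow_add ha0]; norm_num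
  rw [← this]; ring

lemma norm_psi_sub_le_of_forall_lt (hμ : IsQuicksortLaw μ) {A : ℝ} {k l N : ℕ}
    (hN : 1 ≤ N) (hkN : k < N) (hkl : k ≤ l) (t : ℝ)
    (ih : 1 ≤ k → ∀ t : ℝ, ‖psi μ k (t / k) - psi μ l (t / l)‖
      ≤ A * (|t| ^ (3 / 2 : ℝ) * (k : ℝ) ^ (-(1 / 4) : ℝ))) :
    ‖psi μ k (t / N) - psi μ l (t * (k / N) / l)‖
      ≤ A * (|t| ^ (3 / 2 : ℝ) * (N : ℝ) ^ (-(1 / 4) : ℝ)) * (k / N : ℝ) ^ (5 / 4 : ℝ) := by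
  have hN0 : (0 : ℝ) < N := by exact_mod_cast hN
  rcases Nat.eq_zero_or_pos k with rfl | hk
  · simp [psi_zero hμ, psi_zero_right hμ]
  have hk0 : (0 : ℝ) < k := by exact_mod_cast hk
  have h := ih hk (t * (k / N))
  rw [scaled_bound hk hN0 rfl] at h
  rwa [show t * (k / N) / k = t / N by field_simp] at h

lemma integral_rpow_add_rpow :
    ∫ v in (0 : ℝ)..1, (v ^ (5 / 4 : ℝ) + (1 - v) ^ (5 / 4 : ℝ)) = 8 / 9 := by
  have h1 : ∫ v in (0 : ℝ)..1, v ^ (5 / 4 : ℝ) = 4 / 9 := by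
    rw [integral_rpow (by left; norm_num)]; norm_num
  have h2 : ∫ v in (0 : ℝ)..1, (1 - v) ^ (5 / 4 : ℝ) = 4 / 9 := by
    rw [intervalIntegral.integral_comp_sub_left (fun v => v ^ (5 / 4 : ℝ)) 1]; simpa using h1
  have hc : Continuous fun v : ℝ => v ^ (5 / 4 : ℝ) :=
    Real.continuous_rpow_const (by norm_num)
  have hc' : Continuous fun v : ℝ => (1 - v) ^ (5 / 4 : ℝ) :=
    hc.comp (continuous_const.sub continuous_id)
  rw [intervalIntegral.integral_add (hc.intervalIntegrable _ _) (hc'.intervalIntegrable _ _),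
    h1, h2]
  norm_num

/-- The rescaled characteristic functions form a Cauchy sequence, with a rate. -/
lemma norm_psi_sub_psi_scaled_le (hμ : IsQuicksortLaw μ) (n m : ℕ) (hn : 1 ≤ n) (hnm : n ≤ m)
    (t : ℝ) :
    ‖psi μ n (t / n) - psi μ m (t / m)‖
      ≤ 1503 * (|t| ^ (3 / 2 : ℝ) * (n : ℝ) ^ (-(1 / 4) : ℝ)) := by
  induction n using Nat.strong_induction_on generalizing m t with
  | _ n ih =>
    have hn0 : (0 : ℝ) < n := by exact_mod_cast hn
    set B := |t| ^ (3 / 2 : ℝ) * (n : ℝ) ^ (-(1 / 4) : ℝ) with hB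
    have hB0 : 0 ≤ B := by positivity
    have hM := intervalIntegrable_floor_floor (norm_mixedTerm_le hμ n m t) n m
    have hc : Continuous fun v : ℝ => v ^ (5 / 4 : ℝ) :=
      Real.continuous_rpow_const (by norm_num)
    have h1 : ‖psi μ n (t / n) - ∫ v in (0 : ℝ)..1, mixedTerm μ n m t ⌊n * v⌋₊ ⌊m * v⌋₊‖
        ≤ 1336 * B := by
      rw [psi_eq_integral_recTerm hμ hn, ← intervalIntegral.integral_sub
        (intervalIntegrable_floor _ _) hM]
      have e : 1336 * B = ∫ v in (0 : ℝ)..1,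
          1503 * B * (v ^ (5 / 4 : ℝ) + (1 - v) ^ (5 / 4 : ℝ)) := by
        rw [intervalIntegral.integral_const_mul, integral_rpow_add_rpow]; ring
      rw [e]
      refine intervalIntegral.norm_integral_le_of_norm_le zero_le_one ?_
        ((continuous_const.mul (hc.add (hc.comp
          (continuous_const.sub continuous_id)))).intervalIntegrable _ _)
      have hne : ∀ᵐ v ∂(volume : Measure ℝ), v ≠ 1 := by simp [ae_iff, measure_singleton]
      filter_upwards [hne] with v hv1 hv
      have hv0 : 0 ≤ v := hv.1.le
      have hv1 : v < 1 := lt_of_le_of_ne hv.2 hv1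
      have hk := floor_mul_lt hn hv0 hv1
      have hb : ((n - 1 - ⌊n * v⌋₊ : ℕ) : ℝ) / n ≤ 1 - v := by
        rw [cast_sub_floor_div hn hv0 hv1]
        linarith [le_floor_mul_div (v := v) hn]
      refine (norm_mul_mul_sub_le (Complex.norm_exp_ofReal_mul_I _).le (norm_psi_le_one hμ _ _)
        (norm_psi_le_one hμ _ _) (norm_psi_le_one hμ _ _)).trans ?_
      rw [sub_self, norm_zero, zero_add, mul_add]
      have hA : (0 : ℝ) ≤ 1503 * B := by positivity
      refine add_le_add ?_ ?_
      · refine (norm_psi_sub_le_of_forall_lt hμ hn hk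
          (floor_mul_mono hnm hv0) t fun h t' => ih _ hk _ h (floor_mul_mono hnm hv0) t').trans ?_
        gcongr
        exact floor_mul_div_le hn hv0
      · refine (norm_psi_sub_le_of_forall_lt hμ hn (by omega)
          (sub_floor_mul_mono hn hnm hv0 hv1) t fun h t' => ih _ (by omega) _ h
            (sub_floor_mul_mono hn hnm hv0 hv1) t').trans ?_
        gcongr
    have h2 := norm_integral_mixedTerm_sub_psi_le hμ hn hnm t
    refine (norm_sub_le_norm_sub_add_norm_sub _ _ _).trans ((add_le_add h1 h2).trans ?_)
    rw [← hB]; linarith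

end CauchyEstimate

section ExponentialDecay

section Convolution

variable {a : ℕ → ℝ}

lemma le_one_sub_of_window (ha0 : ∀ n, 0 ≤ a n) (ha1 : ∀ n, a n ≤ 1)
    (hrec : ∀ n, 1 ≤ n → n * a n ≤ ∑ k ∈ Finset.range n, a k * a (n - 1 - k))
    {η : ℝ} {k₀ : ℕ} (hw : ∀ k, k₀ ≤ k → k ≤ 2 * k₀ → a k ≤ 1 - η) (n : ℕ) (hn : k₀ ≤ n) :
    a n ≤ 1 - η := by
  induction n using Nat.strong_induction_on with
  | _ n ih =>
    rcases le_or_gt n (2 * k₀) with h | h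
    · exact hw n hn h
    have hn0 : (0 : ℝ) < n := by exact_mod_cast (show 0 < n by omega)
    have hs : ∑ k ∈ Finset.range n, a k * a (n - 1 - k) ≤ ∑ k ∈ Finset.range n, (1 - η) := by
      refine Finset.sum_le_sum fun k hk => ?_
      rw [Finset.mem_range] at hk
      rcases le_or_gt k₀ k with h1 | h1
      · exact (mul_le_of_le_one_right (ha0 _) (ha1 _)).trans (ih k hk h1)
      · exact (mul_le_of_le_one_left (ha0 _) (ha1 _)).trans (ih _ (by omega) (by omega))
    rw [Finset.sum_const, Finset.card_range, nsmul_eq_mul] at hs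
    exact le_of_mul_le_mul_left ((hrec n (by omega)).trans hs) hn0

lemma le_exp_of_le_one_sub (ha0 : ∀ n, 0 ≤ a n) (ha1 : ∀ n, a n ≤ 1)
    (hrec : ∀ n, 1 ≤ n → n * a n ≤ ∑ k ∈ Finset.range n, a k * a (n - 1 - k))
    {η : ℝ} (hη0 : 0 ≤ η) (hη1 : η ≤ 1) {k₀ : ℕ} (hk₀ : 1 ≤ k₀)
    (hη : ∀ k, k₀ ≤ k → a k ≤ 1 - η) (n : ℕ) :
    a n ≤ Real.exp 1 * Real.exp (-(η / 8 * (n / k₀))) := by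
  have hk : (0 : ℝ) < k₀ := by exact_mod_cast hk₀
  set r : ℕ → ℝ := fun j => Real.exp (η / 8 * (j / k₀)) with hr
  have hr0 : ∀ j, 0 < r j := fun j => Real.exp_pos _
  have hr1 : ∀ j, 1 ≤ r j := fun j => Real.one_le_exp (by positivity)
  have hradd : ∀ i j, r i * r j = r (i + j) := fun i j => by
    simp only [hr]; rw [← Real.exp_add]; congr 1; push_cast; ring
  have hrmono : ∀ i j, i ≤ j → r i ≤ r j := fun i j hij => by
    simp only [hr]; gcongr
  have hrk : ∀ c : ℕ, r (c * k₀) = Real.exp (η / 8 * c) := fun c => by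
    simp only [hr]; congr 1; push_cast; field_simp
  have hfour : Real.exp (η / 8 * 4) * (1 - η / 2) ≤ 1 := by
    calc _ ≤ Real.exp (η / 8 * 4) * Real.exp (-(η / 2)) := by
          gcongr; linarith [Real.add_one_le_exp (-(η / 2))]
      _ = 1 := by rw [← Real.exp_add]; ring_nf; simp
  have htwo : Real.exp (η / 8 * 2) * (1 - η / 2) ≤ 1 := by
    refine le_trans ?_ hfour
    gcongr
    · linarith
    · norm_num
  set d : ℕ → ℝ := fun k => a k * r (k + 1) with hd
  have hd0 : ∀ k, 0 ≤ d k := fun k => mul_nonneg (ha0 _) (hr0 _).le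
  have hinit : ∑ k ∈ Finset.range (2 * k₀), d k ≤ 2 * k₀ := by
    have h1 : ∀ k ∈ Finset.range (2 * k₀), d k
        ≤ (if k < k₀ then (1 : ℝ) else 1 - η) * Real.exp (η / 8 * 2) := by
      intro k hk'
      rw [Finset.mem_range] at hk'
      have h2 : r (k + 1) ≤ Real.exp (η / 8 * 2) := by
        have := hrk 2
        push_cast at this
        rw [← this]; exact hrmono _ _ (by omega)
      refine mul_le_mul ?_ h2 (hr0 _).le ?_
      · split_ifs with h
        · exact ha1 k
        · exact hη k (by omega)
      · split_ifs <;> linarith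
    refine (Finset.sum_le_sum h1).trans ?_
    rw [← Finset.sum_mul, two_mul, Finset.sum_range_add]
    have e1 : ∑ k ∈ Finset.range k₀, (if k < k₀ then (1 : ℝ) else 1 - η) = k₀ := by
      rw [Finset.sum_congr rfl fun k hk' => if_pos (Finset.mem_range.1 hk')]; simp
    have e2 : ∑ k ∈ Finset.range k₀, (if k₀ + k < k₀ then (1 : ℝ) else 1 - η) = k₀ * (1 - η) := by
      simp [mul_sub]
    rw [e1, e2]
    calc _ = 2 * k₀ * (Real.exp (η / 8 * 2) * (1 - η / 2)) := by ring
      _ ≤ 2 * k₀ * 1 := by gcongr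
      _ = _ := by ring
  have hmain : ∀ n, 2 * k₀ ≤ n → d n ≤ 1 := by
    intro n hn
    induction n using Nat.strong_induction_on with
    | _ n ih =>
      rcases lt_or_ge n (4 * k₀) with h | h
      · have h2 : r (n + 1) ≤ Real.exp (η / 8 * 4) := by
          have := hrk 4
          push_cast at this
          rw [← this]; exact hrmono _ _ (by omega)
        calc d n ≤ (1 - η) * Real.exp (η / 8 * 4) := by
              refine mul_le_mul (hη n (by omega)) h2 (hr0 _).le (by linarith)
          _ ≤ Real.exp (η / 8 * 4) * (1 - η / 2) := by
              rw [mul_comm]; gcongr; linarith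
          _ ≤ 1 := hfour
      · set e : ℕ → ℝ := fun k => if k < 2 * k₀ then d k else 1 with he
        have hn0 : (0 : ℝ) < n := by exact_mod_cast (show 0 < n by omega)
        have hprod : ∀ k ∈ Finset.range n, a k * a (n - 1 - k) * r (n + 1)
            ≤ e k + e (n - 1 - k) - 1 := by
          intro k hk'
          rw [Finset.mem_range] at hk'
          have e1 : a k * a (n - 1 - k) * r (n + 1) = d k * d (n - 1 - k) := by
            simp only [hd]
            rw [show n + 1 = (k + 1) + (n - 1 - k + 1) by omega, ← hradd]; ring
          rw [e1]
          simp only [he]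
          split_ifs with h1 h2 h2
          · omega
          · have := ih (n - 1 - k) (by omega) (by omega)
            linarith [mul_le_of_le_one_right (hd0 k) this]
          · have := ih k hk' (by omega)
            linarith [mul_le_of_le_one_left (hd0 (n - 1 - k)) this]
          · have h3 := ih k hk' (by omega)
            have h4 := ih (n - 1 - k) (by omega) (by omega)
            linarith [mul_le_one₀ h3 (hd0 _) h4]
        have hsum : ∑ k ∈ Finset.range n, e k ≤ n := by
          rw [show n = 2 * k₀ + (n - 2 * k₀) by omega, Finset.sum_range_add]
          have e1 : ∑ k ∈ Finset.range (2 * k₀), e k = ∑ k ∈ Finset.range (2 * k₀), d k :=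
            Finset.sum_congr rfl fun k hk' => if_pos (Finset.mem_range.1 hk')
          have e2 : ∑ k ∈ Finset.range (n - 2 * k₀), e (2 * k₀ + k) = (n - 2 * k₀ : ℕ) := by
            simp [he]
          rw [e1, e2]; push_cast; linarith
        have hnd : n * d n ≤ n := by
          calc n * d n = n * a n * r (n + 1) := by simp only [hd]; ring
            _ ≤ (∑ k ∈ Finset.range n, a k * a (n - 1 - k)) * r (n + 1) := by
                have := (hr0 (n + 1)).le
                gcongr; exact hrec n (by omega)
            _ ≤ ∑ k ∈ Finset.range n, (e k + e (n - 1 - k) - 1) := by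
                rw [Finset.sum_mul]; exact Finset.sum_le_sum hprod
            _ = 2 * ∑ k ∈ Finset.range n, e k - n := by
                rw [Finset.sum_sub_distrib, Finset.sum_add_distrib, Finset.sum_range_reflect]
                simp; ring
            _ ≤ n := by linarith
        exact le_of_mul_le_mul_left (by linarith) hn0
  have hfin : a n * r n ≤ Real.exp 1 := by
    rcases lt_or_ge n (2 * k₀) with h | h
    · have h2 := hrk 2
      push_cast at h2
      calc a n * r n ≤ 1 * r (2 * k₀) :=
            mul_le_mul (ha1 _) (hrmono _ _ h.le) (hr0 _).le zero_le_one
        _ ≤ Real.exp 1 := by rw [one_mul, h2]; gcongr; linarith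
    · calc a n * r n ≤ d n := mul_le_mul_of_nonneg_left (hrmono _ _ (by omega)) (ha0 _)
        _ ≤ 1 := hmain n h
        _ ≤ Real.exp 1 := Real.one_le_exp zero_le_one
  rw [Real.exp_neg, ← div_eq_mul_inv, le_div_iff₀ (Real.exp_pos _)]
  exact hfin

end Convolution

variable {μ : ℕ → Measure ℤ}

lemma mul_norm_psi_le (hμ : IsQuicksortLaw μ) (s : ℝ) (n : ℕ) (hn : 1 ≤ n) :
    n * ‖psi μ n s‖ ≤ ∑ k ∈ Finset.range n, ‖psi μ k s‖ * ‖psi μ (n - 1 - k) s‖ := by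
  have hn0 : (0 : ℝ) < n := by exact_mod_cast hn
  rw [psi_rec hμ hn, norm_smul, norm_inv, Real.norm_of_nonneg hn0.le, mul_inv_cancel_left₀ hn0.ne']
  refine (norm_sum_le _ _).trans (Finset.sum_le_sum fun k _ => ?_)
  rw [norm_mul, norm_mul, Complex.norm_exp_ofReal_mul_I, one_mul]

lemma qsMean_one : qsMean 1 = 0 := by simp [qsMean]; norm_num

lemma qsMean_two : qsMean 2 = 1 := by simp [qsMean, harmonic, Finset.sum_range_succ]; norm_num

lemma qsMean_three : qsMean 3 = 8 / 3 := by
  simp [qsMean, harmonic, Finset.sum_range_succ]; norm_num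

lemma psi_one (hμ : IsQuicksortLaw μ) (s : ℝ) : psi μ 1 s = 1 := by
  rw [psi_rec hμ le_rfl]
  simp [toll, psi_zero hμ, qsMean_one]

lemma psi_two (hμ : IsQuicksortLaw μ) (s : ℝ) : psi μ 2 s = 1 := by
  rw [psi_rec hμ (by norm_num)]
  simp only [Finset.sum_range_succ, Finset.sum_range_zero]
  norm_num [toll, psi_zero hμ, psi_one hμ, qsMean_one, qsMean_two]

lemma psi_three (hμ : IsQuicksortLaw μ) (s : ℝ) :
    psi μ 3 s = Complex.exp (((-(2 / 3) * s : ℝ) : ℂ) * Complex.I)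
      * (2 * Complex.exp ((s : ℂ) * Complex.I) + 1) / 3 := by
  rw [psi_rec hμ (by norm_num)]
  simp only [Finset.sum_range_succ, Finset.sum_range_zero, toll, psi_zero hμ, psi_one hμ,
    psi_two hμ, qsMean_one, qsMean_two, qsMean_three, qsMean_zero]
  norm_num [psi_two hμ, psi_one hμ, psi_zero hμ, qsMean_one, qsMean_two]
  rw [mul_add, mul_left_comm, ← Complex.exp_add]
  rw [show -(2 / 3 * (s : ℂ) * Complex.I) + s * Complex.I = s * (1 / 3) * Complex.I by ring]
  rw [show -((s : ℂ) * (2 / 3) * Complex.I) = -(2 / 3 * (s : ℂ) * Complex.I) by ring]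
  ring

lemma norm_psi_three_sq (hμ : IsQuicksortLaw μ) (s : ℝ) :
    ‖psi μ 3 s‖ ^ 2 = (5 + 4 * Real.cos s) / 9 := by
  rw [psi_three hμ, norm_div, norm_mul, Complex.norm_exp_ofReal_mul_I, one_mul, div_pow,
    Complex.sq_norm, Complex.normSq_apply, Complex.exp_mul_I]
  simp [← Complex.ofReal_cos, ← Complex.ofReal_sin]
  have := Real.sin_sq_add_cos_sq s
  congr 1
  · nlinarith
  · norm_num

lemma exists_norm_psi_three_le (hμ : IsQuicksortLaw μ) {x₀ : ℝ} (hx₀ : 0 < x₀) :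
    ∃ δ : ℝ, 0 < δ ∧ δ ≤ 1 ∧ ∀ s, x₀ ≤ |s| → |s| ≤ Real.pi → ‖psi μ 3 s‖ ≤ 1 - δ := by
  rcases lt_or_ge Real.pi x₀ with h | hπ
  · exact ⟨1, one_pos, le_rfl, fun s h1 h2 => by linarith⟩
  have hcos : Real.cos x₀ < 1 := by
    rw [← Real.cos_zero]
    exact Real.cos_lt_cos_of_nonneg_of_le_pi le_rfl hπ hx₀
  have hc1 := Real.neg_one_le_cos x₀
  refine ⟨1 - √((5 + 4 * Real.cos x₀) / 9), ?_,
    by linarith [Real.sqrt_nonneg ((5 + 4 * Real.cos x₀) / 9)], fun s h1 h2 => ?_⟩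
  · rw [sub_pos, Real.sqrt_lt' one_pos]; linarith
  · rw [sub_sub_cancel]
    refine Real.le_sqrt_of_sq_le ?_
    rw [norm_psi_three_sq hμ, ← Real.cos_abs]
    have := Real.cos_le_cos_of_nonneg_of_le_pi hx₀.le h2 h1
    linarith

lemma norm_psi_le_of_three (hμ : IsQuicksortLaw μ) {δ s : ℝ} (hδ : 0 ≤ δ)
    (h3 : ‖psi μ 3 s‖ ≤ 1 - δ) (n : ℕ) (hn : 3 ≤ n) : ‖psi μ n s‖ ≤ 1 - δ / 2 := by
  have h1 : ∀ k, ‖psi μ k s‖ ≤ 1 := fun k => norm_psi_le_one hμ k s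
  have h0 : ∀ k, 0 ≤ ‖psi μ k s‖ := fun k => norm_nonneg _
  refine le_one_sub_of_window h0 h1 (mul_norm_psi_le hμ s) (k₀ := 3) ?_ n hn
  have r4 := mul_norm_psi_le hμ s 4 (by norm_num)
  have r5 := mul_norm_psi_le hμ s 5 (by norm_num)
  have r6 := mul_norm_psi_le hμ s 6 (by norm_num)
  simp only [Finset.sum_range_succ, Finset.sum_range_zero, psi_zero hμ, psi_one hμ, psi_two hμ,
    norm_one] at r4 r5 r6
  norm_num [psi_zero hμ, psi_one hμ, psi_two hμ] at r4 r5 r6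
  have h4 : ‖psi μ 4 s‖ ≤ 1 - δ / 2 := by linarith
  have h5 : ‖psi μ 5 s‖ ≤ 1 - δ / 2 := by linarith
  have h6 : ‖psi μ 6 s‖ ≤ 1 - δ / 2 := by linarith
  intro k hk1 hk2
  interval_cases k
  · linarith
  · exact h4
  · exact h5
  · exact h6

/-- Exponential decay of the characteristic functions, uniform over one period. -/
lemma exists_norm_psi_le_exp (hμ : IsQuicksortLaw μ) :
    ∃ lam : ℝ, 0 < lam ∧ ∀ (n : ℕ) (s : ℝ), |s| ≤ Real.pi →
      ‖psi μ n s‖ ≤ Real.exp 1 * Real.exp (-(lam * (n * |s|))) := by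
  obtain ⟨τ, hτ, σ, hσ, N, hN⟩ := exists_norm_psi_le_one_sub hμ
  set x₀ : ℝ := τ / (4 * (N + 1)) with hx₀
  have hx₀pos : 0 < x₀ := by positivity
  obtain ⟨δ, hδ0, hδ1, hδ⟩ := exists_norm_psi_three_le hμ hx₀pos
  set η : ℝ := min (min (σ * (τ / 4) ^ 2) (δ / 2)) 1 with hη
  have hη0 : 0 < η := by positivity
  have hη1 : η ≤ 1 := min_le_right _ _
  set C : ℝ := max τ 12 with hC
  have hC0 : 0 < C := by positivity
  have key : ∀ s : ℝ, s ≠ 0 → |s| ≤ Real.pi → ∃ k₀ : ℕ, 1 ≤ k₀ ∧ k₀ * |s| ≤ C ∧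
      ∀ k, k₀ ≤ k → ‖psi μ k s‖ ≤ 1 - η := by
    intro s hs0 hsπ
    have hs : 0 < |s| := abs_pos.2 hs0
    rcases lt_or_ge |s| x₀ with h | h
    · have hq : (N : ℝ) + 1 ≤ τ / (4 * |s|) := by
        rw [hx₀, lt_div_iff₀ (by positivity)] at h
        rw [le_div_iff₀ (by positivity)]; linarith
      have e : τ / (2 * |s|) = 2 * (τ / (4 * |s|)) := by field_simp; ring
      have hf1 : (⌊τ / (2 * |s|)⌋₊ : ℝ) ≤ τ / (2 * |s|) := Nat.floor_le (by positivity)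
      have hf2 := Nat.lt_floor_add_one (τ / (2 * |s|))
      have hN0 : (0 : ℝ) ≤ N := Nat.cast_nonneg N
      set k₀ := ⌊τ / (2 * |s|)⌋₊
      have hk1 : τ / (4 * |s|) ≤ k₀ := by linarith
      have hkN : N + 1 ≤ k₀ := by
        have : ((N + 1 : ℕ) : ℝ) ≤ k₀ := by push_cast; linarith
        exact_mod_cast this
      have hup : 2 * (k₀ * |s|) ≤ τ := by
        rw [le_div_iff₀ (by positivity)] at hf1; linarith
      have hlow : τ / 4 ≤ |s| * k₀ := by
        rw [div_le_iff₀ (by positivity)] at hk1; linarith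
      refine ⟨k₀, by omega, ?_, ?_⟩
      · have := le_max_left τ 12
        nlinarith
      · refine le_one_sub_of_window (fun _ => norm_nonneg _) (fun k => norm_psi_le_one hμ k s)
          (mul_norm_psi_le hμ s) fun k h1 h2 => ?_
        have h1' : (k₀ : ℝ) ≤ k := by exact_mod_cast h1
        have h2' : (k : ℝ) ≤ 2 * k₀ := by exact_mod_cast h2
        refine (hN k (by omega) s (by nlinarith)).trans ?_
        have h3 : τ / 4 ≤ |s| * k := hlow.trans (by gcongr)
        have h4 : η ≤ σ * (|s| * k) ^ 2 := by
          refine ((min_le_left _ _).trans (min_le_left _ _)).trans ?_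
          gcongr
        linarith
    · refine ⟨3, by norm_num, ?_, fun k hk => ?_⟩
      · have := Real.pi_lt_four
        refine le_trans ?_ (le_max_right τ 12)
        push_cast; linarith
      · refine (norm_psi_le_of_three hμ hδ0.le (hδ s h hsπ) k hk).trans ?_
        have : η ≤ δ / 2 := (min_le_left _ _).trans (min_le_right _ _)
        linarith
  refine ⟨η / 8 / C, by positivity, fun n s hs => ?_⟩
  rcases eq_or_ne s 0 with rfl | hs0
  · refine (norm_psi_le_one hμ n 0).trans ?_
    simp
  obtain ⟨k₀, hk1, hkC, hk⟩ := key s hs0 hs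
  refine (le_exp_of_le_one_sub (fun _ => norm_nonneg _) (fun k => norm_psi_le_one hμ k s)
    (mul_norm_psi_le hμ s) hη0.le hη1 hk1 hk n).trans ?_
  have hk0 : (0 : ℝ) < k₀ := by exact_mod_cast hk1
  have : η / 8 / C * (n * |s|) ≤ η / 8 * (n / k₀) := by
    rw [div_mul_eq_mul_div, div_le_iff₀ hC0]
    have : (n : ℝ) * |s| ≤ n / k₀ * C := by
      rw [div_mul_eq_mul_div, le_div_iff₀ hk0]
      have := Nat.cast_nonneg (α := ℝ) n
      nlinarith
    nlinarith
  gcongr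

end ExponentialDecay

section CharacteristicLimit

variable {μ : ℕ → Measure ℤ}

lemma integrable_exp_neg_mul_abs {c : ℝ} (hc : 0 < c) :
    Integrable fun t : ℝ => Real.exp (-(c * |t|)) := by
  rw [← integrableOn_univ, ← Set.Iic_union_Ioi (a := (0 : ℝ)), integrableOn_union]
  constructor
  · refine (integrableOn_exp_mul_Iic hc 0).congr_fun (fun t ht => ?_) measurableSet_Iic
    simp only [abs_of_nonpos (Set.mem_Iic.1 ht)]; ring_nf
  · refine (integrableOn_exp_mul_Ioi (neg_lt_zero.2 hc) 0).congr_fun (fun t ht => ?_)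
      measurableSet_Ioi
    simp only [abs_of_pos (Set.mem_Ioi.1 ht)]; ring_nf

/-- The limit of the characteristic functions of `(Q_n - q_n) / n`. -/
noncomputable def charLim (μ : ℕ → Measure ℤ) (t : ℝ) : ℂ :=
  limUnder atTop fun n : ℕ => psi μ n (t / n)

lemma tendsto_charLim (hμ : IsQuicksortLaw μ) (t : ℝ) :
    Tendsto (fun n : ℕ => psi μ n (t / n)) atTop (nhds (charLim μ t)) := by
  refine CauchySeq.tendsto_limUnder ?_
  rw [← cauchySeq_shift 1]
  refine cauchySeq_of_le_tendsto_0'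
    (fun N : ℕ => 1503 * (|t| ^ (3 / 2 : ℝ) * ((N + 1 : ℕ) : ℝ) ^ (-(1 / 4) : ℝ)))
    (fun n m hnm => ?_) ?_
  · rw [dist_eq_norm]
    exact norm_psi_sub_psi_scaled_le hμ (n + 1) (m + 1) (by omega) (by omega) t
  · have h := ((tendsto_rpow_neg_atTop (y := 1 / 4) (by norm_num)).comp
      (tendsto_natCast_atTop_atTop.comp (tendsto_add_atTop_nat 1))).const_mul
        (1503 * |t| ^ (3 / 2 : ℝ))
    simpa [Function.comp_def, mul_assoc] using h

lemma norm_psi_sub_charLim_le (hμ : IsQuicksortLaw μ) {n : ℕ} (hn : 1 ≤ n) (t : ℝ) :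
    ‖psi μ n (t / n) - charLim μ t‖ ≤ 1503 * (|t| ^ (3 / 2 : ℝ) * (n : ℝ) ^ (-(1 / 4) : ℝ)) := by
  refine le_of_tendsto ((tendsto_charLim hμ t).const_sub _).norm ?_
  filter_upwards [eventually_ge_atTop n] with m hm
  exact norm_psi_sub_psi_scaled_le hμ n m hn hm t

lemma charLim_zero (hμ : IsQuicksortLaw μ) : charLim μ 0 = 1 :=
  tendsto_nhds_unique (tendsto_charLim hμ 0) (by simp [psi_zero_right hμ])

lemma norm_charLim_le_one (hμ : IsQuicksortLaw μ) (t : ℝ) : ‖charLim μ t‖ ≤ 1 :=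
  le_of_tendsto (tendsto_charLim hμ t).norm (Eventually.of_forall fun n => norm_psi_le_one hμ n _)

lemma norm_charLim_sub_le (hμ : IsQuicksortLaw μ) (s t : ℝ) :
    ‖charLim μ s - charLim μ t‖ ≤ 7 * |s - t| := by
  refine le_of_tendsto ((tendsto_charLim hμ s).sub (tendsto_charLim hμ t)).norm ?_
  filter_upwards [eventually_gt_atTop 0] with n hn
  have hn0 : (0 : ℝ) < n := by exact_mod_cast hn
  refine (norm_psi_sub_psi_le hμ n _ _).trans_eq ?_
  rw [← sub_div, abs_div, Nat.abs_cast]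
  field_simp

lemma continuous_charLim (hμ : IsQuicksortLaw μ) : Continuous (charLim μ) := by
  refine (LipschitzWith.of_dist_le_mul (K := 7) fun s t => ?_).continuous
  rw [dist_eq_norm, Real.dist_eq]
  exact_mod_cast norm_charLim_sub_le hμ s t

lemma continuous_psi (hμ : IsQuicksortLaw μ) (n : ℕ) : Continuous (psi μ n) := by
  refine (LipschitzWith.of_dist_le_mul (K := 7 * n) fun s t => ?_).continuous
  rw [dist_eq_norm, Real.dist_eq]
  exact_mod_cast norm_psi_sub_psi_le hμ n s t

lemma norm_psi_div_le_exp {lam : ℝ}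
    (h : ∀ (n : ℕ) (s : ℝ), |s| ≤ Real.pi →
      ‖psi μ n s‖ ≤ Real.exp 1 * Real.exp (-(lam * (n * |s|))))
    {n : ℕ} (hn : 1 ≤ n) {t : ℝ} (ht : |t| ≤ Real.pi * n) :
    ‖psi μ n (t / n)‖ ≤ Real.exp 1 * Real.exp (-(lam * |t|)) := by
  have hn0 : (0 : ℝ) < n := by exact_mod_cast hn
  have e : |t / n| = |t| / n := by rw [abs_div, Nat.abs_cast]
  have := h n (t / n) (by rw [e, div_le_iff₀ hn0]; exact ht)
  rwa [e, mul_div_cancel₀ _ hn0.ne'] at this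

lemma norm_charLim_le_exp (hμ : IsQuicksortLaw μ) {lam : ℝ}
    (h : ∀ (n : ℕ) (s : ℝ), |s| ≤ Real.pi →
      ‖psi μ n s‖ ≤ Real.exp 1 * Real.exp (-(lam * (n * |s|)))) (t : ℝ) :
    ‖charLim μ t‖ ≤ Real.exp 1 * Real.exp (-(lam * |t|)) := by
  refine le_of_tendsto (tendsto_charLim hμ t).norm ?_
  have h1 : Tendsto (fun n : ℕ => Real.pi * (n : ℝ)) atTop atTop :=
    tendsto_natCast_atTop_atTop.const_mul_atTop Real.pi_pos
  filter_upwards [h1.eventually_ge_atTop |t|, eventually_ge_atTop 1] with n hn h1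
  exact norm_psi_div_le_exp h h1 hn

lemma integrable_charLim (hμ : IsQuicksortLaw μ) : Integrable (charLim μ) := by
  obtain ⟨lam, hlam, h⟩ := exists_norm_psi_le_exp hμ
  refine ((integrable_exp_neg_mul_abs hlam).const_mul (Real.exp 1)).mono'
    (continuous_charLim hμ).aestronglyMeasurable (Eventually.of_forall fun t => ?_)
  exact norm_charLim_le_exp hμ h t

/-- The characteristic function of `(Q_n - q_n) / n` cut off to one period. -/
noncomputable def charCut (μ : ℕ → Measure ℤ) (n : ℕ) : ℝ → ℂ :=
  (Set.Ioc (-(Real.pi * n)) (Real.pi * n)).indicator fun t => psi μ n (t / n)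

lemma integrable_charCut (hμ : IsQuicksortLaw μ) (n : ℕ) : Integrable (charCut μ n) := by
  refine (integrable_indicator_iff measurableSet_Ioc).2 ?_
  have : Continuous fun t : ℝ => psi μ n (t / n) := (continuous_psi hμ n).comp (by fun_prop)
  exact this.integrableOn_Ioc

lemma norm_charCut_sub_charLim_le (hμ : IsQuicksortLaw μ) {n : ℕ} (hn : 1 ≤ n) (t : ℝ) :
    ‖charCut μ n t - charLim μ t‖ ≤ 1503 * (|t| ^ (3 / 2 : ℝ) * (n : ℝ) ^ (-(1 / 4) : ℝ)) := by
  by_cases ht : t ∈ Set.Ioc (-(Real.pi * n)) (Real.pi * n)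
  · rw [charCut, Set.indicator_of_mem ht]
    exact norm_psi_sub_charLim_le hμ hn t
  · rw [charCut, Set.indicator_of_notMem ht, zero_sub, norm_neg]
    have hn1 : (1 : ℝ) ≤ n := by exact_mod_cast hn
    have ht1 : (n : ℝ) ≤ |t| := by
      by_contra! h
      obtain ⟨h1, h2⟩ := abs_lt.1 h
      have := Real.pi_gt_three
      exact ht ⟨by nlinarith, by nlinarith⟩
    refine (norm_charLim_le_one hμ t).trans ?_
    have h2 : (1 : ℝ) ≤ |t| ^ (3 / 2 : ℝ) * (n : ℝ) ^ (-(1 / 4) : ℝ) := by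
      calc (1 : ℝ) ≤ (n : ℝ) ^ (5 / 4 : ℝ) := Real.one_le_rpow hn1 (by norm_num)
        _ = (n : ℝ) ^ (3 / 2 : ℝ) * (n : ℝ) ^ (-(1 / 4) : ℝ) := by
          rw [← Real.rpow_add (by linarith)]; norm_num
        _ ≤ _ := by gcongr
    linarith

lemma norm_charCut_le_exp {lam : ℝ}
    (h : ∀ (n : ℕ) (s : ℝ), |s| ≤ Real.pi →
      ‖psi μ n s‖ ≤ Real.exp 1 * Real.exp (-(lam * (n * |s|))))
    {n : ℕ} (hn : 1 ≤ n) (t : ℝ) :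
    ‖charCut μ n t‖ ≤ Real.exp 1 * Real.exp (-(lam * |t|)) := by
  by_cases ht : t ∈ Set.Ioc (-(Real.pi * n)) (Real.pi * n)
  · rw [charCut, Set.indicator_of_mem ht]
    exact norm_psi_div_le_exp h hn (abs_le.2 ⟨ht.1.le, ht.2⟩)
  · rw [charCut, Set.indicator_of_notMem ht, norm_zero]
    positivity

lemma rpow_three_quarters_mul_exp_le {lam : ℝ} (hlam : 0 < lam) {x : ℝ} (hx : 0 ≤ x) :
    x ^ (3 / 4 : ℝ) * Real.exp (-(lam / 2 * x))
      ≤ (1 + 4 / lam) * Real.exp (-(lam / 4 * x)) := by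
  have h1 : x ^ (3 / 4 : ℝ) ≤ 1 + x := by
    rcases le_total x 1 with h | h
    · exact (Real.rpow_le_one hx h (by norm_num)).trans (by linarith)
    · refine (Real.rpow_le_rpow_of_exponent_le h (by norm_num : (3 / 4 : ℝ) ≤ 1)).trans ?_
      rw [Real.rpow_one]; linarith
  have h2 : 1 + x ≤ (1 + 4 / lam) * Real.exp (lam / 4 * x) := by
    have h3 := Real.add_one_le_exp (lam / 4 * x)
    have h4 : (1 + 4 / lam) * (lam / 4 * x + 1) ≤ (1 + 4 / lam) * Real.exp (lam / 4 * x) := by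
      gcongr
    refine le_trans ?_ h4
    have : (1 + 4 / lam) * (lam / 4 * x + 1) = 1 + x + lam / 4 * x + 4 / lam := by
      field_simp; ring
    rw [this]
    have : 0 < 4 / lam := by positivity
    nlinarith [mul_nonneg hlam.le hx]
  calc _ ≤ ((1 + 4 / lam) * Real.exp (lam / 4 * x)) * Real.exp (-(lam / 2 * x)) := by
        gcongr; exact h1.trans h2
    _ = _ := by rw [mul_assoc, ← Real.exp_add]; ring_nf

lemma exists_norm_charCut_sub_charLim_le_exp (hμ : IsQuicksortLaw μ) :
    ∃ K c : ℝ, 0 ≤ K ∧ 0 < c ∧ ∀ n : ℕ, 1 ≤ n → ∀ t : ℝ,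
      ‖charCut μ n t - charLim μ t‖ ≤ K * (n : ℝ) ^ (-(1 / 8) : ℝ) * Real.exp (-(c * |t|)) := by
  obtain ⟨lam, hlam, h⟩ := exists_norm_psi_le_exp hμ
  refine ⟨100 * (1 + 4 / lam), lam / 4, by positivity, by positivity, fun n hn t => ?_⟩
  have hn0 : (0 : ℝ) < n := by exact_mod_cast hn
  set A := ‖charCut μ n t - charLim μ t‖ with hA
  have h1 : A ≤ 1503 * (|t| ^ (3 / 2 : ℝ) * (n : ℝ) ^ (-(1 / 4) : ℝ)) :=
    norm_charCut_sub_charLim_le hμ hn t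
  have h2 : A ≤ 6 * Real.exp (-(lam * |t|)) := by
    have h3 := norm_charCut_le_exp h hn t
    have h4 := norm_charLim_le_exp hμ h t
    have h5 : A ≤ 2 * Real.exp 1 * Real.exp (-(lam * |t|)) :=
      (norm_sub_le _ _).trans (by linarith)
    refine h5.trans ?_
    gcongr
    linarith [Real.exp_one_lt_d9]
  have e : (1503 * (|t| ^ (3 / 2 : ℝ) * (n : ℝ) ^ (-(1 / 4) : ℝ)))
      * (6 * Real.exp (-(lam * |t|)))
      = 9018 *
        (|t| ^ (3 / 4 : ℝ) * (n : ℝ) ^ (-(1 / 8) : ℝ) * Real.exp (-(lam / 2 * |t|))) ^ 2 := by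
    rw [mul_pow, mul_pow, ← Real.rpow_natCast (_ ^ (3 / 4 : ℝ)),
      ← Real.rpow_natCast (_ ^ (-(1 / 8) : ℝ)), ← Real.rpow_mul (abs_nonneg t),
      ← Real.rpow_mul hn0.le, ← Real.exp_nat_mul]
    norm_num
    ring_nf
  have h3 : A ≤ 100 * (|t| ^ (3 / 4 : ℝ) * (n : ℝ) ^ (-(1 / 8) : ℝ)
      * Real.exp (-(lam / 2 * |t|))) := by
    refine abs_le_of_sq_le_sq' ?_ (by positivity) |>.2
    have h4 := mul_le_mul h1 h2 (norm_nonneg _) (by positivity)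
    rw [e, ← sq] at h4
    nlinarith [sq_nonneg (|t| ^ (3 / 4 : ℝ) * (n : ℝ) ^ (-(1 / 8) : ℝ)
      * Real.exp (-(lam / 2 * |t|)))]
  have h4 := mul_le_mul_of_nonneg_left (rpow_three_quarters_mul_exp_le hlam (abs_nonneg t))
    (by positivity : (0 : ℝ) ≤ 100 * (n : ℝ) ^ (-(1 / 8) : ℝ))
  refine h3.trans (le_trans (le_of_eq ?_) (h4.trans (le_of_eq ?_))) <;> ring

end CharacteristicLimit

section LocalLimit

variable {μ : ℕ → Measure ℤ}

lemma integral_exp_int_mul_I (m : ℤ) :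
    ∫ s in (-Real.pi)..Real.pi, Complex.exp (((s * m : ℝ) : ℂ) * Complex.I)
      = if m = 0 then ((2 * Real.pi : ℝ) : ℂ) else 0 := by
  split_ifs with hm
  · subst hm
    simp [two_mul]
  · have hc : (m : ℂ) * Complex.I ≠ 0 := by simp [hm]
    have h := integral_exp_mul_complex (a := -Real.pi) (b := Real.pi) hc
    have e : ∀ s : ℝ, ((s * m : ℝ) : ℂ) * Complex.I = (m : ℂ) * Complex.I * s := fun s => by
      push_cast; ring
    simp only [e, h]
    rw [div_eq_zero_iff]
    left
    rw [sub_eq_zero, Complex.exp_eq_exp_iff_exists_int]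
    exact ⟨m, by push_cast; ring⟩

lemma measure_singleton_eq_integral_psi (hμ : IsQuicksortLaw μ) (n : ℕ) (x : ℤ) :
    (((μ n {x}).toReal : ℝ) : ℂ) = ((2 * Real.pi)⁻¹ : ℝ) *
      ∫ s in (-Real.pi)..Real.pi,
        Complex.exp (((-s * ((x : ℝ) - qsMean n) : ℝ) : ℂ) * Complex.I) * psi μ n s := by
  have hp := hμ.1 n
  have e1 : ∀ s : ℝ,
      Complex.exp (((-s * ((x : ℝ) - qsMean n) : ℝ) : ℂ) * Complex.I) * psi μ n s
        = ∫ z : ℤ, Complex.exp (((s * ((z - x : ℤ) : ℝ) : ℝ) : ℂ) * Complex.I) ∂μ n := by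
    intro s
    rw [psi, ← integral_const_mul]
    refine integral_congr_ae (Eventually.of_forall fun z => ?_)
    simp only
    rw [← Complex.exp_add]
    congr 1
    push_cast; ring
  have e2 : ∫ s in (-Real.pi)..Real.pi, ∫ z : ℤ,
        Complex.exp (((s * ((z - x : ℤ) : ℝ) : ℝ) : ℂ) * Complex.I) ∂μ n
      = ∫ z : ℤ, (∫ s in (-Real.pi)..Real.pi,
        Complex.exp (((s * ((z - x : ℤ) : ℝ) : ℝ) : ℂ) * Complex.I)) ∂μ n := by
    refine intervalIntegral_integral_swap ?_
    have hfin : IsFiniteMeasure (volume.restrict (Set.uIoc (-Real.pi) Real.pi)) :=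
      ⟨by simp [Set.uIoc]⟩
    refine Integrable.of_bound (C := 1) ?_ (Eventually.of_forall fun p => ?_)
    · refine Measurable.aestronglyMeasurable ?_
      simp only [Function.uncurry_def]
      fun_prop
    · simp only [Function.uncurry_def, Complex.norm_exp_ofReal_mul_I, le_refl]
  simp only [e1, e2, integral_exp_int_mul_I, sub_eq_zero]
  have e3 : ∀ z : ℤ, (if z = x then ((2 * Real.pi : ℝ) : ℂ) else 0)
      = ({x} : Set ℤ).indicator (fun _ => ((2 * Real.pi : ℝ) : ℂ)) z := fun z => by
    simp [Set.indicator_apply]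
  simp only [e3]
  rw [integral_indicator (MeasurableSet.singleton x), setIntegral_const, Complex.real_smul,
    Measure.real]
  have : (Real.pi : ℂ) ≠ 0 := by simp [Real.pi_ne_zero]
  push_cast
  field_simp

lemma measure_singleton_eq_integral_charCut (hμ : IsQuicksortLaw μ) {n : ℕ} (hn : 1 ≤ n)
    (x : ℤ) :
    (((μ n {x}).toReal : ℝ) : ℂ) = ((n : ℝ)⁻¹ : ℝ) * (((2 * Real.pi)⁻¹ : ℝ) *
      ∫ t : ℝ, Complex.exp (((-t * (((x : ℝ) - qsMean n) / n) : ℝ) : ℂ) * Complex.I)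
        * charCut μ n t) := by
  have hn0 : (0 : ℝ) < n := by exact_mod_cast hn
  rw [measure_singleton_eq_integral_psi hμ]
  have e : ∫ s in (-Real.pi)..Real.pi,
        Complex.exp (((-s * ((x : ℝ) - qsMean n) : ℝ) : ℂ) * Complex.I) * psi μ n s
      = ((n : ℝ)⁻¹ : ℝ) • ∫ t in (-(Real.pi * n))..(Real.pi * n),
        Complex.exp (((-t * (((x : ℝ) - qsMean n) / n) : ℝ) : ℂ) * Complex.I)
          * psi μ n (t / n) := by
    have h := intervalIntegral.integral_comp_div (a := -(Real.pi * n)) (b := Real.pi * n)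
      (fun s => Complex.exp (((-s * ((x : ℝ) - qsMean n) : ℝ) : ℂ) * Complex.I) * psi μ n s)
      hn0.ne'
    rw [neg_div, mul_div_cancel_right₀ _ hn0.ne'] at h
    rw [← inv_smul_eq_iff₀ hn0.ne'] at h
    rw [← h]
    congr 2
    ext t
    rw [show -(t / n) * ((x : ℝ) - qsMean n) = -t * (((x : ℝ) - qsMean n) / n) by ring]
  rw [e, intervalIntegral.integral_of_le (by nlinarith [Real.pi_pos]),
    ← integral_indicator measurableSet_Ioc, Complex.real_smul]
  have e2 : ∀ t : ℝ, (Set.Ioc (-(Real.pi * n)) (Real.pi * n)).indicator (fun t : ℝ =>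
      Complex.exp (((-t * (((x : ℝ) - qsMean n) / n) : ℝ) : ℂ) * Complex.I) * psi μ n (t / n)) t
      = Complex.exp (((-t * (((x : ℝ) - qsMean n) / n) : ℝ) : ℂ) * Complex.I)
        * charCut μ n t := fun t => by
    rw [charCut, Set.indicator_mul_right]
  simp only [e2]
  ring

/-- The inverse Fourier transform of `charLim`. -/
noncomputable def limDensityC (μ : ℕ → Measure ℤ) (y : ℝ) : ℂ :=
  ((2 * Real.pi)⁻¹ : ℝ) *
    ∫ t : ℝ, Complex.exp (((-t * y : ℝ) : ℂ) * Complex.I) * charLim μ t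

lemma integrable_exp_mul {g : ℝ → ℂ} (hg : Integrable g) (y : ℝ) :
    Integrable fun t : ℝ => Complex.exp (((-t * y : ℝ) : ℂ) * Complex.I) * g t := by
  refine hg.bdd_mul (c := 1) ?_ (Eventually.of_forall fun t => ?_)
  · exact Continuous.aestronglyMeasurable (by fun_prop)
  · rw [Complex.norm_exp_ofReal_mul_I]

lemma exists_norm_measure_singleton_sub_le (hμ : IsQuicksortLaw μ) :
    ∃ C : ℝ, 0 ≤ C ∧ ∀ n : ℕ, 1 ≤ n → ∀ x : ℤ,
      ‖(((μ n {x}).toReal : ℝ) : ℂ)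
        - ((n : ℝ)⁻¹ : ℝ) * limDensityC μ (((x : ℝ) - qsMean n) / n)‖
        ≤ C * (n : ℝ) ^ (-(9 / 8) : ℝ) := by
  obtain ⟨K, c, hK, hc, h⟩ := exists_norm_charCut_sub_charLim_le_exp hμ
  refine ⟨(2 * Real.pi)⁻¹ * (K * ∫ t : ℝ, Real.exp (-(c * |t|))), ?_, fun n hn x => ?_⟩
  · have : 0 ≤ ∫ t : ℝ, Real.exp (-(c * |t|)) := integral_nonneg fun t => (Real.exp_pos _).le
    have := Real.pi_pos
    positivity
  have hn0 : (0 : ℝ) < n := by exact_mod_cast hn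
  rw [measure_singleton_eq_integral_charCut hμ hn, limDensityC, ← mul_sub, ← mul_sub,
    ← integral_sub (integrable_exp_mul (integrable_charCut hμ n) _)
      (integrable_exp_mul (integrable_charLim hμ) _)]
  simp only [← mul_sub]
  rw [norm_mul, norm_mul, Complex.norm_real, Complex.norm_real, Real.norm_eq_abs,
    Real.norm_eq_abs, abs_of_pos (inv_pos.2 hn0), abs_of_pos (by have := Real.pi_pos; positivity)]
  have h1 : ‖∫ t : ℝ, Complex.exp (((-t * (((x : ℝ) - qsMean n) / n) : ℝ) : ℂ) * Complex.I)
      * (charCut μ n t - charLim μ t)‖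
      ≤ ∫ t : ℝ, K * (n : ℝ) ^ (-(1 / 8) : ℝ) * Real.exp (-(c * |t|)) := by
    refine norm_integral_le_of_norm_le ((integrable_exp_neg_mul_abs hc).const_mul _)
      (Eventually.of_forall fun t => ?_)
    rw [norm_mul, Complex.norm_exp_ofReal_mul_I, one_mul]
    exact h n hn t
  rw [integral_const_mul] at h1
  have e : (n : ℝ) ^ (-(9 / 8) : ℝ) = (n : ℝ)⁻¹ * (n : ℝ) ^ (-(1 / 8) : ℝ) := by
    rw [← Real.rpow_neg_one, ← Real.rpow_add hn0]; norm_num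
  rw [e]
  calc _ ≤ (n : ℝ)⁻¹ * ((2 * Real.pi)⁻¹ *
        (K * (n : ℝ) ^ (-(1 / 8) : ℝ) * ∫ t : ℝ, Real.exp (-(c * |t|)))) := by
        have := Real.pi_pos
        gcongr
    _ = _ := by ring

lemma rpow_le_rpow_mul_log {n : ℕ} (hn : 2 ≤ n) :
    (n : ℝ) ^ (-(9 / 8) : ℝ) ≤ 2 * (n : ℝ) ^ (-19 / 18 : ℝ) * Real.log n := by
  have hn2 : (2 : ℝ) ≤ n := by exact_mod_cast hn
  have h1 : (n : ℝ) ^ (-(9 / 8) : ℝ) ≤ (n : ℝ) ^ (-19 / 18 : ℝ) :=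
    Real.rpow_le_rpow_of_exponent_le (by linarith) (by norm_num)
  have h2 : 1 / 2 ≤ Real.log n := by
    have := Real.log_le_log (by norm_num) hn2
    linarith [Real.log_two_gt_d9]
  have h3 : (0 : ℝ) ≤ (n : ℝ) ^ (-19 / 18 : ℝ) := by positivity
  nlinarith

lemma continuous_limDensityC (hμ : IsQuicksortLaw μ) : Continuous (limDensityC μ) := by
  refine continuous_const.mul (continuous_of_dominated (bound := fun t => ‖charLim μ t‖)
    (fun y => (integrable_exp_mul (integrable_charLim hμ) y).aestronglyMeasurable)
    (fun y => Eventually.of_forall fun t => ?_) (integrable_charLim hμ).norm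
    (Eventually.of_forall fun t => by fun_prop))
  rw [norm_mul, Complex.norm_exp_ofReal_mul_I, one_mul]

/-- The point probability of `Q_n` rescaled at the lattice point next to `n * y + q_n`. -/
noncomputable def scaledMass (μ : ℕ → Measure ℤ) (n : ℕ) (y : ℝ) : ℝ :=
  n * (μ n {⌊n * y + qsMean n⌋}).toReal

lemma tendsto_scaledMass_complex (hμ : IsQuicksortLaw μ) (y : ℝ) :
    Tendsto (fun n => (scaledMass μ n y : ℂ)) atTop (nhds (limDensityC μ y)) := by
  obtain ⟨C, hC0, hC⟩ := exists_norm_measure_singleton_sub_le hμ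
  have h1 : Tendsto (fun n : ℕ => ((⌊n * y + qsMean n⌋ : ℝ) - qsMean n) / n) atTop (nhds y) := by
    have hlo : Tendsto (fun n : ℕ => y - 1 / (n : ℝ)) atTop (nhds y) := by
      simpa using tendsto_const_nhds.sub (tendsto_one_div_atTop_nhds_zero_nat (𝕜 := ℝ))
    refine tendsto_of_tendsto_of_tendsto_of_le_of_le' hlo tendsto_const_nhds ?_ ?_
    · filter_upwards [eventually_gt_atTop 0] with n hn
      have hn0 : (0 : ℝ) < n := by exact_mod_cast hn
      rw [le_div_iff₀ hn0, sub_mul, div_mul_cancel₀ _ hn0.ne']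
      linarith [Int.lt_floor_add_one (n * y + qsMean n)]
    · filter_upwards [eventually_gt_atTop 0] with n hn
      have hn0 : (0 : ℝ) < n := by exact_mod_cast hn
      rw [div_le_iff₀ hn0]
      linarith [Int.floor_le (n * y + qsMean n)]
  have h2 := ((continuous_limDensityC hμ).tendsto y).comp h1
  have h3 : Tendsto (fun n : ℕ => C * (n : ℝ) ^ (-(1 / 8) : ℝ)) atTop (nhds 0) := by
    simpa using ((tendsto_rpow_neg_atTop (y := 1 / 8) (by norm_num)).comp
      tendsto_natCast_atTop_atTop).const_mul C
  refine tendsto_of_tendsto_of_dist h2 (squeeze_zero' (Eventually.of_forall fun _ => dist_nonneg)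
    ?_ h3)
  filter_upwards [eventually_ge_atTop 1] with n hn
  have hn0 : (0 : ℝ) < n := by exact_mod_cast hn
  have h4 := hC n hn ⌊n * y + qsMean n⌋
  rw [dist_comm, dist_eq_norm, scaledMass]
  have e : (((n : ℝ) * (μ n {⌊n * y + qsMean n⌋}).toReal : ℝ) : ℂ)
      - limDensityC μ (((⌊n * y + qsMean n⌋ : ℝ) - qsMean n) / n)
      = (n : ℝ) * ((((μ n {⌊n * y + qsMean n⌋}).toReal : ℝ) : ℂ) - ((n : ℝ)⁻¹ : ℝ)
        * limDensityC μ (((⌊n * y + qsMean n⌋ : ℝ) - qsMean n) / n)) := by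
    have : (n : ℂ) ≠ 0 := by exact_mod_cast hn0.ne'
    push_cast
    field_simp
  simp only [Function.comp_apply]
  rw [e, norm_mul, Complex.norm_real, Real.norm_eq_abs, abs_of_pos hn0]
  refine (mul_le_mul_of_nonneg_left h4 hn0.le).trans_eq ?_
  rw [mul_left_comm]
  congr 1
  nth_rewrite 1 [← Real.rpow_one (n : ℝ)]
  rw [← Real.rpow_add hn0]
  norm_num

/-- The limiting density. -/
noncomputable def limDensity (μ : ℕ → Measure ℤ) (y : ℝ) : ℝ := (limDensityC μ y).re

lemma tendsto_scaledMass (hμ : IsQuicksortLaw μ) (y : ℝ) :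
    Tendsto (fun n => scaledMass μ n y) atTop (nhds (limDensity μ y)) :=
  (Complex.continuous_re.tendsto _).comp (tendsto_scaledMass_complex hμ y)

lemma ofReal_limDensity (hμ : IsQuicksortLaw μ) (y : ℝ) :
    (limDensity μ y : ℂ) = limDensityC μ y :=
  tendsto_nhds_unique ((Complex.continuous_ofReal.tendsto _).comp (tendsto_scaledMass hμ y))
    (tendsto_scaledMass_complex hμ y)

lemma limDensity_nonneg (hμ : IsQuicksortLaw μ) (y : ℝ) : 0 ≤ limDensity μ y :=
  ge_of_tendsto' (tendsto_scaledMass hμ y) fun n => by unfold scaledMass; positivity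

lemma continuous_limDensity (hμ : IsQuicksortLaw μ) : Continuous (limDensity μ) :=
  Complex.continuous_re.comp (continuous_limDensityC hμ)

lemma exists_abs_measure_singleton_sub_le (hμ : IsQuicksortLaw μ) :
    ∃ C : ℝ, 0 ≤ C ∧ ∀ n : ℕ, 1 ≤ n → ∀ x : ℤ,
      |(μ n {x}).toReal - (n : ℝ)⁻¹ * limDensity μ (((x : ℝ) - qsMean n) / n)|
        ≤ C * (n : ℝ) ^ (-(9 / 8) : ℝ) := by
  obtain ⟨C, hC0, hC⟩ := exists_norm_measure_singleton_sub_le hμ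
  refine ⟨C, hC0, fun n hn x => (le_of_eq ?_).trans (hC n hn x)⟩
  rw [← ofReal_limDensity hμ, ← Complex.ofReal_mul, ← Complex.ofReal_sub, Complex.norm_real,
    Real.norm_eq_abs]

end LocalLimit

section WeakLimit

variable {μ : ℕ → Measure ℤ}

lemma lintegral_scaledMass (hμ : IsQuicksortLaw μ) {n : ℕ} (hn : 1 ≤ n) :
    ∫⁻ y : ℝ, ENNReal.ofReal (scaledMass μ n y) = 1 := by
  have hp := hμ.1 n
  have hn0 : (0 : ℝ) < n := by exact_mod_cast hn
  have hm : Measurable fun y : ℝ => ⌊n * y + qsMean n⌋ := by fun_prop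
  have h1 : ∀ k : ℤ, (volume : Measure ℝ).map (fun y : ℝ => ⌊n * y + qsMean n⌋) {k}
      = ENNReal.ofReal (n : ℝ)⁻¹ := by
    intro k
    rw [Measure.map_apply hm (measurableSet_singleton k)]
    have : (fun y : ℝ => ⌊n * y + qsMean n⌋) ⁻¹' {k}
        = Set.Ico (((k : ℝ) - qsMean n) / n) (((k : ℝ) + 1 - qsMean n) / n) := by
      ext y
      simp only [Set.mem_preimage, Set.mem_singleton_iff, Int.floor_eq_iff, Set.mem_Ico,
        div_le_iff₀ hn0, lt_div_iff₀ hn0]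
      constructor <;> rintro ⟨h1, h2⟩ <;> constructor <;> linarith
    rw [this, Real.volume_Ico]
    congr 1
    field_simp
    ring
  have h2 := lintegral_map (μ := (volume : Measure ℝ))
    (f := fun k : ℤ => ENNReal.ofReal (n * (μ n {k}).toReal)) (measurable_of_countable _) hm
  simp only [scaledMass]
  rw [← h2, lintegral_countable']
  simp only [h1]
  have h3 : ∀ k : ℤ, ENNReal.ofReal (n * (μ n {k}).toReal) * ENNReal.ofReal (n : ℝ)⁻¹
      = μ n {k} := fun k => by
    rw [← ENNReal.ofReal_mul (by positivity), mul_right_comm, mul_inv_cancel₀ hn0.ne', one_mul,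
      ENNReal.ofReal_toReal (measure_ne_top _ _)]
  simp only [h3]
  have h4 := lintegral_countable' (μ := μ n) (fun _ => 1)
  simp only [one_mul, lintegral_one, measure_univ] at h4
  exact h4.symm

lemma measurable_scaledMass (n : ℕ) : Measurable (scaledMass μ n) := by
  refine measurable_const.mul
    ((measurable_of_countable (fun k : ℤ => (μ n {k}).toReal)).comp ?_)
  fun_prop

lemma lintegral_limDensity_le (hμ : IsQuicksortLaw μ) :
    ∫⁻ y : ℝ, ENNReal.ofReal (limDensity μ y) ≤ 1 := by
  have h1 : ∀ y, ENNReal.ofReal (limDensity μ y)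
      = liminf (fun n => ENNReal.ofReal (scaledMass μ n y)) atTop := fun y =>
    (((ENNReal.continuous_ofReal.tendsto _).comp (tendsto_scaledMass hμ y)).liminf_eq).symm
  simp only [h1]
  refine (lintegral_liminf_le fun n => (measurable_scaledMass n).ennreal_ofReal).trans ?_
  refine liminf_le_of_le (by isBoundedDefault) fun b hb => ?_
  obtain ⟨n, hn, h⟩ := (hb.and (eventually_ge_atTop 1)).exists
  exact hn.trans_eq (lintegral_scaledMass hμ h)

lemma integrable_limDensity (hμ : IsQuicksortLaw μ) : Integrable (limDensity μ) := by
  refine ⟨(continuous_limDensity hμ).aestronglyMeasurable, ?_⟩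
  rw [hasFiniteIntegral_iff_ofReal (Eventually.of_forall (limDensity_nonneg hμ))]
  exact (lintegral_limDensity_le hμ).trans_lt ENNReal.one_lt_top

lemma fourier_charLim :
    FourierTransform.fourier (fun s : ℝ => charLim μ (2 * Real.pi * s)) = limDensityC μ := by
  ext w
  rw [Real.fourier_real_eq_integral_exp_smul, limDensityC]
  have h := Measure.integral_comp_mul_left
    (fun t : ℝ => Complex.exp (((-t * w : ℝ) : ℂ) * Complex.I) * charLim μ t) (2 * Real.pi)
  have hpi : (0 : ℝ) < 2 * Real.pi := by positivity
  rw [abs_of_pos (inv_pos.2 hpi), Complex.real_smul] at h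
  rw [← h]
  refine integral_congr_ae (Eventually.of_forall fun s => ?_)
  simp only [smul_eq_mul]
  congr 3
  push_cast; ring

lemma integral_exp_mul_limDensity (hμ : IsQuicksortLaw μ) (t : ℝ) :
    ∫ y : ℝ, (limDensity μ y : ℂ) * Complex.exp (t * y * Complex.I) = charLim μ t := by
  have hpi : 2 * Real.pi ≠ 0 := by positivity
  have hc : Continuous fun s : ℝ => charLim μ (2 * Real.pi * s) :=
    (continuous_charLim hμ).comp (by fun_prop)
  have hi : Integrable fun s : ℝ => charLim μ (2 * Real.pi * s) :=
    (integrable_charLim hμ).comp_mul_left' hpi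
  have hC : limDensityC μ = fun y => (limDensity μ y : ℂ) :=
    funext fun y => (ofReal_limDensity hμ y).symm
  have hf : Integrable (limDensityC μ) := by
    rw [hC]; exact (integrable_limDensity hμ).ofReal
  have h := congrFun (hc.fourierInv_fourier_eq hi (by rw [fourier_charLim]; exact hf))
    (t / (2 * Real.pi))
  rw [fourier_charLim, Real.fourierInv_eq', mul_div_cancel₀ _ hpi] at h
  rw [← h, hC]
  refine integral_congr_ae (Eventually.of_forall fun y => ?_)
  simp only [smul_eq_mul]
  rw [mul_comm]
  congr 2
  have : (Real.pi : ℂ) ≠ 0 := by simp [Real.pi_ne_zero]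
  simp
  field_simp

lemma integral_limDensity (hμ : IsQuicksortLaw μ) : ∫ y : ℝ, limDensity μ y = 1 := by
  have h := integral_exp_mul_limDensity hμ 0
  simp only [Complex.ofReal_zero, zero_mul, Complex.exp_zero, mul_one, charLim_zero hμ] at h
  rw [integral_complex_ofReal] at h
  exact_mod_cast h

/-- The law with density `limDensity`. -/
noncomputable def limLaw (μ : ℕ → Measure ℤ) : Measure ℝ :=
  (volume : Measure ℝ).withDensity fun x => ENNReal.ofReal (limDensity μ x)

lemma isProbabilityMeasure_limLaw (hμ : IsQuicksortLaw μ) : IsProbabilityMeasure (limLaw μ) := by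
  constructor
  rw [limLaw, withDensity_apply _ MeasurableSet.univ, Measure.restrict_univ,
    ← ofReal_integral_eq_lintegral_ofReal (integrable_limDensity hμ)
      (Eventually.of_forall (limDensity_nonneg hμ)), integral_limDensity hμ, ENNReal.ofReal_one]

lemma charFun_limLaw (hμ : IsQuicksortLaw μ) (t : ℝ) : charFun (limLaw μ) t = charLim μ t := by
  rw [charFun_apply_real, limLaw, integral_withDensity_eq_integral_toReal_smul
    (continuous_limDensity hμ).measurable.ennreal_ofReal (by simp)]
  rw [← integral_exp_mul_limDensity hμ]
  refine integral_congr_ae (Eventually.of_forall fun y => ?_)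
  simp only [ENNReal.toReal_ofReal (limDensity_nonneg hμ y), Complex.real_smul]

lemma charFun_map_eq_psi (hμ : IsQuicksortLaw μ) (n : ℕ) (t : ℝ) :
    charFun ((μ n).map fun k : ℤ => ((k : ℝ) - meanZ (μ n)) / n) t = psi μ n (t / n) := by
  rw [charFun_apply_real, integral_map (measurable_of_countable _).aemeasurable
    (by fun_prop), psi, meanZ_eq hμ]
  refine integral_congr_ae (Eventually.of_forall fun z => ?_)
  simp only
  congr 2
  push_cast; ring

lemma isProbabilityMeasure_map (hμ : IsQuicksortLaw μ) (n : ℕ) :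
    IsProbabilityMeasure ((μ n).map fun k : ℤ => ((k : ℝ) - meanZ (μ n)) / n) :=
  have := hμ.1 n
  Measure.isProbabilityMeasure_map (measurable_of_countable _).aemeasurable

lemma tendsto_probabilityMeasure (hμ : IsQuicksortLaw μ) :
    Tendsto (β := ProbabilityMeasure ℝ) (fun n : ℕ => ⟨_, isProbabilityMeasure_map hμ n⟩) atTop
      (nhds (X := ProbabilityMeasure ℝ) ⟨limLaw μ, isProbabilityMeasure_limLaw hμ⟩) := by
  refine ProbabilityMeasure.tendsto_of_tendsto_charFun fun t => ?_
  simp only [ProbabilityMeasure.coe_mk, charFun_limLaw hμ, charFun_map_eq_psi hμ]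
  exact tendsto_charLim hμ t

end WeakLimit

section Positivity

variable {μ : ℕ → Measure ℤ}

lemma exists_le_measureReal_window (hμ : IsQuicksortLaw μ) {z η : ℝ}
    (hz : 0 < limDensity μ z) (hη : 0 < η) :
    ∃ p : ℝ, 0 < p ∧ ∀ᶠ k : ℕ in atTop,
      p ≤ (μ k).real {a : ℤ | |((a : ℝ) - qsMean k) / k - z| < η} := by
  have hpos : 0 < limLaw μ (Metric.ball z η) := by
    rw [pos_iff_ne_zero, limLaw, withDensity_apply _ measurableSet_ball, Ne, lintegral_eq_zero_iff
      (continuous_limDensity hμ).measurable.ennreal_ofReal]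
    intro h
    have h1 : ∀ᶠ y in nhds z, 0 < limDensity μ y ∧ y ∈ Metric.ball z η :=
      ((continuous_limDensity hμ).continuousAt.eventually (lt_mem_nhds hz)).and
        (Metric.ball_mem_nhds z hη)
    have h2 : 0 < volume {y | 0 < limDensity μ y ∧ y ∈ Metric.ball z η} :=
      Measure.measure_pos_of_mem_nhds volume h1
    rw [Filter.EventuallyEq, ae_restrict_iff' measurableSet_ball, ae_iff] at h
    refine h2.ne' (measure_mono_null (fun y hy => ?_) h)
    simp only [Set.mem_ofPred_eq, Pi.zero_apply, ENNReal.ofReal_eq_zero, not_forall, not_le]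
    exact ⟨hy.2, hy.1⟩
  obtain ⟨p, hp0, hp⟩ := exists_between hpos
  have h := hp.trans_le (ProbabilityMeasure.le_liminf_measure_open_of_tendsto
    (tendsto_probabilityMeasure hμ) Metric.isOpen_ball)
  refine ⟨p.toReal, ENNReal.toReal_pos hp0.ne' (hp.trans_le le_top).ne, ?_⟩
  filter_upwards [eventually_lt_of_lt_liminf h (by isBoundedDefault)] with k hk
  have := hμ.1 k
  refine ENNReal.toReal_mono (measure_ne_top _ _) (hk.le.trans_eq ?_)
  simp only [ProbabilityMeasure.coe_mk]
  rw [Measure.map_apply (measurable_of_countable _) measurableSet_ball, meanZ_eq hμ]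
  congr 1

lemma exists_le_measure_singleton (hμ : IsQuicksortLaw μ) {z : ℝ} (hz : 0 < limDensity μ z) :
    ∃ c δ : ℝ, 0 < c ∧ 0 < δ ∧ ∀ᶠ m : ℕ in atTop, ∀ b : ℤ,
      |((b : ℝ) - qsMean m) / m - z| ≤ δ → c / m ≤ (μ m {b}).toReal := by
  obtain ⟨C, hC0, hC⟩ := exists_abs_measure_singleton_sub_le hμ
  obtain ⟨δ, hδ, h⟩ := Metric.eventually_nhds_iff.1
    ((continuous_limDensity hμ).continuousAt.eventually (lt_mem_nhds (half_lt_self hz)))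
  refine ⟨limDensity μ z / 4, δ / 2, by positivity, by positivity, ?_⟩
  have h3 : Tendsto (fun n : ℕ => C * (n : ℝ) ^ (-(1 / 8) : ℝ)) atTop (nhds 0) := by
    simpa using ((tendsto_rpow_neg_atTop (y := 1 / 8) (by norm_num)).comp
      tendsto_natCast_atTop_atTop).const_mul C
  filter_upwards [h3.eventually (gt_mem_nhds (by positivity : 0 < limDensity μ z / 4)),
    eventually_ge_atTop 1] with m hm hm1 b hb
  have hm0 : (0 : ℝ) < m := by exact_mod_cast hm1
  have h4 : limDensity μ z / 2 < limDensity μ (((b : ℝ) - qsMean m) / m) := by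
    refine h ?_
    rw [Real.dist_eq]; linarith
  have h5 := (abs_le.1 (hC m hm1 b)).1
  have e : (m : ℝ) ^ (-(9 / 8) : ℝ) = (m : ℝ) ^ (-(1 / 8) : ℝ) * (m : ℝ)⁻¹ := by
    rw [← Real.rpow_neg_one, ← Real.rpow_add hm0]; norm_num
  rw [e, ← mul_assoc] at h5
  have hi : 0 < (m : ℝ)⁻¹ := inv_pos.2 hm0
  rw [div_eq_mul_inv]
  nlinarith

lemma le_measure_singleton_of_window (hμ : IsQuicksortLaw μ) {n : ℕ} (hn : 1 ≤ n) (x : ℤ)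
    {K : Finset ℕ} (hK : K ⊆ Finset.range n) {A : ℕ → Set ℤ} {p q : ℝ}
    (hq : 0 ≤ q) (h1 : ∀ k ∈ K, p ≤ (μ k).real (A k))
    (h2 : ∀ k ∈ K, ∀ a ∈ A k, q ≤ (μ (n - 1 - k) {x - (n - 1) - a}).toReal) :
    (n : ℝ)⁻¹ * (K.card * (p * q)) ≤ (μ n {x}).toReal := by
  have hprob := hμ.1
  have e1 : (μ n {x}).toReal = ∫ z, ({x} : Set ℤ).indicator (fun _ => (1 : ℝ)) z ∂μ n := by
    rw [integral_indicator (MeasurableSet.singleton x), setIntegral_const, smul_eq_mul, mul_one,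
      Measure.real]
  have e2 : ∀ k (a : ℤ),
      ∫ y, ({x} : Set ℤ).indicator (fun _ => (1 : ℝ)) (a + y + ((n : ℤ) - 1)) ∂μ (n - 1 - k)
        = (μ (n - 1 - k) {x - (n - 1) - a}).toReal := by
    intro k a
    have : ∀ y : ℤ, ({x} : Set ℤ).indicator (fun _ => (1 : ℝ)) (a + y + ((n : ℤ) - 1))
        = ({x - (n - 1) - a} : Set ℤ).indicator (fun _ => (1 : ℝ)) y := fun y => by
      simp only [Set.indicator_apply, Set.mem_singleton_iff]
      congr 1
      exact propext ⟨fun h => by omega, fun h => by omega⟩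
    simp only [this]
    rw [integral_indicator (MeasurableSet.singleton _), setIntegral_const, smul_eq_mul, mul_one,
      Measure.real]
  rw [e1, hμ.integral_eq hn, smul_eq_mul]
  simp only [e2]
  have hn0 : (0 : ℝ) ≤ (n : ℝ)⁻¹ := by positivity
  refine mul_le_mul_of_nonneg_left ?_ hn0
  rw [← nsmul_eq_mul]
  refine (Finset.card_nsmul_le_sum K _ _ fun k hk => ?_).trans
    (Finset.sum_le_sum_of_subset_of_nonneg hK fun k _ _ =>
      integral_nonneg fun a => ENNReal.toReal_nonneg)
  calc p * q ≤ (μ k).real (A k) * q := mul_le_mul_of_nonneg_right (h1 k hk) hq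
    _ = ∫ a, (A k).indicator (fun _ => q) a ∂μ k := by
      rw [integral_indicator (DiscreteMeasurableSpace.forall_measurableSet _), setIntegral_const,
        smul_eq_mul]
    _ ≤ _ := by
      refine integral_mono (hμ.integrable _ _) (hμ.integrable _ _) fun a => ?_
      refine Set.indicator_le' (fun a ha => h2 k hk a ha) (fun a _ => ENNReal.toReal_nonneg) a

lemma abs_complement_sub_le {n k : ℕ} (hkn : k < n) {z g η : ℝ} {x a : ℤ}
    (hx : |(x : ℝ) - (n * (z + g) + qsMean n)| ≤ 1)
    (ha : |((a : ℝ) - qsMean k) / k - z| < η) (hk : 1 ≤ k)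
    (ht : |toll n k / n - g| ≤ 2 * η) (hn : (1 + |z|) ≤ η * n) :
    |((x - (n - 1) - a : ℤ) : ℝ) - qsMean (n - 1 - k) - ((n - 1 - k : ℕ) : ℝ) * z|
      ≤ 4 * (η * n) := by
  have hn0 : (0 : ℝ) < n := by exact_mod_cast (show 0 < n by omega)
  have hk0 : (0 : ℝ) < k := by exact_mod_cast hk
  have hkn' : (k : ℝ) ≤ n - 1 := by
    have : ((k + 1 : ℕ) : ℝ) ≤ n := by exact_mod_cast hkn
    push_cast at this; linarith
  have hη : 0 < η := (abs_nonneg _).trans_lt ha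
  have hcast : ((n - 1 - k : ℕ) : ℝ) = n - 1 - k := by
    rw [Nat.cast_sub (by omega), Nat.cast_sub (by omega)]; simp
  have e1 : |toll n k / n - g| * n = |toll n k - g * n| := by
    rw [← Nat.abs_cast n, ← abs_mul, Nat.abs_cast, sub_mul, div_mul_cancel₀ _ hn0.ne']
  have e2 : |((a : ℝ) - qsMean k) / k - z| * k = |(a : ℝ) - qsMean k - z * k| := by
    rw [← Nat.abs_cast k, ← abs_mul, Nat.abs_cast, sub_mul, div_mul_cancel₀ _ hk0.ne']
  have h1 : |toll n k - g * n| ≤ 2 * η * n := by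
    rw [← e1]; exact mul_le_mul_of_nonneg_right ht hn0.le
  have h2 : |(a : ℝ) - qsMean k - z * k| ≤ η * k := by
    rw [← e2]; exact mul_le_mul_of_nonneg_right ha.le hk0.le
  have h3 : η * k ≤ η * n := by gcongr
  have hz := abs_le.1 (le_refl |z|)
  rw [hcast, abs_le]
  rw [abs_le] at h1 h2 hx
  simp only [toll] at h1
  push_cast
  constructor <;> nlinarith

lemma limDensity_add_limToll_pos (hμ : IsQuicksortLaw μ) {z v : ℝ}
    (hz : 0 < limDensity μ z) (hv0 : 0 < v) (hv1 : v < 1) :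
    0 < limDensity μ (z + limToll v) := by
  obtain ⟨c, δ, hc, hδ, hcδ⟩ := exists_le_measure_singleton hμ hz
  set η := δ * (1 - v) / 16 with hη
  have hη0 : 0 < η := by have := sub_pos.2 hv1; positivity
  obtain ⟨p, hp, hpk⟩ := exists_le_measureReal_window hμ hz hη0
  obtain ⟨ε₀, hε₀, hcont⟩ := Metric.continuousAt_iff.1
    (continuous_limToll.continuousAt (x := v)) η hη0
  set ε := min (ε₀ / 2) ((1 - v) / 4) with hε
  have hε0 : 0 < ε := lt_min (by positivity) (by linarith)
  have hε1 : ε ≤ (1 - v) / 4 := min_le_right _ _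
  have hε2 : ε < ε₀ := (min_le_left _ _).trans_lt (by linarith)
  obtain ⟨M₁, hM₁⟩ := eventually_atTop.1 hcδ
  obtain ⟨M₂, hM₂⟩ := eventually_atTop.1 hpk
  have hbound : ∀ᶠ n : ℕ in atTop, ε * p * c / 2 ≤ scaledMass μ n (z + limToll v) := by
    have hlarge : ∀ {d : ℝ}, 0 < d → ∀ D : ℝ, ∀ᶠ n : ℕ in atTop, D ≤ d * n := fun hd D =>
      (tendsto_natCast_atTop_atTop.const_mul_atTop hd).eventually_ge_atTop D
    filter_upwards [hlarge hv0 (M₂ + 1), hlarge (show 0 < (1 - v) / 4 by linarith) (M₁ + 1),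
      hlarge hε0 2, hlarge hη0 (1 + |z|), hlarge (show 0 < η ^ 2 by positivity) 225,
      eventually_ge_atTop 1] with n hnv hnv1 hnε hnη hnη2 hn1
    have hn0 : (0 : ℝ) < n := by exact_mod_cast hn1
    have hM₁0 := Nat.cast_nonneg (α := ℝ) M₁
    have hM₂0 := Nat.cast_nonneg (α := ℝ) M₂
    have hsqrt : 15 / √(n : ℝ) ≤ η := by
      rw [div_le_iff₀ (Real.sqrt_pos.2 hn0)]
      refine abs_le_of_sq_le_sq' ?_ (by positivity) |>.2
      rw [mul_pow, Real.sq_sqrt hn0.le]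
      linarith
    set K := Finset.Icc ⌈n * v⌉₊ ⌊n * (v + ε)⌋₊ with hK
    have hmem : ∀ k ∈ K, v * n ≤ k ∧ (k : ℝ) ≤ (v + ε) * n := by
      intro k hk
      rw [hK, Finset.mem_Icc, Nat.ceil_le, Nat.le_floor_iff (by positivity)] at hk
      constructor <;> linarith [hk.1, hk.2]
    have hlt : ∀ k ∈ K, k < n := by
      intro k hk
      have h := (hmem k hk).2
      have : (k : ℝ) < n := by nlinarith
      exact_mod_cast this
    set x := ⌊n * (z + limToll v) + qsMean n⌋ with hx
    have hx1 : |(x : ℝ) - (n * (z + limToll v) + qsMean n)| ≤ 1 := by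
      rw [abs_le]
      constructor
      · linarith [Int.lt_floor_add_one (n * (z + limToll v) + qsMean n)]
      · linarith [Int.floor_le (n * (z + limToll v) + qsMean n)]
    have hcard : ε * n / 2 ≤ K.card := by
      rw [hK, Nat.card_Icc]
      have h1 := Nat.lt_floor_add_one (n * (v + ε))
      have h2 := Nat.ceil_lt_add_one (show 0 ≤ n * v by positivity)
      have h3 : ((⌊n * (v + ε)⌋₊ + 1 : ℕ) : ℝ)
          ≤ ((⌊n * (v + ε)⌋₊ + 1 - ⌈n * v⌉₊ : ℕ) : ℝ) + (⌈n * v⌉₊ : ℝ) := by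
        exact_mod_cast (by omega :
          ⌊n * (v + ε)⌋₊ + 1 ≤ (⌊n * (v + ε)⌋₊ + 1 - ⌈n * v⌉₊) + ⌈n * v⌉₊)
      push_cast at h3
      nlinarith
    have hmain := le_measure_singleton_of_window hμ hn1 x (K := K) (p := p) (q := c / n)
      (A := fun k => {a : ℤ | |((a : ℝ) - qsMean k) / k - z| < η})
      (fun k hk => Finset.mem_range.2 (hlt k hk)) (by positivity) ?_ ?_
    · rw [scaledMass, ← hx]
      calc ε * p * c / 2 = n * ((n : ℝ)⁻¹ * (ε * n / 2 * (p * (c / n)))) := by field_simp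
        _ ≤ n * ((n : ℝ)⁻¹ * (K.card * (p * (c / n)))) := by gcongr
        _ ≤ _ := by gcongr
    · intro k hk
      refine hM₂ k ?_
      have : ((M₂ : ℕ) : ℝ) ≤ k := by linarith [(hmem k hk).1]
      exact_mod_cast this
    · intro k hk a ha
      obtain ⟨hk1, hk2⟩ := hmem k hk
      have hkn := hlt k hk
      have hcast : ((n - 1 - k : ℕ) : ℝ) = n - 1 - k := by
        rw [Nat.cast_sub (by omega), Nat.cast_sub (by omega)]; simp
      have hm2 : (1 - v) / 2 * n ≤ ((n - 1 - k : ℕ) : ℝ) := by rw [hcast]; nlinarith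
      have hm0 : (0 : ℝ) < ((n - 1 - k : ℕ) : ℝ) := lt_of_lt_of_le (by nlinarith) hm2
      have hmn : ((n - 1 - k : ℕ) : ℝ) ≤ n := by
        exact_mod_cast (by omega : n - 1 - k ≤ n)
      have hkpos : 1 ≤ k := by
        have : (0 : ℝ) < k := by nlinarith
        exact_mod_cast this
      have hw0 : v ≤ (k : ℝ) / n := by rwa [le_div_iff₀ hn0]
      have hw1 : (k : ℝ) / n ≤ v + ε := by rwa [div_le_iff₀ hn0]
      have ht1 := abs_toll_div_sub_limToll hn1 (v := (k : ℝ) / n) (by linarith) (by linarith)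
      rw [mul_div_cancel₀ _ hn0.ne', Nat.floor_natCast] at ht1
      have ht2 : |limToll ((k : ℝ) / n) - limToll v| ≤ η := by
        refine (hcont ?_).le
        rw [Real.dist_eq, abs_of_nonneg (by linarith)]
        linarith
      have ht : |toll n k / n - limToll v| ≤ 2 * η := by
        refine (abs_sub_le _ (limToll ((k : ℝ) / n)) _).trans ?_
        linarith
      have hb := abs_complement_sub_le hkn hx1 ha hkpos ht hnη
      refine (div_le_div_of_nonneg_left hc.le hm0 hmn).trans (hM₁ _ ?_ _ ?_)
      · have : ((M₁ : ℕ) : ℝ) ≤ ((n - 1 - k : ℕ) : ℝ) := by linarith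
        exact_mod_cast this
      · have e : (((x - (n - 1) - a : ℤ) : ℝ) - qsMean (n - 1 - k)) / ((n - 1 - k : ℕ) : ℝ) - z
            = (((x - (n - 1) - a : ℤ) : ℝ) - qsMean (n - 1 - k) - ((n - 1 - k : ℕ) : ℝ) * z)
              / ((n - 1 - k : ℕ) : ℝ) := by
          field_simp
        rw [e, abs_div, Nat.abs_cast, div_le_iff₀ hm0]
        refine hb.trans ?_
        have : δ * ((1 - v) / 2 * n) ≤ δ * ((n - 1 - k : ℕ) : ℝ) := by gcongr
        have h0 : 0 ≤ δ * (1 - v) * n := by have := sub_pos.2 hv1; positivity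
        have h1 : 4 * (η * n) = δ * (1 - v) * n / 4 := by rw [hη]; ring
        linarith
  exact lt_of_lt_of_le (by positivity) (ge_of_tendsto (tendsto_scaledMass hμ _) hbound)

lemma exists_limToll_eq {h : ℝ} (hh : |h| ≤ 3 / 10) : ∃ v, 0 < v ∧ v < 1 ∧ limToll v = h := by
  have hhalf : limToll (1 / 2) = 1 - 2 * Real.log 2 := by
    rw [limToll, show (1 : ℝ) - 1 / 2 = 1 / 2 by norm_num, Real.negMulLog, one_div, Real.log_inv]
    ring
  rw [abs_le] at hh
  obtain ⟨v, hv, hvh⟩ := intermediate_value_Icc' (by norm_num : (0 : ℝ) ≤ 1 / 2)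
    continuous_limToll.continuousOn (show h ∈ Set.Icc (limToll (1 / 2)) (limToll 0) by
      rw [hhalf, limToll_zero]
      constructor <;> linarith [Real.log_two_gt_d9])
  refine ⟨v, lt_of_le_of_ne hv.1 ?_, by linarith [hv.2], hvh⟩
  rintro rfl
  rw [limToll_zero] at hvh
  linarith

lemma limDensity_pos (hμ : IsQuicksortLaw μ) (x : ℝ) : 0 < limDensity μ x := by
  obtain ⟨z, hz⟩ : ∃ z, 0 < limDensity μ z := by
    by_contra! h
    have h0 : limDensity μ = fun _ => 0 :=
      funext fun y => le_antisymm (h y) (limDensity_nonneg hμ y)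
    have := integral_limDensity hμ
    simp [h0] at this
  have hstep : ∀ (h : ℝ), |h| ≤ 3 / 10 → ∀ j : ℕ, 0 < limDensity μ (z + j * h) := by
    intro h hh j
    induction j with
    | zero => simpa using hz
    | succ j ih =>
      obtain ⟨v, hv0, hv1, hv⟩ := exists_limToll_eq hh
      have := limDensity_add_limToll_pos hμ ih hv0 hv1
      rw [hv] at this
      convert this using 2
      push_cast; ring
  obtain ⟨N, hN⟩ := exists_nat_gt (4 * |x - z|)
  have hN0 : (0 : ℝ) < N := lt_of_le_of_lt (by positivity) hN
  have := hstep ((x - z) / N) (by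
    rw [abs_div, Nat.abs_cast, div_le_iff₀ hN0]; linarith) N
  rwa [mul_div_cancel₀ _ hN0.ne', add_sub_cancel] at this

end Positivity

end QuickSort

/-- **Local limit theorem for QuickSort with rate.**  There exist a continuous, everywhere
positive probability density `f` and a constant `C` such that the normalized QuickSort
comparison counts `(Q_n - q_n)/n` converge weakly to the law with density `f`, and
`|P(Q_n = x) - n⁻¹ f((x - q_n)/n)| ≤ C n^{-19/18} log n` for all integers `n ≥ 2` and `x`. -/
theorem quicksort_local_limit_theorem_rate
    (μ : ℕ → Measure ℤ) (hμ : IsQuicksortLaw μ) :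
    ∃ f : ℝ → ℝ, Continuous f ∧ (∀ x : ℝ, 0 < f x) ∧ (∫ x : ℝ, f x) = 1 ∧
      ∃ C : ℝ,
        (∀ g : ℝ →ᵇ ℝ,
          Tendsto
            (fun n : ℕ => ∫ y, g y ∂((μ n).map (fun k : ℤ => ((k : ℝ) - meanZ (μ n)) / n)))
            atTop
            (nhds (∫ y, g y ∂((volume : Measure ℝ).withDensity
              (fun x => ENNReal.ofReal (f x)))))) ∧
        (∀ n : ℕ, 2 ≤ n → ∀ x : ℤ,
          |((μ n) {x}).toReal - (n : ℝ)⁻¹ * f (((x : ℝ) - meanZ (μ n)) / n)|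
            ≤ C * (n : ℝ) ^ (-19 / 18 : ℝ) * Real.log n) := by
  obtain ⟨C, hC0, hC⟩ := QuickSort.exists_abs_measure_singleton_sub_le hμ
  refine ⟨QuickSort.limDensity μ, QuickSort.continuous_limDensity hμ, QuickSort.limDensity_pos hμ,
    QuickSort.integral_limDensity hμ, C * 2, fun g => ?_, fun n hn x => ?_⟩
  · exact ProbabilityMeasure.tendsto_iff_forall_integral_tendsto.1
      (QuickSort.tendsto_probabilityMeasure hμ) g
  · rw [QuickSort.meanZ_eq hμ]
    refine (hC n (by omega) x).trans ?_
    rw [mul_assoc C, mul_assoc C]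
    exact mul_le_mul_of_nonneg_left (QuickSort.rpow_le_rpow_mul_log hn) hC0
end

section
/- Let r ≥ 20 be an even integer and let n ≥ 5r. Then ν_n({k ∈ ℕ : k ≤ n/(3r)}) ≤ e^{−n/(400r)}. -/
open MeasureTheory ProbabilityTheory

/-- Binary convolution of laws on `ℕ` (the law of the sum of independent variables). -/
noncomputable def mconvN (μ ν : Measure ℕ) : Measure ℕ :=
  μ.bind (fun x => ν.map (fun y => x + y))

/-- `ν k` is the law of `X_{k,r}`, the number of sublists of length between `r/2` and `r`
left after the first phase of the two-phase run of QuickSort on `k` keys. -/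
def IsPhaseOneLaw (r : ℕ) (ν : ℕ → Measure ℕ) : Prop :=
  (∀ k, IsProbabilityMeasure (ν k)) ∧
  (∀ k, k ≤ r / 2 - 1 → ν k = Measure.dirac 0) ∧
  (∀ k, r / 2 ≤ k → k ≤ r → ν k = Measure.dirac 1) ∧
  ∀ k : ℕ, r + 1 ≤ k →
    ν k = (k : ENNReal)⁻¹ • ∑ u ∈ Finset.Icc 1 k, mconvN (ν (u - 1)) (ν (k - u))

/-- Weights bounding the exponentially tilted Laplace transforms of the phase-one laws. -/
noncomputable def phaseOneWeight (h k : ℕ) : ℝ :=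
  if k < h then 5 / 4 else if k ≤ 2 * h then 2 / 3 else 1

/-- Additive corrections dominating the products of two weights. -/
noncomputable def phaseOneCorrection (h k : ℕ) : ℝ :=
  if k < h then 1 / 4 else if k ≤ 2 * h then -(1 / 4) else 0

lemma phaseOneWeight_nonneg (h k : ℕ) : 0 ≤ phaseOneWeight h k := by
  unfold phaseOneWeight
  split_ifs <;> norm_num

lemma phaseOneWeight_mul_le {h i j : ℕ} (hij : 2 * h ≤ i + j) :
    phaseOneWeight h i * phaseOneWeight h j
      ≤ 1 + phaseOneCorrection h i + phaseOneCorrection h j := by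
  unfold phaseOneWeight phaseOneCorrection
  split_ifs <;> first | omega | norm_num

lemma sum_phaseOneCorrection_nonpos {h k : ℕ} (hk : 2 * h + 1 ≤ k) :
    ∑ i ∈ Finset.range k, phaseOneCorrection h i ≤ 0 := by
  induction k, hk using Nat.le_induction with
  | base =>
    have hlow : ∀ i ∈ Finset.range h, phaseOneCorrection h i = 1 / 4 := fun i hi => by
      simp [phaseOneCorrection, Finset.mem_range.mp hi]
    have hmid : ∀ i ∈ Finset.range (h + 1), phaseOneCorrection h (h + i) = -(1 / 4) :=
      fun i hi => by
        have := Finset.mem_range.mp hi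
        simp only [phaseOneCorrection]
        rw [if_neg (by omega), if_pos (by omega)]
    rw [show 2 * h + 1 = h + (h + 1) by ring, Finset.sum_range_add,
      Finset.sum_congr rfl hlow, Finset.sum_congr rfl hmid]
    simp only [Finset.sum_const, Finset.card_range, nsmul_eq_mul]
    push_cast
    linarith
  | succ k hk ih =>
    have hzero : phaseOneCorrection h k = 0 := by
      simp only [phaseOneCorrection]
      rw [if_neg (by omega), if_neg (by omega)]
    rw [Finset.sum_range_succ, hzero, add_zero]
    exact ih

lemma sum_phaseOneWeight_mul_le {h k : ℕ} (hk : 2 * h + 1 ≤ k) :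
    ∑ u ∈ Finset.Icc 1 k, phaseOneWeight h (u - 1) * phaseOneWeight h (k - u) ≤ k := by
  have hIcc : Finset.Icc 1 k = Finset.Ico (0 + 1) (k + 1) := by
    ext u
    simp only [Finset.mem_Icc, Finset.mem_Ico]
    omega
  calc ∑ u ∈ Finset.Icc 1 k, phaseOneWeight h (u - 1) * phaseOneWeight h (k - u)
      = ∑ i ∈ Finset.range k, phaseOneWeight h i * phaseOneWeight h (k - 1 - i) := by
        rw [hIcc, ← Finset.sum_Ico_add', ← Finset.range_eq_Ico]
        refine Finset.sum_congr rfl fun i _ => ?_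
        rw [Nat.add_sub_cancel, show k - (i + 1) = k - 1 - i by omega]
    _ ≤ ∑ i ∈ Finset.range k,
          (1 + phaseOneCorrection h i + phaseOneCorrection h (k - 1 - i)) :=
        Finset.sum_le_sum fun i hi => by
          have := Finset.mem_range.mp hi
          exact phaseOneWeight_mul_le (by omega)
    _ = k + 2 * ∑ i ∈ Finset.range k, phaseOneCorrection h i := by
        rw [Finset.sum_add_distrib, Finset.sum_add_distrib, Finset.sum_range_reflect]
        simp only [Finset.sum_const, Finset.card_range, nsmul_eq_mul]
        ring
    _ ≤ k := by linarith [sum_phaseOneCorrection_nonpos hk]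

/-- The Laplace transform at `1` of a law on `ℕ`. -/
noncomputable def expTransform (μ : Measure ℕ) : ENNReal :=
  ∫⁻ x, ENNReal.ofReal (Real.exp (-(x : ℝ))) ∂μ

lemma expTransform_mconvN (μ ν : Measure ℕ) :
    expTransform (mconvN μ ν) = expTransform μ * expTransform ν := by
  unfold expTransform mconvN
  rw [Measure.lintegral_bind (Measurable.of_discrete).aemeasurable
    (Measurable.of_discrete).aemeasurable,
    ← lintegral_mul_const _ Measurable.of_discrete]
  refine lintegral_congr fun x => ?_
  rw [lintegral_map Measurable.of_discrete Measurable.of_discrete,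
    ← lintegral_const_mul _ Measurable.of_discrete]
  refine lintegral_congr fun y => ?_
  rw [← ENNReal.ofReal_mul (Real.exp_nonneg _), ← Real.exp_add]
  congr 2
  push_cast
  ring

lemma expTransform_dirac (m : ℕ) :
    expTransform (Measure.dirac m) = ENNReal.ofReal (Real.exp (-(m : ℝ))) := by
  simp [expTransform]

lemma IsPhaseOneLaw.expTransform_eq {r : ℕ} {ν : ℕ → Measure ℕ} (hν : IsPhaseOneLaw r ν)
    {k : ℕ} (hk : r + 1 ≤ k) :
    expTransform (ν k) = (k : ENNReal)⁻¹ *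
      ∑ u ∈ Finset.Icc 1 k, expTransform (ν (u - 1)) * expTransform (ν (k - u)) := by
  rw [hν.2.2.2 k hk]
  simp_rw [← expTransform_mconvN]
  simp only [expTransform, lintegral_smul_measure, lintegral_finsetSum_measure, smul_eq_mul]

lemma IsPhaseOneLaw.expTransform_le {r h : ℕ} {ν : ℕ → Measure ℕ} (hν : IsPhaseOneLaw r ν)
    (hrh : r = 2 * h) {a : ℝ} (ha : 0 ≤ a)
    (hlow : Real.exp (a * h) ≤ 5 / 4) (hmid : Real.exp (-1 + a * (2 * h + 1)) ≤ 2 / 3)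
    (k : ℕ) :
    expTransform (ν k) ≤ ENNReal.ofReal (Real.exp (-(a * (k + 1))) * phaseOneWeight h k) := by
  induction k using Nat.strong_induction_on with
  | _ k ih =>
    rcases lt_or_ge k h with hkh | hkh
    · rw [hν.2.1 k (by omega), expTransform_dirac]
      apply ENNReal.ofReal_le_ofReal
      have hexp : Real.exp (a * (k + 1)) ≤ 5 / 4 := by
        refine le_trans (Real.exp_le_exp.mpr ?_) hlow
        have : (k : ℝ) + 1 ≤ h := by exact_mod_cast hkh
        gcongr
      rw [Real.exp_neg (a * (k + 1)), inv_mul_eq_div, le_div_iff₀ (Real.exp_pos _)]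
      simpa [phaseOneWeight, hkh] using hexp
    rcases le_or_gt k (2 * h) with hk2 | hk2
    · rw [hν.2.2.1 k (by omega) (by omega), expTransform_dirac]
      apply ENNReal.ofReal_le_ofReal
      have hexp : Real.exp (-1 + a * (k + 1)) ≤ 2 / 3 := by
        refine le_trans (Real.exp_le_exp.mpr ?_) hmid
        have : (k : ℝ) ≤ 2 * h := by exact_mod_cast hk2
        gcongr
      rw [Real.exp_neg (a * (k + 1)), inv_mul_eq_div, le_div_iff₀ (Real.exp_pos _),
        ← Real.exp_add]
      simpa [phaseOneWeight, not_lt.mpr hkh, hk2] using hexp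
    · have hweight : phaseOneWeight h k = 1 := by
        simp only [phaseOneWeight]
        rw [if_neg (by omega), if_neg (by omega)]
      have hkpos : (0 : ℝ) < k := by exact_mod_cast (by omega : 0 < k)
      rw [hν.expTransform_eq (by omega), hweight, mul_one]
      have hsum : ∑ u ∈ Finset.Icc 1 k, expTransform (ν (u - 1)) * expTransform (ν (k - u))
          ≤ ENNReal.ofReal (∑ u ∈ Finset.Icc 1 k, Real.exp (-(a * (k + 1))) *
              (phaseOneWeight h (u - 1) * phaseOneWeight h (k - u))) := by
        rw [ENNReal.ofReal_sum_of_nonneg fun u _ => mul_nonneg (Real.exp_nonneg _)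
          (mul_nonneg (phaseOneWeight_nonneg _ _) (phaseOneWeight_nonneg _ _))]
        refine Finset.sum_le_sum fun u hu => ?_
        obtain ⟨hu1, huk⟩ := Finset.mem_Icc.mp hu
        refine (mul_le_mul' (ih (u - 1) (by omega)) (ih (k - u) (by omega))).trans_eq ?_
        rw [← ENNReal.ofReal_mul (mul_nonneg (Real.exp_nonneg _) (phaseOneWeight_nonneg _ _)),
          mul_mul_mul_comm, ← Real.exp_add, Nat.cast_sub hu1, Nat.cast_sub huk]
        congr 3
        push_cast
        ring
      calc (k : ENNReal)⁻¹ *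
            ∑ u ∈ Finset.Icc 1 k, expTransform (ν (u - 1)) * expTransform (ν (k - u))
          ≤ (k : ENNReal)⁻¹ * ENNReal.ofReal (k * Real.exp (-(a * (k + 1)))) := by
            gcongr
            refine hsum.trans (ENNReal.ofReal_le_ofReal ?_)
            rw [← Finset.mul_sum, mul_comm]
            exact mul_le_mul_of_nonneg_right (sum_phaseOneWeight_mul_le (by omega))
              (Real.exp_nonneg _)
        _ = ENNReal.ofReal (Real.exp (-(a * (k + 1)))) := by
            rw [ENNReal.ofReal_mul hkpos.le, ENNReal.ofReal_natCast, ← mul_assoc,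
              ENNReal.inv_mul_cancel (by exact_mod_cast hkpos.ne') (ENNReal.natCast_ne_top k),
              one_mul]

lemma measure_le_exp_mul_expTransform (μ : Measure ℕ) (x : ℝ) :
    μ {k : ℕ | (k : ℝ) ≤ x} ≤ ENNReal.ofReal (Real.exp x) * expTransform μ := by
  unfold expTransform
  rw [← lintegral_const_mul _ Measurable.of_discrete,
    ← lintegral_indicator_one (MeasurableSet.of_discrete)]
  refine lintegral_mono fun k => ?_
  refine Set.indicator_apply_le' (fun hk => ?_) fun _ => zero_le
  have hk' : (k : ℝ) ≤ x := hk
  rw [← ENNReal.ofReal_mul (Real.exp_nonneg _), ← Real.exp_add, Pi.one_apply,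
    ENNReal.one_le_ofReal, Real.one_le_exp_iff]
  linarith

/-- With high probability, the first phase of the two-phase QuickSort leaves more than
`n/(3r)` sublists of length between `r/2` and `r`. -/
theorem phase_one_lower_tail
    (r : ℕ) (hr_even : Even r) (hr : 20 ≤ r)
    (ν : ℕ → Measure ℕ) (hν : IsPhaseOneLaw r ν)
    (n : ℕ) (hn : 5 * r ≤ n) :
    ν n {k : ℕ | (k : ℝ) ≤ (n : ℝ) / (3 * r)}
      ≤ ENNReal.ofReal (Real.exp (-(n : ℝ) / (400 * r))) := by
  obtain ⟨h, hrh⟩ : ∃ h, r = 2 * h := hr_even.two_dvd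
  have hh : (10 : ℝ) ≤ h := by exact_mod_cast (by omega : 10 ≤ h)
  have hrR : (r : ℝ) = 2 * h := by exact_mod_cast hrh
  have hr0 : (0 : ℝ) < r := by linarith
  set a : ℝ := 403 / (1200 * r) with ha_def
  have ha : 0 < a := by positivity
  have har : a * r = 403 / 1200 := by
    rw [ha_def]
    field_simp
  have hah : a * h = 403 / 2400 := by
    rw [hrR] at har
    linarith
  have ha20 : a ≤ 403 / 24000 := by nlinarith
  have hlow : Real.exp (a * h) ≤ 5 / 4 := by
    rw [hah]
    have h1 := Real.add_one_le_exp (-(403 / 2400 : ℝ))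
    rw [Real.exp_neg] at h1
    rw [← inv_inv (Real.exp _)]
    exact (inv_anti₀ (by norm_num) h1).trans (by norm_num)
  have hmid : Real.exp (-1 + a * (2 * h + 1)) ≤ 2 / 3 := by
    have h1 := Real.add_one_le_exp (1 - a * (2 * h + 1))
    rw [show -1 + a * (2 * (h : ℝ) + 1) = -(1 - a * (2 * h + 1)) by ring, Real.exp_neg]
    have h2 : (3 / 2 : ℝ) ≤ Real.exp (1 - a * (2 * h + 1)) := by linarith
    exact (inv_anti₀ (by norm_num) h2).trans (by norm_num)
  have hweight : phaseOneWeight h n = 1 := by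
    simp only [phaseOneWeight]
    rw [if_neg (by omega), if_neg (by omega)]
  have hbound := hν.expTransform_le hrh ha.le hlow hmid n
  rw [hweight, mul_one] at hbound
  refine (measure_le_exp_mul_expTransform (ν n) _).trans ((mul_le_mul_right hbound _).trans ?_)
  rw [← ENNReal.ofReal_mul (Real.exp_nonneg _), ← Real.exp_add]
  refine ENNReal.ofReal_le_ofReal (Real.exp_le_exp.mpr ?_)
  have hsplit : (n : ℝ) / (3 * r) + n / (400 * r) = a * n := by
    rw [ha_def]
    field_simp
    ring
  rw [neg_div]
  linarith
end

section
/- Let r ≥ 2 be an even integer and let (ξ_k)_{k ≥ 0} be the sequence of real numbers determined by ξ_k = 0 for 0 ≤ k ≤ r/2 − 1, ξ_k = 1 for r/2 ≤ k ≤ r, and ξ_k = (2/k)·Σ_{i=0}^{k−1} ξ_i for k ≥ r + 1. Then ξ_k = (k + 1)/(r + 1) for every k ≥ r. -/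
/-- The expectations `ξ_k = E X_{k,r}` of the number of sublists of length between `r/2`
and `r` produced in the first phase of a two-phase run of QuickSort satisfy
`ξ_k = (k+1)/(r+1)` for every `k ≥ r`. -/
theorem xi_formula
    (r : ℕ) (hr_even : Even r) (hr : 2 ≤ r)
    (ξ : ℕ → ℝ)
    (h0 : ∀ k, k ≤ r / 2 - 1 → ξ k = 0)
    (h1 : ∀ k, r / 2 ≤ k → k ≤ r → ξ k = 1)
    (hrec : ∀ k : ℕ, r + 1 ≤ k → ξ k = (2 / (k : ℝ)) * ∑ i ∈ Finset.range k, ξ i) :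
    ∀ k : ℕ, r ≤ k → ξ k = ((k : ℝ) + 1) / ((r : ℝ) + 1) := by
  obtain ⟨m, rfl⟩ := hr_even
  have hdiv : (m + m) / 2 = m := by omega
  rw [hdiv] at h0 h1
  have hinit : ∑ i ∈ Finset.range (m + m + 1), ξ i = m + 1 := by
    rw [add_assoc, Finset.sum_range_add,
      Finset.sum_eq_zero fun i hi => h0 i (by have := Finset.mem_range.mp hi; omega),
      Finset.sum_congr rfl fun i hi =>
        h1 (m + i) (by omega) (by have := Finset.mem_range.mp hi; omega)]
    simp
  have hr_pos : (0 : ℝ) < ((m + m : ℕ) : ℝ) + 1 := by positivity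
  have hstep (k : ℕ) (hk : m + m + 1 ≤ k)
      (hsum : ∑ i ∈ Finset.range k, ξ i = k * (k + 1) / (2 * (((m + m : ℕ) : ℝ) + 1))) :
      ξ k = ((k : ℝ) + 1) / (((m + m : ℕ) : ℝ) + 1) := by
    have hk_pos : (0 : ℝ) < k := by exact_mod_cast (by omega : 0 < k)
    rw [hrec k hk, hsum]
    field_simp
  have hsum (k : ℕ) (hk : m + m + 1 ≤ k) :
      ∑ i ∈ Finset.range k, ξ i = k * (k + 1) / (2 * (((m + m : ℕ) : ℝ) + 1)) := by
    induction k, hk using Nat.le_induction with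
    | base =>
      rw [hinit]
      field_simp
      push_cast
      ring
    | succ k hk ih =>
      rw [Finset.sum_range_succ, hstep k hk ih, ih]
      field_simp
      push_cast
      ring
  intro k hk
  rcases hk.eq_or_lt with rfl | hlt
  · rw [h1 _ (by omega) le_rfl, div_self hr_pos.ne']
  · exact hstep k hlt (hsum k hlt)
end

section
/- Let r ≥ 20 be an even integer, let n ≥ 5r, and set s = ⌈n/(3r)⌉. Then there exist a probability space carrying a random variable Q with law μ_n, a σ-algebra 𝓕 on that space, an 𝓕-measurable random variable A and an integer-valued random variable B with Q = A + B, and an event E ∈ 𝓕 with P(E) ≥ 1 − e^{−n/(400r)}, such that for almost every point of E the conditional distribution of B given 𝓕 is the convolution of s probability measures μ_{r_1}, …, μ_{r_s}, where r_1, …, r_s are 𝓕-measurable random integers satisfying r/2 ≤ r_i ≤ r for each i. -/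
open MeasureTheory ProbabilityTheory

/-- Convolution of a finite family of laws on `ℤ`. -/
noncomputable def mconvFamZ : {s : ℕ} → (Fin s → Measure ℤ) → Measure ℤ
  | 0, _ => Measure.dirac 0
  | (_ + 1), ν => mconvZ (ν 0) (mconvFamZ (fun i => ν i.succ))

open scoped ENNReal

/-- The exponential-moment recursion closes up: a profile which is slightly above `1` on sizes
below `h` and sufficiently below `1` on `[h, 2h]` has self-convolution at most that of the
constant `1`. -/
theorem sum_mul_reflect_le {h N : ℕ} (hN : 2 * h ≤ N) (Z : ℕ → ℝ)
    (hZ : ∀ k, Z k = if k < h then 11 / 10 else if k ≤ 2 * h then 100 / 121 else 1) :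
    ∑ k ∈ Finset.range (N + 1), Z k * Z (N - k) ≤ N + 1 := by
  set α : ℕ → ℝ := fun k => if k < h then 1 / 10 else if k < 2 * h then -(1 / 10) else 0 with hα
  have hsum : ∑ k ∈ Finset.range (N + 1), α k = 0 := by
    obtain ⟨c, hc⟩ : ∃ c, N + 1 = h + h + c := ⟨N + 1 - (h + h), by lia⟩
    have h₁ : ∀ k ∈ Finset.range h, α k = 1 / 10 := fun k hk => by
      have := Finset.mem_range.1 hk
      simp only [hα]
      grind
    have h₂ : ∀ k ∈ Finset.range h, α (h + k) = -(1 / 10) := fun k hk => by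
      have := Finset.mem_range.1 hk
      simp only [hα]
      grind
    have h₃ : ∀ k ∈ Finset.range c, α (h + h + k) = 0 := fun k hk => by
      simp only [hα]
      grind
    rw [hc, Finset.sum_range_add, Finset.sum_range_add, Finset.sum_congr rfl h₁,
      Finset.sum_congr rfl h₂, Finset.sum_congr rfl h₃]
    simp
  calc ∑ k ∈ Finset.range (N + 1), Z k * Z (N - k)
      ≤ ∑ k ∈ Finset.range (N + 1), (1 + α k + α (N - k)) := by
        refine Finset.sum_le_sum fun k hk => ?_
        have hk := Finset.mem_range.1 hk
        rw [hZ, hZ]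
        simp only [hα]
        split_ifs <;> first | lia | norm_num
    _ = N + 1 := by
        have hrefl := Finset.sum_range_reflect α (N + 1)
        simp only [Nat.add_sub_cancel] at hrefl
        simp [Finset.sum_add_distrib, hsum, hrefl]

namespace PMF

variable {α β : Type*}

/-- The expectation of a nonnegative function under a discrete law. -/
noncomputable def expect (p : PMF α) (g : α → ℝ≥0∞) : ℝ≥0∞ := ∑' a, p a * g a

theorem expect_bind (p : PMF α) (f : α → PMF β) (g : β → ℝ≥0∞) :
    (p.bind f).expect g = p.expect fun a => (f a).expect g := by
  simp only [expect, bind_apply, ← ENNReal.tsum_mul_right, ← ENNReal.tsum_mul_left, mul_assoc]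
  exact ENNReal.tsum_comm

theorem expect_pure (a : α) (g : α → ℝ≥0∞) : (pure a).expect g = g a := by
  rw [expect, tsum_eq_single a]
  · simp
  · intro b hb
    simp [pure_apply_of_ne _ _ hb]

theorem expect_map (p : PMF α) (f : α → β) (g : β → ℝ≥0∞) :
    (p.map f).expect g = p.expect fun a => g (f a) := by
  rw [← bind_pure_comp, expect_bind]
  simp only [Function.comp_apply, expect_pure]

theorem expect_const (p : PMF α) (c : ℝ≥0∞) : (p.expect fun _ => c) = c := by
  rw [expect, ENNReal.tsum_mul_right, p.tsum_coe, one_mul]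

theorem expect_add (p : PMF α) (f g : α → ℝ≥0∞) :
    (p.expect fun a => f a + g a) = p.expect f + p.expect g := by
  simp only [expect, mul_add, ENNReal.tsum_add]

theorem expect_mul_left (p : PMF α) (c : ℝ≥0∞) (g : α → ℝ≥0∞) :
    (p.expect fun a => c * g a) = c * p.expect g := by
  simp only [expect, ← ENNReal.tsum_mul_left, mul_left_comm]

theorem expect_mul_right (p : PMF α) (c : ℝ≥0∞) (g : α → ℝ≥0∞) :
    (p.expect fun a => g a * c) = p.expect g * c := by
  simp only [mul_comm _ c, expect_mul_left]

theorem expect_mono (p : PMF α) {f g : α → ℝ≥0∞} (h : ∀ a, f a ≤ g a) :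
    p.expect f ≤ p.expect g :=
  ENNReal.tsum_le_tsum fun a => mul_le_mul_right (h a) _

theorem lintegral_toMeasure [MeasurableSpace α] [Countable α] [MeasurableSingletonClass α]
    (p : PMF α) (g : α → ℝ≥0∞) : ∫⁻ a, g a ∂p.toMeasure = p.expect g := by
  rw [lintegral_countable', expect]
  refine tsum_congr fun a => ?_
  rw [toMeasure_apply_singleton _ _ (measurableSet_singleton a), mul_comm]

theorem toMeasure_eq_expect [MeasurableSpace α] (p : PMF α) {s : Set α} (hs : MeasurableSet s) :
    p.toMeasure s = p.expect (s.indicator 1) := by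
  rw [toMeasure_apply _ hs, expect]
  refine tsum_congr fun a => ?_
  by_cases ha : a ∈ s <;> simp [ha]

theorem ae_mem_support [MeasurableSpace α] [DiscreteMeasurableSpace α] (p : PMF α) :
    ∀ᵐ a ∂p.toMeasure, a ∈ p.support := by
  rw [ae_iff, toMeasure_apply_eq_zero_iff _ .of_discrete]
  exact Set.disjoint_left.2 fun a ha ha' => ha' ha

theorem expect_uniformOfFinset (s : Finset α) (hs : s.Nonempty) (g : α → ℝ≥0∞) :
    (uniformOfFinset s hs).expect g = (s.card : ℝ≥0∞)⁻¹ * ∑ a ∈ s, g a := by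
  rw [expect, tsum_eq_sum (s := s), Finset.mul_sum]
  · exact Finset.sum_congr rfl fun a ha => by rw [uniformOfFinset_apply_of_mem hs ha]
  · intro a ha
    simp [ha]

end PMF

theorem mconvZ_toMeasure (p q : PMF ℤ) :
    mconvZ p.toMeasure q.toMeasure = (p.bind fun x => q.map (x + ·)).toMeasure := by
  ext t ht
  rw [mconvZ, Measure.bind_apply ht Measurable.of_discrete.aemeasurable,
    PMF.toMeasure_bind_apply _ _ _ ht, PMF.lintegral_toMeasure, PMF.expect]
  refine tsum_congr fun x => ?_
  rw [PMF.toMeasure_map (fun y : ℤ => x + y) q .of_discrete]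

/-- The law of the sum of independent QuickSort costs for sublists of the given sizes. -/
noncomputable def quicksortSum (m : ℕ → PMF ℤ) : List ℕ → PMF ℤ
  | [] => PMF.pure 0
  | k :: l => (m k).bind fun x => (quicksortSum m l).map (x + ·)

theorem quicksortSum_append (m : ℕ → PMF ℤ) (l l' : List ℕ) :
    quicksortSum m (l ++ l') =
      (quicksortSum m l).bind fun x => (quicksortSum m l').map (x + ·) := by
  induction l with
  | nil =>
    simp only [List.nil_append, quicksortSum, PMF.pure_bind, zero_add]
    exact (PMF.map_id _).symm
  | cons k l ih =>
    simp [quicksortSum, ih, PMF.map_bind, PMF.bind_map, PMF.map_comp, Function.comp_def, add_assoc]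

theorem quicksortSum_ofFn (m : ℕ → PMF ℤ) {s : ℕ} (f : Fin s → ℕ) :
    (quicksortSum m (List.ofFn f)).toMeasure = mconvFamZ fun i => (m (f i)).toMeasure := by
  induction s with
  | zero => simp [quicksortSum, mconvFamZ, PMF.toMeasure_pure]
  | succ s ih => rw [List.ofFn_succ, quicksortSum, mconvFamZ, ← ih, mconvZ_toMeasure]

/-- The law of `a + X₁ + ⋯ + X_j` where `(a, [r₁, …, r_j])` has law `D` and, given this pair, the
`X_i` are independent QuickSort costs of sizes `r_i`. -/
noncomputable def mixtureLaw (m : ℕ → PMF ℤ) (D : PMF (ℤ × List ℕ)) : PMF ℤ :=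
  D.bind fun p => (quicksortSum m p.2).map (p.1 + ·)

theorem Icc_one_nonempty {n : ℕ} (hn : 2 ≤ n) : (Finset.Icc 1 n).Nonempty :=
  Finset.nonempty_Icc.2 (by lia)

/-- The distributional QuickSort recursion for a sequence of discrete laws. -/
def QuicksortRec (m : ℕ → PMF ℤ) : Prop :=
  ∀ (n : ℕ) (hn : 2 ≤ n), m n =
    (PMF.uniformOfFinset (Finset.Icc 1 n) (Icc_one_nonempty hn)).bind fun u =>
      (m (u - 1)).bind fun x => (m (n - u)).map fun y => x + y + ((n : ℤ) - 1)

theorem IsQuicksortLaw.exists_pmf {μ : ℕ → Measure ℤ} (hμ : IsQuicksortLaw μ) :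
    ∃ m : ℕ → PMF ℤ, (∀ n, (m n).toMeasure = μ n) ∧ QuicksortRec m := by
  obtain ⟨hprob, -, -, hrec⟩ := hμ
  refine ⟨fun n => (μ n).toPMF, fun n => Measure.toPMF_toMeasure _, fun n hn => ?_⟩
  rw [← PMF.toMeasure_inj, Measure.toPMF_toMeasure, hrec n hn]
  ext t ht
  rw [PMF.toMeasure_eq_expect _ ht, PMF.expect_bind, PMF.expect_uniformOfFinset,
    Measure.smul_apply, Measure.finsetSum_apply, Nat.card_Icc, Nat.add_sub_cancel, smul_eq_mul]
  refine congrArg _ (Finset.sum_congr rfl fun u _ => ?_)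
  rw [← PMF.toMeasure_eq_expect _ ht, ← Measure.toPMF_toMeasure (μ (u - 1)),
    ← Measure.toPMF_toMeasure (μ (n - u)), mconvZ_toMeasure,
    PMF.toMeasure_map (fun x : ℤ => x + ((n : ℤ) - 1)) _ .of_discrete]
  simp only [PMF.map_bind, PMF.map_comp, Function.comp_def]

/-- Truncating the list of sizes to its first `s` entries, the costs of the others being
absorbed into the first coordinate. -/
noncomputable def absorbTail (m : ℕ → PMF ℤ) (s : ℕ) (D : PMF (ℤ × List ℕ)) :
    PMF (ℤ × List ℕ) :=
  D.bind fun p => (quicksortSum m (p.2.drop s)).map fun c => (p.1 + c, p.2.take s)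

theorem exists_of_mem_support_absorbTail {m : ℕ → PMF ℤ} {s : ℕ} {D : PMF (ℤ × List ℕ)}
    {a : ℤ × List ℕ} (ha : a ∈ (absorbTail m s D).support) :
    ∃ b ∈ D.support, a.2 = b.2.take s := by
  simp only [absorbTail, PMF.mem_support_bind_iff, PMF.mem_support_map_iff] at ha
  obtain ⟨b, hb, c, -, rfl⟩ := ha
  exact ⟨b, hb, rfl⟩

theorem one_le_expect_absorbTail_add (m : ℕ → PMF ℤ) (s : ℕ) (D : PMF (ℤ × List ℕ)) :
    1 ≤ (absorbTail m s D).expect ({a | a.2.length = s}.indicator 1) +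
      D.expect ({a | a.2.length < s}.indicator 1) := by
  rw [absorbTail, PMF.expect_bind, ← PMF.expect_add, ← D.expect_const 1]
  refine D.expect_mono fun a => ?_
  rw [PMF.expect_map]
  rcases lt_or_ge a.2.length s with ha | ha <;> simp [Set.indicator, ha, PMF.expect_const]

theorem mixtureLaw_absorbTail (m : ℕ → PMF ℤ) (s : ℕ) (D : PMF (ℤ × List ℕ)) :
    mixtureLaw m (absorbTail m s D) = mixtureLaw m D := by
  simp only [mixtureLaw, absorbTail, PMF.bind_bind, PMF.bind_map, Function.comp_def]
  refine congrArg _ (funext fun p => ?_)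
  conv_rhs => rw [← List.take_append_drop s p.2, quicksortSum_append]
  simp only [← PMF.bind_pure_comp, PMF.bind_bind, PMF.pure_bind, Function.comp_def]
  rw [PMF.bind_comm]
  simp only [add_comm, add_left_comm]

/-- The weight profile of `sum_mul_reflect_le`. -/
noncomputable def momentProfile (h k : ℕ) : ℝ :=
  if k < h then 11 / 10 else if k ≤ 2 * h then 100 / 121 else 1

theorem momentProfile_nonneg (h k : ℕ) : 0 ≤ momentProfile h k := by
  unfold momentProfile
  split_ifs <;> norm_num

/-- The exponential decay rate, in the number of keys, of the moment bound. -/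
noncomputable def momentRate (h : ℕ) : ℝ := 2 * Real.log (11 / 10) / (2 * h + 1)

theorem momentProfile_base_lt {h n : ℕ} (hn : n < h) :
    1 ≤ momentProfile h n * Real.exp (-(momentRate h * (n + 1))) := by
  have hlog : 0 ≤ Real.log (11 / 10) := Real.log_nonneg (by norm_num)
  have hn' : (n : ℝ) + 1 ≤ h := by exact_mod_cast hn
  have hle : momentRate h * (n + 1) ≤ Real.log (11 / 10) := by
    rw [momentRate, div_mul_eq_mul_div, div_le_iff₀ (by positivity)]
    nlinarith
  rw [momentProfile, if_pos hn]
  calc (1 : ℝ) = 11 / 10 * Real.exp (-Real.log (11 / 10)) := by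
        rw [Real.exp_neg, Real.exp_log (by norm_num)]
        norm_num
    _ ≤ _ := by gcongr

theorem momentProfile_base_le {h n : ℕ} (hn : h ≤ n) (hn' : n ≤ 2 * h) :
    (10 / 11) ^ 4 ≤ momentProfile h n * Real.exp (-(momentRate h * (n + 1))) := by
  have hlog : 0 ≤ Real.log (11 / 10) := Real.log_nonneg (by norm_num)
  have hcast : (n : ℝ) ≤ 2 * h := by exact_mod_cast hn'
  have hle : momentRate h * (n + 1) ≤ 2 * Real.log (11 / 10) := by
    rw [momentRate, div_mul_eq_mul_div, div_le_iff₀ (by positivity)]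
    nlinarith
  rw [momentProfile, if_neg (by lia), if_pos hn']
  calc ((10 : ℝ) / 11) ^ 4 = 100 / 121 * Real.exp (-(2 * Real.log (11 / 10))) := by
        rw [Real.exp_neg, two_mul, Real.exp_add, Real.exp_log (by norm_num)]
        norm_num
    _ ≤ _ := by gcongr

theorem inv_mul_sum_momentProfile_le {h n : ℕ} (hn : 2 * h < n) :
    (n : ℝ≥0∞)⁻¹ * ∑ u ∈ Finset.Icc 1 n,
      ENNReal.ofReal (momentProfile h (u - 1) *
        Real.exp (-(momentRate h * ((u - 1 : ℕ) + 1)))) *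
      ENNReal.ofReal (momentProfile h (n - u) *
        Real.exp (-(momentRate h * ((n - u : ℕ) + 1)))) ≤
    ENNReal.ofReal (momentProfile h n * Real.exp (-(momentRate h * (n + 1)))) := by
  obtain ⟨N, rfl⟩ : ∃ N, n = N + 1 := ⟨n - 1, by lia⟩
  have hterm : ∀ k ∈ Finset.range (N + 1),
      ENNReal.ofReal (momentProfile h (1 + k - 1) *
        Real.exp (-(momentRate h * ((1 + k - 1 : ℕ) + 1)))) *
      ENNReal.ofReal (momentProfile h (N + 1 - (1 + k)) *
        Real.exp (-(momentRate h * ((N + 1 - (1 + k) : ℕ) + 1)))) =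
      ENNReal.ofReal (momentProfile h k * momentProfile h (N - k) *
        Real.exp (-(momentRate h * ((N + 1 : ℕ) + 1)))) := by
    intro k hk
    have hk := Finset.mem_range.1 hk
    rw [← ENNReal.ofReal_mul (mul_nonneg (momentProfile_nonneg _ _) (Real.exp_nonneg _)),
      mul_mul_mul_comm, ← Real.exp_add, show 1 + k - 1 = k by lia,
      show N + 1 - (1 + k) = N - k by lia, Nat.cast_sub (by lia : k ≤ N)]
    congr 3
    push_cast
    ring
  rw [← Finset.Ico_add_one_right_eq_Icc, Finset.sum_Ico_eq_sum_range, Nat.add_sub_cancel,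
    Finset.sum_congr rfl hterm, ← ENNReal.ofReal_sum_of_nonneg, ← Finset.sum_mul,
    momentProfile, if_neg (by lia), if_neg (by lia), one_mul]
  · refine (ENNReal.inv_mul_le_iff (by simp) (by simp)).2 ?_
    rw [← ENNReal.ofReal_natCast, ← ENNReal.ofReal_mul (by positivity)]
    refine ENNReal.ofReal_le_ofReal (mul_le_mul_of_nonneg_right ?_ (Real.exp_nonneg _))
    exact_mod_cast sum_mul_reflect_le (by lia) (momentProfile h) fun _ => rfl
  · intro k _
    exact mul_nonneg (mul_nonneg (momentProfile_nonneg _ _) (momentProfile_nonneg _ _))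
      (Real.exp_nonneg _)

/-- Stopping the QuickSort recursion tree at the sublists of size at most `2h` writes the cost
as a fixed part plus independent QuickSort costs with sizes in `[h, 2h]`, and the number of
these sublists has an exponentially small negative exponential moment. -/
theorem QuicksortRec.exists_mixture {m : ℕ → PMF ℤ} (hm : QuicksortRec m) {h : ℕ} (hh : 1 ≤ h)
    (n : ℕ) :
    ∃ D : PMF (ℤ × List ℕ), mixtureLaw m D = m n ∧
      (∀ p ∈ D.support, ∀ k ∈ p.2, h ≤ k ∧ k ≤ 2 * h) ∧
      D.expect (fun p => ENNReal.ofReal ((10 / 11) ^ 4) ^ p.2.length) ≤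
        ENNReal.ofReal (momentProfile h n * Real.exp (-(momentRate h * (n + 1)))) := by
  induction n using Nat.strong_induction_on with
  | _ n ih =>
  rcases lt_or_ge n h with hnh | hnh
  · refine ⟨(m n).map fun x => (x, []), ?_, ?_, ?_⟩
    · simp [mixtureLaw, PMF.bind_map, Function.comp_def, quicksortSum, PMF.pure_map]
    · simp
    · simpa [PMF.expect_map, PMF.expect_const] using momentProfile_base_lt hnh
  rcases le_or_gt n (2 * h) with hn | hn
  · refine ⟨PMF.pure (0, [n]), ?_, ?_, ?_⟩
    · simp only [mixtureLaw, PMF.pure_bind, quicksortSum, PMF.pure_map, zero_add, add_zero,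
        PMF.bind_pure]
      exact PMF.map_id _
    · simp [hnh, hn]
    · simpa [PMF.expect_pure] using
        ENNReal.ofReal_le_ofReal (momentProfile_base_le hnh hn)
  have hD : ∀ k, ∃ D : PMF (ℤ × List ℕ), k < n → mixtureLaw m D = m k ∧
      (∀ p ∈ D.support, ∀ k ∈ p.2, h ≤ k ∧ k ≤ 2 * h) ∧
      D.expect (fun p => ENNReal.ofReal ((10 / 11) ^ 4) ^ p.2.length) ≤
        ENNReal.ofReal (momentProfile h k * Real.exp (-(momentRate h * (k + 1)))) := fun k => by
    by_cases hk : k < n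
    · exact (ih k hk).imp fun D hD _ => hD
    · exact ⟨PMF.pure (0, []), fun hk' => absurd hk' hk⟩
  choose D hD using hD
  have hn2 : 2 ≤ n := by lia
  refine ⟨(PMF.uniformOfFinset (Finset.Icc 1 n) (Icc_one_nonempty hn2)).bind fun u =>
    (D (u - 1)).bind fun p => (D (n - u)).map fun p' =>
      (p.1 + p'.1 + ((n : ℤ) - 1), p.2 ++ p'.2), ?_, ?_, ?_⟩
  · rw [hm n hn2]
    simp only [mixtureLaw, PMF.bind_bind, PMF.bind_map, Function.comp_def]
    ext z
    rw [PMF.bind_apply, PMF.bind_apply]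
    refine tsum_congr fun u => ?_
    by_cases hu : u ∈ Finset.Icc 1 n
    · have hu := Finset.mem_Icc.1 hu
      congr 2
      rw [← (hD (u - 1) (by lia)).1, ← (hD (n - u) (by lia)).1]
      simp only [mixtureLaw, quicksortSum_append, ← PMF.bind_pure_comp, PMF.bind_bind,
        PMF.pure_bind, Function.comp_def]
      refine congrArg _ (funext fun p => ?_)
      rw [PMF.bind_comm]
      simp only [add_assoc, add_comm, add_left_comm]
    · rw [PMF.uniformOfFinset_apply_of_notMem _ hu, zero_mul, zero_mul]
  · intro p hp k hk
    simp only [PMF.mem_support_bind_iff, PMF.mem_support_map_iff,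
      PMF.mem_support_uniformOfFinset_iff] at hp
    obtain ⟨u, hu, p₁, hp₁, p₂, hp₂, rfl⟩ := hp
    have hu := Finset.mem_Icc.1 hu
    rcases List.mem_append.1 hk with hk | hk
    · exact (hD (u - 1) (by lia)).2.1 p₁ hp₁ k hk
    · exact (hD (n - u) (by lia)).2.1 p₂ hp₂ k hk
  · simp only [PMF.expect_bind, PMF.expect_map, List.length_append, pow_add,
      PMF.expect_mul_left, PMF.expect_mul_right, PMF.expect_uniformOfFinset, Nat.card_Icc,
      Nat.add_sub_cancel]
    refine le_trans ?_ (inv_mul_sum_momentProfile_le hn)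
    gcongr with u hu
    · have hu := Finset.mem_Icc.1 hu
      exact (hD (u - 1) (by lia)).2.2
    · have hu := Finset.mem_Icc.1 hu
      exact (hD (n - u) (by lia)).2.2

/-- Outside an exponentially small event, the recursion tree has at least `s` sublists. -/
theorem expect_length_lt_le {h n s : ℕ} (hh : 10 ≤ h) (hn : 2 * h < n)
    (hsn : (s : ℝ) - 1 ≤ n / (3 * (2 * h : ℕ))) {D : PMF (ℤ × List ℕ)}
    (hD : D.expect (fun p => ENNReal.ofReal ((10 / 11) ^ 4) ^ p.2.length) ≤
      ENNReal.ofReal (momentProfile h n * Real.exp (-(momentRate h * (n + 1))))) :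
    D.expect ({p | p.2.length < s}.indicator 1) ≤
      ENNReal.ofReal (Real.exp (-(n : ℝ) / (400 * (2 * h : ℕ)))) := by
  set ℓ := Real.log (11 / 10) with hℓ
  have hw : ((10 : ℝ) / 11) ^ 4 = Real.exp (-(4 * ℓ)) := by
    rw [hℓ, ← Real.log_rpow (by norm_num), ← Real.log_inv, Real.exp_log (by positivity)]
    norm_num
  have hℓ0 : 1 / 11 ≤ ℓ := by
    have := Real.one_sub_inv_le_log_of_pos (show (0 : ℝ) < 11 / 10 by norm_num)
    norm_num at this ⊢
    linarith
  have hmarkov : ∀ p : ℤ × List ℕ, Set.indicator {p | p.2.length < s} 1 p ≤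
      ENNReal.ofReal (Real.exp (4 * ℓ * (s - 1))) *
        ENNReal.ofReal ((10 / 11) ^ 4) ^ p.2.length := by
    intro p
    refine Set.indicator_apply_le' (fun hp => ?_) fun _ => zero_le
    have hp' : (p.2.length : ℝ) + 1 ≤ s := by exact_mod_cast hp
    rw [hw, ← ENNReal.ofReal_pow (Real.exp_nonneg _), ← Real.exp_nat_mul,
      ← ENNReal.ofReal_mul (Real.exp_nonneg _), ← Real.exp_add, Pi.one_apply]
    refine ENNReal.one_le_ofReal.2 (Real.one_le_exp ?_)
    nlinarith
  refine (D.expect_mono hmarkov).trans ?_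
  rw [D.expect_mul_left]
  refine (mul_le_mul_right hD _).trans ?_
  rw [← ENNReal.ofReal_mul (Real.exp_nonneg _), momentProfile, if_neg (by lia),
    if_neg (by lia), one_mul, ← Real.exp_add]
  refine ENNReal.ofReal_le_ofReal (Real.exp_le_exp.2 ?_)
  have hh' : (10 : ℝ) ≤ h := by exact_mod_cast hh
  have hn0 : (0 : ℝ) ≤ n := Nat.cast_nonneg n
  set x : ℝ := n / (2 * h : ℕ) with hx
  have hx0 : 0 ≤ x := by positivity
  have h₁ : (s : ℝ) - 1 ≤ x / 3 := by
    refine hsn.trans_eq ?_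
    rw [hx, div_div, mul_comm]
  have h₂ : 2 * (20 / 21 * x) * ℓ ≤ momentRate h * (n + 1) := by
    have : 20 / 21 * x ≤ (n + 1) / (2 * h + 1) := by
      rw [hx, le_div_iff₀ (by positivity)]
      push_cast
      rw [← mul_div_assoc, div_mul_eq_mul_div, div_le_iff₀ (by positivity)]
      nlinarith
    calc 2 * (20 / 21 * x) * ℓ ≤ 2 * ((n + 1) / (2 * h + 1)) * ℓ := by gcongr
      _ = momentRate h * (n + 1) := by rw [momentRate]; ring
  have h₃ : -(n : ℝ) / (400 * (2 * h : ℕ)) = -(x / 400) := by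
    rw [hx]; ring
  rw [h₃]
  nlinarith [mul_le_mul_of_nonneg_left h₁ (show 0 ≤ 4 * ℓ by linarith),
    mul_le_mul_of_nonneg_left hℓ0 hx0]

/-- **Decomposition of QuickSort.** For even `r ≥ 20` and `n ≥ 5r`, with `s = ⌈n/(3r)⌉`,
one may realize `Q_n = A + B` with `A` measurable w.r.t. a σ-algebra `𝓕` and, on an
`𝓕`-measurable event of probability at least `1 - e^{-n/(400r)}`, the conditional
distribution of `B` given `𝓕` is the convolution of `s` QuickSort laws `μ_{r_1}, …, μ_{r_s}`
with `𝓕`-measurable sizes `r/2 ≤ r_i ≤ r`. -/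
theorem quicksort_decomposition
    (μ : ℕ → Measure ℤ) (hμ : IsQuicksortLaw μ)
    (r : ℕ) (hr_even : Even r) (hr : 20 ≤ r)
    (n : ℕ) (hn : 5 * r ≤ n)
    (s : ℕ) (hs : s = ⌈(n : ℝ) / (3 * r)⌉₊) :
    ∃ (Ω : Type) (mΩ : MeasurableSpace Ω) (P : Measure Ω),
      IsProbabilityMeasure P ∧
      ∃ (F : MeasurableSpace Ω), F ≤ mΩ ∧
      ∃ (Q A B : Ω → ℤ) (R : Fin s → Ω → ℕ) (E : Set Ω) (κ : Ω → Measure ℤ),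
        Measurable[mΩ] Q ∧ @Measure.map Ω ℤ mΩ _ Q P = μ n ∧
        Measurable[F] A ∧ Measurable[mΩ] B ∧
        (∀ ω, Q ω = A ω + B ω) ∧
        MeasurableSet[F] E ∧
        1 - ENNReal.ofReal (Real.exp (-(n : ℝ) / (400 * r))) ≤ P E ∧
        (∀ i, Measurable[F] (R i)) ∧
        (∀ i ω, r / 2 ≤ R i ω ∧ R i ω ≤ r) ∧
        -- `κ` is the conditional distribution (regular conditional probability
        -- distribution) of `B` given `F`:
        (∀ᵐ ω ∂P, IsProbabilityMeasure (κ ω)) ∧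
        (∀ t : Set ℤ, MeasurableSet t → Measurable[F] (fun ω => κ ω t)) ∧
        (∀ t : Set ℤ, MeasurableSet t → ∀ G : Set Ω, MeasurableSet[F] G →
          P (G ∩ B ⁻¹' t) = ∫⁻ ω in G, κ ω t ∂P) ∧
        -- on almost every point of `E` it is the asserted convolution:
        (∀ᵐ ω ∂P, ω ∈ E → κ ω = mconvFamZ (fun i => μ (R i ω))) := by
  obtain ⟨h, rfl⟩ := even_iff_two_dvd.1 hr_even
  obtain ⟨m, hm, hrec⟩ := hμ.exists_pmf
  obtain ⟨D, hlaw, hsupp, hmom⟩ := hrec.exists_mixture (h := h) (by lia) n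
  have hs_lt : (s : ℝ) - 1 ≤ n / (3 * (2 * h : ℕ)) := by
    have := Nat.ceil_lt_add_one (show (0 : ℝ) ≤ n / (3 * (2 * h : ℕ)) by positivity)
    rw [← hs] at this
    linarith
  have htail := expect_length_lt_le (by lia) (by lia) hs_lt hmom
  set D' := absorbTail m s D with hD'
  let _ : MeasurableSpace (List ℕ) := ⊤
  have : DiscreteMeasurableSpace (List ℕ) := ⟨fun _ => trivial⟩
  let p : PMF ((ℤ × List ℕ) × ℤ) := D'.bind fun a => (quicksortSum m a.2).map fun b => (a, b)
  have hfst : Measurable[MeasurableSpace.comap (Prod.fst : (ℤ × List ℕ) × ℤ → ℤ × List ℕ) ⊤, ⊤]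
      (Prod.fst : (ℤ × List ℕ) × ℤ → ℤ × List ℕ) := comap_measurable _
  let size : ℕ → (ℤ × List ℕ) → ℕ := fun i a =>
    if h ≤ a.2.getD i h ∧ a.2.getD i h ≤ 2 * h then a.2.getD i h else h
  refine ⟨(ℤ × List ℕ) × ℤ, inferInstance, p.toMeasure, inferInstance,
    MeasurableSpace.comap Prod.fst ⊤, fun _ _ => .of_discrete,
    fun ω => ω.1.1 + ω.2, fun ω => ω.1.1, fun ω => ω.2, fun i ω => size i ω.1,
    Prod.fst ⁻¹' {a | a.2.length = s}, fun ω => (quicksortSum m ω.1.2).toMeasure,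
    .of_discrete, ?_, measurable_from_top.comp hfst, .of_discrete, fun _ => rfl,
    ⟨_, trivial, rfl⟩, ?_, fun i => (measurable_from_top (f := size i)).comp hfst, ?_,
    Filter.Eventually.of_forall fun _ => inferInstance, ?_, ?_, ?_⟩
  · rw [PMF.toMeasure_map _ p .of_discrete, ← hm, ← hlaw, ← mixtureLaw_absorbTail m s D]
    simp only [p, mixtureLaw, PMF.map_bind, PMF.map_comp, Function.comp_def, hD']
  · refine tsub_le_iff_right.2 ((one_le_expect_absorbTail_add m s D).trans ?_)
    refine add_le_add (le_of_eq ?_) htail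
    rw [PMF.toMeasure_eq_expect _ (DiscreteMeasurableSpace.forall_measurableSet _)]
    simp only [p, PMF.expect_bind, PMF.expect_map, hD']
    refine congrArg _ (funext fun a => ?_)
    exact (PMF.expect_const _ _).symm
  · intro i ω
    simp only [size]
    split_ifs <;> lia
  · intro t _
    exact (measurable_from_top (f := fun a : ℤ × List ℕ => (quicksortSum m a.2).toMeasure t)).comp hfst
  · rintro t - _ ⟨G, -, rfl⟩
    rw [← lintegral_indicator .of_discrete, PMF.lintegral_toMeasure,
      PMF.toMeasure_eq_expect _ .of_discrete]
    simp only [p, PMF.expect_bind, PMF.expect_map]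
    refine congrArg _ (funext fun a => ?_)
    by_cases ha : a ∈ G
    · simp only [Set.indicator, Set.mem_preimage, Set.mem_inter_iff, ha, true_and, if_true,
        PMF.expect_const]
      rw [PMF.toMeasure_eq_expect _ (DiscreteMeasurableSpace.forall_measurableSet t)]
      refine congrArg _ (funext fun b => ?_)
      by_cases hb : b ∈ t <;> simp [ha, hb]
    · simp [ha, PMF.expect_const, Set.indicator]
  · filter_upwards [p.ae_mem_support] with ω hω hlen
    simp only [p, PMF.mem_support_bind_iff, PMF.mem_support_map_iff] at hω
    obtain ⟨a, ha, b, -, rfl⟩ := hω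
    obtain ⟨c, hc, hac⟩ := exists_of_mem_support_absorbTail ha
    have hlen : a.2.length = s := hlen
    have hofFn : a.2 = List.ofFn fun i : Fin s => size i a := by
      refine List.ext_getElem (by simp [hlen]) fun i hi _ => ?_
      have hmem := hsupp c hc a.2[i]
        (List.mem_of_mem_take ((List.Perm.of_eq hac).subset (List.getElem_mem hi)))
      simp [size, List.getElem?_eq_getElem hi, hmem]
    simp only [← hm]
    rw [← quicksortSum_ofFn m fun i : Fin s => size i a, ← hofFn]
end
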